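/- Let d ≥ 2 and p > p_c. There exists a constant c > 0 such that, Q-almost surely on the event {|C| = +∞}, for all sufficiently large r and all n ≥ r: P_0^ω(sup_{0 ≤ i ≤ n} D(0, X_i) ≤ r) ≥ exp(−c(r + n/r^2)). -/

import Mathlib

open MeasureTheory
open scoped ENNReal

namespace Perco

/-- Vertices of the lattice `Z^d`. -/
abbrev Zd (d : ℕ) := Fin d → ℤ

/-- A percolation configuration: each (unordered) edge of the lattice is open or closed.
(Only the values on nearest-neighbour pairs matter.) -/
abbrev Config (d : ℕ) := Sym2 (Zd d) → Bool

/-- Lattice adjacency: `(x,y) ∈ E^d`. -/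
def latAdj {d : ℕ} (x y : Zd d) : Prop := (∑ i, |x i - y i|) = 1

/-- Open adjacency in the configuration `ω`. -/
def openAdj {d : ℕ} (ω : Config d) (x y : Zd d) : Prop :=
  latAdj x y ∧ ω s(x, y) = true

/-- `C`: the open cluster of the origin. -/
def cluster {d : ℕ} (ω : Config d) : Set (Zd d) :=
  {y | Relation.ReflTransGen (openAdj ω) 0 y}

/-- `Q` is the product measure making the edge states i.i.d. Bernoulli(p). -/
def IsBernoulli {d : ℕ} (p : ℝ) (Q : Measure (Config d)) : Prop :=
  IsProbabilityMeasure Q ∧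
    ∀ (s : Finset (Sym2 (Zd d))) (f : Sym2 (Zd d) → Bool),
      Q {ω : Config d | ∀ e ∈ s, ω e = f e} =
        ∏ e ∈ s, (if f e then ENNReal.ofReal p else ENNReal.ofReal (1 - p))

/-- The critical probability `p_c`. -/
noncomputable def pc (d : ℕ) : ℝ :=
  sSup {p : ℝ | 0 ≤ p ∧ p ≤ 1 ∧
    ∀ Q : Measure (Config d), IsBernoulli p Q → Q {ω | (cluster ω).Infinite} = 0}

/-- The box `B_n = [-n,n]^d`. -/
def box (d n : ℕ) : Set (Zd d) := {x | ∀ i, |x i| ≤ (n : ℤ)}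

/-- `C_n`: the connected component of `0` in `C ∩ B_n`. -/
def clusterN {d : ℕ} (ω : Config d) (n : ℕ) : Set (Zd d) :=
  {y | Relation.ReflTransGen
    (fun a b => openAdj ω a b ∧ a ∈ box d n ∧ b ∈ box d n) 0 y}

/-- `A` is connected in the open subgraph. -/
def ConnOpen {d : ℕ} (ω : Config d) (A : Set (Zd d)) : Prop :=
  ∀ x ∈ A, ∀ y ∈ A,
    Relation.ReflTransGen (fun a b => openAdj ω a b ∧ a ∈ A ∧ b ∈ A) x y

/-- `A` is connected in the lattice. -/
def ConnLat {d : ℕ} (A : Set (Zd d)) : Prop :=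
  ∀ x ∈ A, ∀ y ∈ A,
    Relation.ReflTransGen (fun a b => latAdj a b ∧ a ∈ A ∧ b ∈ A) x y

/-- The boundary `∂_{C^g} A` = open lattice edges from `A` to its complement. -/
def bdry {d : ℕ} (ω : Config d) (A : Set (Zd d)) : Set (Zd d × Zd d) :=
  {e | openAdj ω e.1 e.2 ∧ e.1 ∈ A ∧ e.2 ∉ A}

/-- The profile `f_c` (at scale `n`, exponent `γ`). -/
noncomputable def fcut (d : ℕ) (γ c : ℝ) (n : ℕ) (x : ℝ) : ℝ :=
  if x < c * (n : ℝ) ^ γ then 1 else x ^ (1 - 1 / (d : ℝ))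

/-- `ν(x)`: number of open neighbours of `x`. -/
noncomputable def nu {d : ℕ} (ω : Config d) (x : Zd d) : ℕ :=
  Set.ncard {y | openAdj ω x y}

-- Transition kernel of the simple random walk on the open subgraph.
open Classical in
noncomputable def step {d : ℕ} (ω : Config d) (x y : Zd d) : ℝ :=
  if openAdj ω x y then ((nu ω x : ℝ))⁻¹ else 0

/-- Weight of a path of length `n`. -/
noncomputable def pathW {d n : ℕ} (ω : Config d) (γ : Fin (n + 1) → Zd d) : ℝ :=
  ∏ i : Fin n, step ω (γ i.castSucc) (γ i.succ)

/-- `N_n`: number of distinct sites visited by the path. -/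
noncomputable def visits {d n : ℕ} (γ : Fin (n + 1) → Zd d) : ℕ :=
  (Set.range γ).ncard

/-- `P_0^ω(E)`, the probability of a path event for the walk started at 0. -/
noncomputable def PWalk {d : ℕ} (ω : Config d) (n : ℕ)
    (E : (Fin (n + 1) → Zd d) → Prop) : ℝ :=
  ∑' γ : Fin (n + 1) → Zd d,
    Set.indicator {γ | γ 0 = 0 ∧ E γ} (fun γ => pathW ω γ) γ

/-- `E_0^ω(α^{N_n})`. -/
noncomputable def LaplaceN {d : ℕ} (ω : Config d) (α : ℝ) (n : ℕ) : ℝ :=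
  ∑' γ : Fin (n + 1) → Zd d,
    Set.indicator {γ | γ 0 = 0} (fun γ => pathW ω γ * α ^ visits γ) γ

/-- `E_0^ω(α^{N_n} 1_{X_n = 0})`. -/
noncomputable def LaplaceNReturn {d : ℕ} (ω : Config d) (α : ℝ) (n : ℕ) : ℝ :=
  ∑' γ : Fin (n + 1) → Zd d,
    Set.indicator {γ | γ 0 = 0 ∧ γ (Fin.last n) = 0}
      (fun γ => pathW ω γ * α ^ visits γ) γ

/-- Vertices of the wreath product `C^g ≀ Z/2Z` (lamplighter states). -/
abbrev Lamp (d : ℕ) := Zd d × (Zd d →₀ ZMod 2)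

/-- Flip a lamp configuration at one point. -/
noncomputable def flipAt {σ : Type*} (f : σ →₀ ZMod 2) (x : σ) : σ →₀ ZMod 2 :=
  f + Finsupp.single x 1

/-- Transition kernel of the lamplighter walk `Z` with parameter `α`. -/
noncomputable def ptilde {d : ℕ} (ω : Config d) (α : ℝ) (u v : Lamp d) : ℝ :=
  Set.indicator
    {q : Lamp d × Lamp d | ∀ x, x ≠ q.1.1 → x ≠ q.2.1 → q.1.2 x = q.2.2 x}
    (fun q => (if q.2.2 q.1.1 = 0 then α else 1 - α) *
      (if q.2.2 q.2.1 = 0 then α else 1 - α) * step ω q.1.1 q.2.1) (u, v)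

/-- `P̃_o^ω(Z_n = o)`: return probability of the lamplighter walk. -/
noncomputable def ZReturn {d : ℕ} (ω : Config d) (α : ℝ) (n : ℕ) : ℝ :=
  ∑' γ : Fin (n + 1) → Lamp d,
    Set.indicator {γ | γ 0 = (0, 0) ∧ γ (Fin.last n) = (0, 0)}
      (fun γ => ∏ i : Fin n, ptilde ω α (γ i.castSucc) (γ i.succ)) γ

/-- Vertex set of the wreath product over a vertex set `V` of the base. -/
def wVert {d : ℕ} (V : Set (Zd d)) : Set (Lamp d) :=
  {u | u.1 ∈ V ∧ ↑u.2.support ⊆ V}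

/-- Adjacency in the wreath product `C^g ≀ Z/2Z`. -/
def wAdj {d : ℕ} (ω : Config d) (u v : Lamp d) : Prop :=
  (u.1 = v.1 ∧ (∀ x, x ≠ u.1 → u.2 x = v.2 x) ∧ u.2 u.1 ≠ v.2 u.1) ∨
    (u.2 = v.2 ∧ openAdj ω u.1 v.1)

/-- Boundary of `U` in the wreath product `C^g ≀ Z/2Z`. -/
def wBdry {d : ℕ} (ω : Config d) (U : Set (Lamp d)) : Set (Lamp d × Lamp d) :=
  {e | e.1 ∈ U ∧ e.2 ∈ wVert (cluster ω) \ U ∧ wAdj ω e.1 e.2}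

/-- Følner function `Fol_{C_n^g}^{C^g}` (with value `⊤` when no set qualifies). -/
noncomputable def FolC {d : ℕ} (ω : Config d) (n : ℕ) (k : ℝ) : ℝ≥0∞ :=
  sInf {m : ℝ≥0∞ | ∃ A : Set (Zd d), A ⊆ clusterN ω n ∧ A.Nonempty ∧
    ((bdry ω A).ncard : ℝ) / (A.ncard : ℝ) ≤ 1 / k ∧ m = (A.ncard : ℝ≥0∞)}

/-- Følner function `Fol_{C_n^g ≀ Z/2Z}^{C^g ≀ Z/2Z}`. -/
noncomputable def FolW {d : ℕ} (ω : Config d) (n : ℕ) (k : ℝ) : ℝ≥0∞ :=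
  sInf {m : ℝ≥0∞ | ∃ U : Set (Lamp d), U ⊆ wVert (clusterN ω n) ∧ U.Nonempty ∧
    ((wBdry ω U).ncard : ℝ) / (U.ncard : ℝ) ≤ 1 / k ∧ m = (U.ncard : ℝ≥0∞)}

/-- Degree of a configuration `f` in the graph `K_U`. -/
noncomputable def Kdeg {d : ℕ} (U : Set (Lamp d)) (f : Zd d →₀ ZMod 2) : ℕ :=
  Set.ncard {g : Zd d →₀ ZMod 2 | ∃ x : Zd d, (x, f) ∈ U ∧ (x, g) ∈ U ∧ g = flipAt f x}

/-- A point `u = (x,f)` of `U` is bad if `(x, f̄_x) ∉ U`. -/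
def badPt {d : ℕ} (U : Set (Lamp d)) (u : Lamp d) : Prop :=
  (u.1, flipAt u.2 u.1) ∉ U

/-- `D(0,x) ≤ r`: the chemical distance from the origin to `x` is at most `r`. -/
def chemLE {d : ℕ} (ω : Config d) (x : Zd d) (r : ℕ) : Prop :=
  ∃ m ≤ r, ∃ γ : ℕ → Zd d, γ 0 = 0 ∧ γ m = x ∧ ∀ i < m, openAdj ω (γ i) (γ (i + 1))

/-- `B_r(C)`: chemical ball of radius `r` around the origin. -/
def chemBall {d : ℕ} (ω : Config d) (r : ℕ) : Set (Zd d) := {x | chemLE ω x r}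

/-- Lattice connected component of `x` inside a vertex set `V`. -/
def latCompIn {d : ℕ} (V : Set (Zd d)) (x : Zd d) : Set (Zd d) :=
  {y | Relation.ReflTransGen (fun a b => latAdj a b ∧ a ∈ V ∧ b ∈ V) x y}

/-- Open connected component of `x` inside a vertex set `V`. -/
def openCompIn {d : ℕ} (ω : Config d) (V : Set (Zd d)) (x : Zd d) : Set (Zd d) :=
  {y | Relation.ReflTransGen (fun a b => openAdj ω a b ∧ a ∈ V ∧ b ∈ V) x y}

/-- `L_n`: a connected component of the open subgraph inside `B_n` of maximal cardinality. -/
def IsLargestComp {d : ℕ} (ω : Config d) (n : ℕ) (L : Set (Zd d)) : Prop :=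
  (∃ x ∈ box d n, L = openCompIn ω (box d n) x) ∧
    ∀ y ∈ box d n, (openCompIn ω (box d n) y).ncard ≤ L.ncard

/-- `\bar L`: the connected component of `L` in the full open subgraph. -/
def closureOf {d : ℕ} (ω : Config d) (L : Set (Zd d)) : Set (Zd d) :=
  {y | ∃ x ∈ L, Relation.ReflTransGen (openAdj ω) x y}

/-- The boundary `∂_{\bar L_n^g} A`. -/
def bdryBar {d : ℕ} (ω : Config d) (n : ℕ) (L A : Set (Zd d)) : Set (Zd d × Zd d) :=
  {e | openAdj ω e.1 e.2 ∧ e.1 ∈ A ∩ closureOf ω L ∧ e.2 ∈ box d (n + 1) \ A}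

/-- `n(A)`: number of connected components of `B_n − L` containing a component of `A`. -/
noncomputable def nComp {d : ℕ} (n : ℕ) (L A : Set (Zd d)) : ℕ :=
  Set.ncard {P : Set (Zd d) |
    (∃ x ∈ box d n \ L, P = latCompIn (box d n \ L) x) ∧
    ∃ x ∈ A, latCompIn A x ⊆ P}

/-- The killed kernel `P^{B_r(C)}` acting on functions. -/
noncomputable def Pball {d : ℕ} (ω : Config d) (r : ℕ) (f : Zd d → ℝ) : Zd d → ℝ :=
  Set.indicator (chemBall ω r) (fun x =>
    ∑' y : Zd d, Set.indicator (chemBall ω r) (fun y => step ω x y * f y) y)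

/-- The Dirichlet form `ξ(f,f) = ((Id − P^{B_r(C)}) 1_{B_r(C)} f | f)_ν`. -/
noncomputable def dirichletForm {d : ℕ} (ω : Config d) (r : ℕ) (f : Zd d → ℝ) : ℝ :=
  ∑' x : Zd d, (nu ω x : ℝ) * f x *
    (Set.indicator (chemBall ω r) f x - Pball ω r (Set.indicator (chemBall ω r) f) x)

/-- `‖f‖²_{l²(ν)}`. -/
noncomputable def normSq {d : ℕ} (ω : Config d) (f : Zd d → ℝ) : ℝ :=
  ∑' x : Zd d, (nu ω x : ℝ) * f x ^ 2

/-- `λ_1(B_r(C))`: smallest Dirichlet eigenvalue of the killed walk. -/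
noncomputable def lambda1 {d : ℕ} (ω : Config d) (r : ℕ) : ℝ :=
  sInf {t : ℝ | ∃ f : Zd d → ℝ, f ≠ 0 ∧ Function.support f ⊆ chemBall ω r ∧
    t = dirichletForm ω r f / normSq ω f}

/-! ### Paths of bounded length -/

/-- `y` can be reached from `x` by at most `n` steps along the relation `r`. -/
def reach {α : Type*} (r : α → α → Prop) : ℕ → α → α → Prop
  | 0, x, y => x = y
  | n + 1, x, y => reach r n x y ∨ ∃ z, reach r n x z ∧ r z y

section Reach

variable {α β : Type*} {r s : α → α → Prop}

theorem reach_refl (n : ℕ) (x : α) : reach r n x x := by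
  induction n with
  | zero => rfl
  | succ n ih => exact Or.inl ih

theorem reach.mono_len {m n : ℕ} {x y : α} (h : reach r m x y) (hmn : m ≤ n) :
    reach r n x y := by
  induction hmn with
  | refl => exact h
  | step _ ih => exact Or.inl ih

theorem reach.snoc {n : ℕ} {x y z : α} (h : reach r n x y) (hr : r y z) :
    reach r (n + 1) x z := Or.inr ⟨y, h, hr⟩

theorem reach.single {x y : α} (hr : r x y) : reach r 1 x y := Or.inr ⟨x, rfl, hr⟩

theorem reach.mono {n : ℕ} {x y : α} (h : reach r n x y) (hrs : ∀ a b, r a b → s a b) :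
    reach s n x y := by
  induction n generalizing y with
  | zero => exact h
  | succ n ih =>
    rcases h with h | ⟨z, h, hz⟩
    · exact Or.inl (ih h)
    · exact Or.inr ⟨z, ih h, hrs _ _ hz⟩

theorem reach.trans {m n : ℕ} {x y z : α} (h : reach r m x y) (h' : reach r n y z) :
    reach r (m + n) x z := by
  induction n generalizing z with
  | zero => cases h'; exact h
  | succ n ih =>
    rcases h' with h' | ⟨w, h', hw⟩
    · exact Or.inl (ih h')
    · exact Or.inr ⟨w, ih h', hw⟩

theorem reach.cons {n : ℕ} {x y z : α} (hr : r x y) (h : reach r n y z) :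
    reach r (n + 1) x z := ((reach.single hr).trans h).mono_len (by omega)

theorem reach.symm (hr : ∀ a b, r a b → r b a) {n : ℕ} {x y : α} (h : reach r n x y) :
    reach r n y x := by
  induction n generalizing y with
  | zero => exact Eq.symm h
  | succ n ih =>
    rcases h with h | ⟨z, h, hz⟩
    · exact Or.inl (ih h)
    · exact reach.cons (hr _ _ hz) (ih h)

theorem reach.map {t : β → β → Prop} (f : α → β) (hf : ∀ a b, r a b → t (f a) (f b))
    {n : ℕ} {x y : α} (h : reach r n x y) : reach t n (f x) (f y) := by
  induction n generalizing y with
  | zero => exact congrArg f h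
  | succ n ih =>
    rcases h with h | ⟨z, h, hz⟩
    · exact Or.inl (ih h)
    · exact Or.inr ⟨f z, ih h, hf _ _ hz⟩

theorem reach.reflTransGen {n : ℕ} {x y : α} (h : reach r n x y) :
    Relation.ReflTransGen r x y := by
  induction n generalizing y with
  | zero => cases h; exact .refl
  | succ n ih =>
    rcases h with h | ⟨z, h, hz⟩
    · exact ih h
    · exact (ih h).tail hz

theorem exists_reach_of_reflTransGen {x y : α} (h : Relation.ReflTransGen r x y) :
    ∃ n, reach r n x y := by
  induction h with
  | refl => exact ⟨0, rfl⟩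
  | tail _ hr ih => obtain ⟨n, hn⟩ := ih; exact ⟨n + 1, hn.snoc hr⟩

theorem reach.exists_path {n : ℕ} {x y : α} (h : reach r n x y) :
    ∃ m ≤ n, ∃ γ : ℕ → α, γ 0 = x ∧ γ m = y ∧ ∀ i < m, r (γ i) (γ (i + 1)) := by
  induction n generalizing y with
  | zero => exact ⟨0, le_rfl, fun _ => x, rfl, h, by simp⟩
  | succ n ih =>
    rcases h with h | ⟨z, h, hz⟩
    · obtain ⟨m, hm, γ, h⟩ := ih h
      exact ⟨m, by omega, γ, h⟩
    · obtain ⟨m, hm, γ, h0, h1, h2⟩ := ih h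
      refine ⟨m + 1, by omega, fun i => if i ≤ m then γ i else y, by simp [h0], by simp, ?_⟩
      intro i hi
      rcases Nat.lt_succ_iff_lt_or_eq.1 hi with hi | rfl
      · have h3 : i ≤ m := hi.le
        have h4 : i + 1 ≤ m := hi
        simpa [h3, h4] using h2 i hi
      · simpa [h1] using hz

theorem reach_of_path {m : ℕ} {γ : ℕ → α} (h : ∀ i < m, r (γ i) (γ (i + 1))) :
    reach r m (γ 0) (γ m) := by
  induction m with
  | zero => rfl
  | succ m ih => exact (ih fun i hi => h i (by omega)).snoc (h m (by omega))

end Reach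

theorem chemLE_iff {d : ℕ} {ω : Config d} {x : Zd d} {r : ℕ} :
    chemLE ω x r ↔ reach (openAdj ω) r 0 x := by
  constructor
  · rintro ⟨m, hm, γ, h0, h1, h2⟩
    have := reach_of_path h2
    rw [h0, h1] at this
    exact this.mono_len hm
  · intro h
    obtain ⟨m, hm, γ, h⟩ := h.exists_path
    exact ⟨m, hm, γ, h⟩

/-! ### Lattice geometry -/

theorem latAdj_comm {d : ℕ} {x y : Zd d} : latAdj x y ↔ latAdj y x := by
  simp only [latAdj, abs_sub_comm]

theorem openAdj_comm {d : ℕ} {ω : Config d} {x y : Zd d} :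
    openAdj ω x y ↔ openAdj ω y x := by
  simp only [openAdj, Sym2.eq_swap (a := x), latAdj_comm (x := x)]

theorem latAdj.exists_eq_add {d : ℕ} {x y : Zd d} (h : latAdj x y) :
    ∃ (i : Fin d) (s : ℤ), (s = 1 ∨ s = -1) ∧ y = x + Pi.single i s := by
  classical
  unfold latAdj at h
  obtain ⟨i, hi⟩ : ∃ i, x i ≠ y i := by
    by_contra! hc
    simp [hc] at h
  have h1 : 1 ≤ |x i - y i| := Int.one_le_abs (sub_ne_zero.2 hi)
  rw [← Finset.add_sum_erase _ _ (Finset.mem_univ i)] at h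
  have h2 : ∀ j ∈ Finset.univ.erase i, (0 : ℤ) ≤ |x j - y j| := fun _ _ => abs_nonneg _
  have h3 := Finset.sum_nonneg h2
  have h4 : ∑ j ∈ Finset.univ.erase i, |x j - y j| = 0 := by omega
  have h5 := (Finset.sum_eq_zero_iff_of_nonneg h2).1 h4
  have h6 : |x i - y i| = 1 := by omega
  refine ⟨i, y i - x i, ?_, ?_⟩
  · rcases abs_eq (by norm_num : (0:ℤ) ≤ 1) |>.1 h6 with h | h <;> omega
  · funext j
    by_cases hj : j = i
    · subst hj; simp
    · have := h5 j (by simp [hj])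
      have := abs_eq_zero.1 this
      simp [hj]; omega

theorem latAdj_add_single {d : ℕ} (x : Zd d) (i : Fin d) {s : ℤ} (hs : s = 1 ∨ s = -1) :
    latAdj x (x + Pi.single i s) := by
  classical
  unfold latAdj
  rw [Finset.sum_eq_single i]
  · rcases hs with rfl | rfl <;> simp
  · intro j _ hj; simp [hj]
  · simp

theorem latAdj.abs_sub_le {d : ℕ} {x y : Zd d} (h : latAdj x y) (i : Fin d) :
    |x i - y i| ≤ 1 := by
  rw [← h]
  exact Finset.single_le_sum (f := fun i => |x i - y i|) (fun _ _ => abs_nonneg _)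
    (Finset.mem_univ i)

/-- The set of lattice neighbours of `x`. -/
noncomputable def nbrs {d : ℕ} (x : Zd d) : Finset (Zd d) := by
  classical
  exact (Finset.univ ×ˢ {1, -1}).image fun is : Fin d × ℤ => x + Pi.single is.1 is.2

theorem mem_nbrs {d : ℕ} {x y : Zd d} : y ∈ nbrs x ↔ latAdj x y := by
  classical
  unfold nbrs
  constructor
  · intro h
    obtain ⟨⟨i, s⟩, his, rfl⟩ := Finset.mem_image.1 h
    exact latAdj_add_single x i (by simpa using his)
  · intro h
    obtain ⟨i, s, hs, rfl⟩ := h.exists_eq_add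
    exact Finset.mem_image.2 ⟨(i, s), by simpa using hs, rfl⟩

theorem card_nbrs_le {d : ℕ} (x : Zd d) : (nbrs x).card ≤ 2 * d := by
  classical
  unfold nbrs
  refine Finset.card_image_le.trans ?_
  rw [Finset.card_product]
  simp [mul_comm]

/-- The box `[-n,n]^d` as a finite set. -/
noncomputable def fbox (d n : ℕ) : Finset (Zd d) := Finset.Icc (fun _ => -(n : ℤ)) (fun _ => (n : ℤ))

theorem mem_fbox {d n : ℕ} {x : Zd d} : x ∈ fbox d n ↔ ∀ i, |x i| ≤ n := by
  simp only [fbox, Finset.mem_Icc, Pi.le_def, abs_le, forall_and]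

theorem card_fbox (d n : ℕ) : (fbox d n).card = (2 * n + 1) ^ d := by
  simp only [fbox, Pi.card_Icc, Int.card_Icc, Finset.prod_const, Finset.card_univ,
    Fintype.card_fin]
  congr 1
  omega

theorem reach_abs_sub_le {d : ℕ} {r : Zd d → Zd d → Prop} (hr : ∀ a b, r a b → latAdj a b)
    {n : ℕ} {x y : Zd d} (h : reach r n x y) (i : Fin d) : |x i - y i| ≤ n := by
  induction n generalizing y with
  | zero => cases h; simp
  | succ n ih =>
    rcases h with h | ⟨z, h, hz⟩
    · have := ih h; push_cast; omega
    · have h1 := ih h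
      have h2 := (hr _ _ hz).abs_sub_le i
      have h3 := abs_sub_le (x i) (z i) (y i)
      push_cast; omega

theorem chemBall_subset_fbox {d : ℕ} (ω : Config d) (r : ℕ) :
    chemBall ω r ⊆ fbox d r := by
  intro x hx
  have h := chemLE_iff.1 hx
  rw [Finset.mem_coe, mem_fbox]
  intro i
  have := reach_abs_sub_le (fun a b (h : openAdj ω a b) => h.1) h i
  simpa using this

theorem chemBall_finite {d : ℕ} (ω : Config d) (r : ℕ) : (chemBall ω r).Finite :=
  (fbox d r).finite_toSet.subset (chemBall_subset_fbox ω r)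

theorem nu_le {d : ℕ} (ω : Config d) (x : Zd d) : nu ω x ≤ 2 * d := by
  refine le_trans ?_ (card_nbrs_le x)
  rw [← Set.ncard_coe_finset]
  exact Set.ncard_le_ncard (fun y hy => by simpa [mem_nbrs] using hy.1) (Finset.finite_toSet _)

theorem nu_pos {d : ℕ} {ω : Config d} {x y : Zd d} (h : openAdj ω x y) : 0 < nu ω x := by
  unfold nu
  rw [Set.ncard_pos ((nbrs x).finite_toSet.subset fun y hy => by simpa [mem_nbrs] using hy.1)]
  exact ⟨y, h⟩

/-! ### The walk killed on leaving a finite set -/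

theorem step_nonneg {d : ℕ} (ω : Config d) (x y : Zd d) : 0 ≤ step ω x y := by
  unfold step
  split_ifs <;> positivity

/-- The transition operator killed outside `B`. -/
noncomputable def killed {d : ℕ} (ω : Config d) (B : Finset (Zd d)) (f : Zd d → ℝ) :
    Zd d → ℝ :=
  fun x => if x ∈ B then ∑ y ∈ B, step ω x y * f y else 0

/-- Probability of staying in `B` up to time `n`. -/
noncomputable def stay {d : ℕ} (ω : Config d) (B : Finset (Zd d)) (n : ℕ) : Zd d → ℝ :=
  (killed ω B)^[n] fun x => if x ∈ B then 1 else 0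

theorem killed_mono {d : ℕ} {ω : Config d} {B : Finset (Zd d)} {f g : Zd d → ℝ}
    (h : ∀ x, f x ≤ g x) (x : Zd d) : killed ω B f x ≤ killed ω B g x := by
  unfold killed
  split_ifs
  · exact Finset.sum_le_sum fun y _ => mul_le_mul_of_nonneg_left (h y) (step_nonneg ω x y)
  · rfl

theorem sum_step_le {d : ℕ} (ω : Config d) (B : Finset (Zd d)) (x : Zd d) :
    ∑ y ∈ B, step ω x y ≤ 1 := by
  classical
  unfold step
  rw [← Finset.sum_filter, Finset.sum_const, nsmul_eq_mul]
  have h : (B.filter fun y => openAdj ω x y).card ≤ nu ω x := by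
    rw [nu, ← Set.ncard_coe_finset]
    refine Set.ncard_le_ncard (fun y hy => (Finset.mem_filter.1 hy).2) ?_
    exact (nbrs x).finite_toSet.subset fun y hy => by simpa [mem_nbrs] using hy.1
  rw [← div_eq_mul_inv]
  exact div_le_one_of_le₀ (by exact_mod_cast h) (by positivity)

theorem stay_succ {d : ℕ} (ω : Config d) (B : Finset (Zd d)) (n : ℕ) :
    stay ω B (n + 1) = killed ω B (stay ω B n) := by
  simp only [stay, Function.iterate_succ_apply']

theorem stay_nonneg {d : ℕ} (ω : Config d) (B : Finset (Zd d)) (n : ℕ) (x : Zd d) :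
    0 ≤ stay ω B n x := by
  induction n generalizing x with
  | zero => simp only [stay, Function.iterate_zero, id]; split_ifs <;> norm_num
  | succ n ih =>
    rw [stay_succ, killed]
    split_ifs
    · exact Finset.sum_nonneg fun y _ => mul_nonneg (step_nonneg ω x y) (ih y)
    · rfl

theorem stay_succ_le {d : ℕ} (ω : Config d) (B : Finset (Zd d)) (n : ℕ) (x : Zd d) :
    stay ω B (n + 1) x ≤ stay ω B n x := by
  induction n generalizing x with
  | zero =>
    rw [stay_succ]
    simp only [stay, Function.iterate_zero, id, killed]
    split_ifs
    · refine le_trans (Finset.sum_le_sum fun y _ => ?_) (sum_step_le ω B x)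
      simp
    · rfl
  | succ n ih =>
    simp only [stay_succ _ _ (n + 1), stay_succ _ _ n] at ih ⊢
    exact killed_mono ih x

theorem stay_antitone {d : ℕ} (ω : Config d) (B : Finset (Zd d)) (x : Zd d) :
    Antitone fun n => stay ω B n x :=
  antitone_nat_of_succ_le fun n => stay_succ_le ω B n x

theorem stay_eq_sum {d : ℕ} (ω : Config d) (B : Finset (Zd d)) (n : ℕ) (x : Zd d) :
    stay ω B n x = ∑ γ ∈ (Fintype.piFinset fun _ : Fin (n + 1) => B).filter (fun γ => γ 0 = x),
      pathW ω γ := by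
  classical
  induction n generalizing x with
  | zero =>
    simp only [stay, Function.iterate_zero, id, pathW, Finset.univ_eq_empty, Finset.prod_empty]
    rw [Finset.sum_const, nsmul_one]
    split_ifs with h
    · have : (Fintype.piFinset fun _ : Fin (0 + 1) => B).filter (fun γ => γ 0 = x)
          = {fun _ => x} := by
        ext γ
        simp only [Finset.mem_filter, Fintype.mem_piFinset, Finset.mem_singleton]
        constructor
        · rintro ⟨_, h⟩
          funext i
          rw [← h]
          congr 1
          exact Fin.eq_zero i
        · rintro rfl
          exact ⟨fun _ => h, rfl⟩
      rw [this]; simp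
    · have : (Fintype.piFinset fun _ : Fin (0 + 1) => B).filter (fun γ => γ 0 = x) = ∅ := by
        ext γ
        simp only [Finset.mem_filter, Fintype.mem_piFinset, Finset.notMem_empty, iff_false]
        rintro ⟨h1, rfl⟩
        exact h (h1 0)
      rw [this]; simp
  | succ n ih =>
    rw [stay_succ, killed]
    split_ifs with hx
    · simp only [ih, Finset.mul_sum]
      rw [Finset.sum_sigma']
      refine Finset.sum_bij' (fun s _ => Fin.cons x s.2) (fun γ _ => ⟨γ 1, Fin.tail γ⟩)
        ?_ ?_ ?_ ?_ ?_
      · rintro ⟨y, γ⟩ h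
        simp only [Finset.mem_sigma, Finset.mem_filter, Fintype.mem_piFinset] at h ⊢
        refine ⟨fun i => ?_, rfl⟩
        refine Fin.cases ?_ (fun i => ?_) i
        · simpa using hx
        · simpa using h.2.1 i
      · intro γ h
        simp only [Finset.mem_sigma, Finset.mem_filter, Fintype.mem_piFinset] at h ⊢
        exact ⟨h.1 1, fun i => h.1 i.succ, rfl⟩
      · rintro ⟨y, γ⟩ h
        simp only [Finset.mem_sigma, Finset.mem_filter, Fintype.mem_piFinset] at h
        obtain ⟨_, _, rfl⟩ := h
        rfl
      · intro γ h
        simp only [Finset.mem_filter] at h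
        obtain ⟨_, rfl⟩ := h
        simp
      · rintro ⟨y, γ⟩ h
        simp only [Finset.mem_sigma, Finset.mem_filter, Fintype.mem_piFinset] at h
        obtain ⟨_, _, rfl⟩ := h
        simp only [pathW]
        rw [Fin.prod_univ_succ]
        rfl
    · rw [Finset.sum_eq_zero]
      intro γ h
      simp only [Finset.mem_filter, Fintype.mem_piFinset] at h
      obtain ⟨h, rfl⟩ := h
      exact absurd (h 0) hx

theorem pWalk_eq_stay {d : ℕ} (ω : Config d) (n r : ℕ) :
    PWalk ω n (fun γ => ∀ i, chemLE ω (γ i) r) =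
      stay ω (chemBall_finite ω r).toFinset n 0 := by
  classical
  rw [stay_eq_sum, PWalk, tsum_eq_sum (s := (Fintype.piFinset
    fun _ : Fin (n + 1) => (chemBall_finite ω r).toFinset).filter (fun γ => γ 0 = 0))]
  · refine Finset.sum_congr rfl fun γ hγ => ?_
    rw [Set.indicator_of_mem]
    simpa [chemBall, and_comm] using hγ
  · intro γ hγ
    rw [Set.indicator_of_notMem]
    simpa [chemBall, and_comm] using hγ

theorem stay_succ_ge {d : ℕ} {ω : Config d} {B : Finset (Zd d)} {n : ℕ} {x y : Zd d}
    (hx : x ∈ B) (hy : y ∈ B) (h : openAdj ω x y) :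
    (2 * d : ℝ)⁻¹ * stay ω B n y ≤ stay ω B (n + 1) x := by
  rw [stay_succ, killed, if_pos hx]
  refine le_trans ?_ (Finset.single_le_sum (f := fun y => step ω x y * stay ω B n y)
    (fun y _ => mul_nonneg (step_nonneg ω x y) (stay_nonneg ω B n y)) hy)
  refine mul_le_mul_of_nonneg_right ?_ (stay_nonneg ω B n y)
  rw [step, if_pos h]
  have h1 := nu_pos h
  have h2 := nu_le ω x
  refine inv_anti₀ (by exact_mod_cast h1) (by exact_mod_cast h2)

theorem stay_ge_of_reach {d : ℕ} (hd : 1 ≤ d) {ω : Config d} {B : Finset (Zd d)} {n k : ℕ}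
    {x y : Zd d} (h : reach (fun a b => openAdj ω a b ∧ a ∈ B ∧ b ∈ B) k x y) :
    ((2 * d : ℝ)⁻¹) ^ k * stay ω B n y ≤ stay ω B n x := by
  have hd' : (1 : ℝ) ≤ d := by exact_mod_cast hd
  induction k generalizing y with
  | zero => cases h; simp
  | succ k ih =>
    have h2d : (2 * d : ℝ)⁻¹ ≤ 1 := inv_le_one_of_one_le₀ (by linarith)
    have h0 : (0 : ℝ) ≤ (2 * d : ℝ)⁻¹ := by positivity
    have hp : (0 : ℝ) ≤ ((2 * d : ℝ)⁻¹) ^ k := by positivity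
    rcases h with h | ⟨z, h, hz, hzB, hyB⟩
    · refine le_trans ?_ (ih h)
      rw [pow_succ]
      have := stay_nonneg ω B n y
      refine mul_le_mul_of_nonneg_right ?_ this
      nlinarith
    · refine le_trans ?_ (ih h)
      rw [pow_succ, mul_assoc]
      refine mul_le_mul_of_nonneg_left ?_ hp
      exact (stay_succ_ge hzB hyB hz).trans (stay_succ_le ω B n z)

/-! ### Spectral lower bound -/

/-- The `ℓ²(ν)` inner product over `B`. -/
noncomputable def ip {d : ℕ} (ω : Config d) (B : Finset (Zd d)) (f g : Zd d → ℝ) : ℝ :=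
  ∑ x ∈ B, (nu ω x : ℝ) * (f x * g x)

open Classical in
theorem nu_mul_step {d : ℕ} (ω : Config d) (x y : Zd d) :
    (nu ω x : ℝ) * step ω x y = if openAdj ω x y then 1 else 0 := by
  unfold step
  split_ifs with h
  · exact mul_inv_cancel₀ (by exact_mod_cast (nu_pos h).ne')
  · simp

open Classical in
theorem ip_killed {d : ℕ} (ω : Config d) (B : Finset (Zd d)) (f g : Zd d → ℝ) :
    ip ω B f (killed ω B g) =
      ∑ x ∈ B, ∑ y ∈ B, (if openAdj ω x y then 1 else 0) * (f x * g y) := by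
  unfold ip killed
  refine Finset.sum_congr rfl fun x hx => ?_
  rw [if_pos hx, Finset.mul_sum, Finset.mul_sum]
  refine Finset.sum_congr rfl fun y _ => ?_
  rw [← nu_mul_step]
  ring

theorem ip_killed_comm {d : ℕ} (ω : Config d) (B : Finset (Zd d)) (f g : Zd d → ℝ) :
    ip ω B f (killed ω B g) = ip ω B (killed ω B f) g := by
  have h : ip ω B (killed ω B f) g = ip ω B g (killed ω B f) := by
    simp only [ip, mul_comm (g _)]
  rw [h, ip_killed, ip_killed, Finset.sum_comm]
  refine Finset.sum_congr rfl fun x _ => Finset.sum_congr rfl fun y _ => ?_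
  rw [openAdj_comm, mul_comm (f y)]

theorem ip_iterate_comm {d : ℕ} (ω : Config d) (B : Finset (Zd d)) (k : ℕ) (f g : Zd d → ℝ) :
    ip ω B f ((killed ω B)^[k] g) = ip ω B ((killed ω B)^[k] f) g := by
  induction k generalizing f with
  | zero => rfl
  | succ k ih =>
    rw [Function.iterate_succ_apply', ip_killed_comm, ih, ← Function.iterate_succ_apply]

theorem ip_sq_le {d : ℕ} (ω : Config d) (B : Finset (Zd d)) (f g : Zd d → ℝ) :
    ip ω B f g ^ 2 ≤ ip ω B f f * ip ω B g g := by
  unfold ip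
  have h := Finset.sum_mul_sq_le_sq_mul_sq B (fun x => √(nu ω x : ℝ) * f x)
    (fun x => √(nu ω x : ℝ) * g x)
  have hs : ∀ (x : Zd d) (a b : ℝ),
      (nu ω x : ℝ) * (a * b) = √(nu ω x : ℝ) * a * (√(nu ω x : ℝ) * b) := fun x a b => by
    rw [mul_mul_mul_comm, Real.mul_self_sqrt (by positivity)]
  simp only [hs]
  simpa only [sq] using h

theorem ip_iterate_two_pow {d : ℕ} (ω : Config d) (B : Finset (Zd d)) (f : Zd d → ℝ)
    (h0 : 0 < ip ω B f f) {θ : ℝ} (hθ : 0 ≤ θ)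
    (h1 : θ * ip ω B f f ≤ ip ω B f (killed ω B f)) (j : ℕ) :
    θ ^ (2 ^ j) * ip ω B f f ≤ ip ω B f ((killed ω B)^[2 ^ j] f) := by
  induction j with
  | zero => simpa using h1
  | succ j ih =>
    have h2 : ip ω B f ((killed ω B)^[2 ^ (j + 1)] f) =
        ip ω B ((killed ω B)^[2 ^ j] f) ((killed ω B)^[2 ^ j] f) := by
      rw [← ip_iterate_comm, ← Function.iterate_add_apply]
      congr 2
      ring_nf
    rw [h2]
    have h3 := ip_sq_le ω B f ((killed ω B)^[2 ^ j] f)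
    have h4 : (θ ^ (2 ^ j) * ip ω B f f) ^ 2 ≤ ip ω B f ((killed ω B)^[2 ^ j] f) ^ 2 :=
      pow_le_pow_left₀ (by positivity) ih 2
    have h5 := h4.trans h3
    rw [pow_succ 2 j, pow_mul θ]
    nlinarith

/-- A function of gradient at most `η` vanishing on the inner boundary almost minimizes
the Dirichlet form. -/
theorem ip_sub_killed_le {d : ℕ} (ω : Config d) (B : Finset (Zd d)) (f : Zd d → ℝ) {η : ℝ}
    (hf : ∀ x ∈ B, ∀ y ∈ B, openAdj ω x y → |f x - f y| ≤ η)
    (hb : ∀ x ∈ B, ∀ y, y ∉ B → openAdj ω x y → f x = 0) :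
    ip ω B f f - ip ω B f (killed ω B f) ≤ d * B.card * η ^ 2 := by
  classical
  have h1 : ip ω B f f = ∑ x ∈ B, ∑ y ∈ B, (if openAdj ω x y then (1:ℝ) else 0) * (f x * f x) := by
    unfold ip
    refine Finset.sum_congr rfl fun x hx => ?_
    rw [← Finset.sum_mul]
    by_cases hfx : f x = 0
    · simp [hfx]
    · congr 1
      rw [Finset.sum_boole, nu, ← Set.ncard_coe_finset]
      congr 2
      ext y
      simp only [Set.mem_ofPred_eq, Finset.coe_filter]
      refine ⟨fun h => ⟨?_, h⟩, fun h => h.2⟩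
      by_contra hy
      exact hfx (hb x hx y hy h)
  have h2 : ip ω B f f =
      ∑ x ∈ B, ∑ y ∈ B, (if openAdj ω x y then (1:ℝ) else 0) * (f y * f y) := by
    rw [h1, Finset.sum_comm]
    refine Finset.sum_congr rfl fun x _ => Finset.sum_congr rfl fun y _ => ?_
    rw [openAdj_comm]
  have h3 : 2 * (ip ω B f f - ip ω B f (killed ω B f)) =
      ∑ x ∈ B, ∑ y ∈ B, (if openAdj ω x y then (1:ℝ) else 0) * (f x - f y) ^ 2 := by
    have : 2 * (ip ω B f f - ip ω B f (killed ω B f)) =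
      ip ω B f f + ip ω B f f - 2 * ip ω B f (killed ω B f) := by ring
    rw [this]
    nth_rewrite 1 [h1]
    rw [h2, ip_killed, Finset.mul_sum, ← Finset.sum_add_distrib, ← Finset.sum_sub_distrib]
    refine Finset.sum_congr rfl fun x _ => ?_
    rw [Finset.mul_sum, ← Finset.sum_add_distrib, ← Finset.sum_sub_distrib]
    refine Finset.sum_congr rfl fun y _ => ?_
    ring
  have h4 : ∑ x ∈ B, ∑ y ∈ B, (if openAdj ω x y then (1:ℝ) else 0) * (f x - f y) ^ 2 ≤
      ∑ x ∈ B, (2 * d : ℝ) * η ^ 2 := by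
    refine Finset.sum_le_sum fun x hx => ?_
    have : ∑ y ∈ B, (if openAdj ω x y then (1:ℝ) else 0) * (f x - f y) ^ 2 ≤
        ∑ y ∈ B, (if openAdj ω x y then (1:ℝ) else 0) * η ^ 2 := by
      refine Finset.sum_le_sum fun y hy => ?_
      split_ifs with h
      · rw [one_mul, one_mul, ← sq_abs]
        exact pow_le_pow_left₀ (abs_nonneg _) (hf x hx y hy h) 2
      · simp
    refine this.trans ?_
    rw [← Finset.sum_mul, Finset.sum_boole]
    refine mul_le_mul_of_nonneg_right ?_ (sq_nonneg _)
    have h5 : (B.filter fun y => openAdj ω x y).card ≤ (nbrs x).card :=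
      Finset.card_le_card fun y hy => mem_nbrs.2 (Finset.mem_filter.1 hy).2.1
    exact_mod_cast h5.trans (card_nbrs_le x)
  rw [Finset.sum_const, nsmul_eq_mul] at h4
  nlinarith

/-! ### Confinement from volume growth -/

theorem reach.exists_last {α : Type*} {r : α → α → Prop} {n : ℕ} {x y : α}
    (h : reach r n x y) (hxy : x ≠ y) : ∃ z, r z y := by
  induction n generalizing y with
  | zero => exact absurd h hxy
  | succ n ih =>
    rcases h with h | ⟨z, _, hz⟩
    · exact ih h hxy
    · exact ⟨z, hz⟩

theorem chemBall_mono {d : ℕ} (ω : Config d) {m n : ℕ} (h : m ≤ n) :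
    chemBall ω m ⊆ chemBall ω n := fun _ hx =>
  chemLE_iff.2 ((chemLE_iff.1 hx).mono_len h)

/-- The chemical distance to the origin. -/
noncomputable def cdist {d : ℕ} (ω : Config d) (x : Zd d) : ℕ := sInf {m | chemLE ω x m}

theorem chemLE_cdist {d : ℕ} {ω : Config d} {x : Zd d} {r : ℕ} (h : chemLE ω x r) :
    chemLE ω x (cdist ω x) := Nat.sInf_mem (s := {m | chemLE ω x m}) ⟨r, h⟩

theorem cdist_le {d : ℕ} {ω : Config d} {x : Zd d} {r : ℕ} (h : chemLE ω x r) :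
    cdist ω x ≤ r := Nat.sInf_le h

theorem chemLE.snoc {d : ℕ} {ω : Config d} {x y : Zd d} {r : ℕ} (h : chemLE ω x r)
    (hxy : openAdj ω x y) : chemLE ω y (r + 1) :=
  chemLE_iff.2 ((chemLE_iff.1 h).snoc hxy)

theorem cdist_le_succ {d : ℕ} {ω : Config d} {x y : Zd d} {r : ℕ} (h : chemLE ω x r)
    (hxy : openAdj ω x y) : cdist ω y ≤ cdist ω x + 1 :=
  cdist_le ((chemLE_cdist h).snoc hxy)

theorem reach_inside {d : ℕ} {ω : Config d} {n r : ℕ} {x : Zd d} (hn : n ≤ r)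
    (h : reach (openAdj ω) n 0 x) :
    reach (fun a b => openAdj ω a b ∧ a ∈ (chemBall_finite ω r).toFinset ∧
      b ∈ (chemBall_finite ω r).toFinset) n 0 x := by
  induction n generalizing x with
  | zero => exact h
  | succ n ih =>
    rcases h with h | ⟨z, h, hz⟩
    · exact Or.inl (ih (by omega) h)
    · refine Or.inr ⟨z, ih (by omega) h, hz, ?_, ?_⟩
      · rw [Set.Finite.mem_toFinset]
        exact chemLE_iff.2 (h.mono_len (by omega))
      · rw [Set.Finite.mem_toFinset]
        exact chemLE_iff.2 ((h.snoc hz).mono_len (by omega))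

theorem stay_ge_of_growth {d : ℕ} (hd : 1 ≤ d) {c : ℝ} (hc : 0 < c) {ω : Config d} {r n : ℕ}
    (hvol : c * ((r / 2 : ℕ) : ℝ) ^ d ≤ (chemBall ω (r / 2)).ncard)
    (hr3 : 3 ≤ r) (hrc : 6 / c ≤ r) (hrK : 2 * (4 * d * 9 ^ d / c) ≤ (r : ℝ) ^ 2) (hn : 1 ≤ n) :
    ∃ y ∈ chemBall ω r, (1 - (4 * d * 9 ^ d / c) / (r : ℝ) ^ 2) ^ (2 * n) * (c / (8 * d * 9 ^ d))
      ≤ stay ω (chemBall_finite ω r).toFinset n y := by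
  classical
  set K : ℝ := 4 * d * 9 ^ d / c with hK
  set B := (chemBall_finite ω r).toFinset with hB
  have hd' : (1 : ℝ) ≤ d := by exact_mod_cast hd
  have hrpos : (0 : ℝ) < r := by positivity
  have hmem : ∀ x, x ∈ B ↔ chemLE ω x r := fun x => by
    rw [hB, Set.Finite.mem_toFinset]; rfl
  set f : Zd d → ℝ := fun x => if x ∈ B then 1 - (cdist ω x : ℝ) / r else 0 with hf
  have hf1 : ∀ x, f x ≤ if x ∈ B then 1 else 0 := fun x => by
    simp only [hf]
    split_ifs
    · have : (0 : ℝ) ≤ (cdist ω x : ℝ) / r := by positivity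
      linarith
    · rfl
  have hf0 : ∀ x, 0 ≤ f x := fun x => by
    simp only [hf]
    split_ifs with h
    · have h1 : (cdist ω x : ℝ) ≤ r := by exact_mod_cast cdist_le ((hmem x).1 h)
      have : (cdist ω x : ℝ) / r ≤ 1 := div_le_one_of_le₀ h1 hrpos.le
      linarith
    · rfl
  have hBcard : (B.card : ℝ) ≤ (3 * r) ^ d := by
    have h1 : B.card ≤ (fbox d r).card := Finset.card_le_card fun x hx =>
      chemBall_subset_fbox ω r ((hmem x).1 hx)
    rw [card_fbox] at h1
    have h2 : (2 * r + 1) ^ d ≤ (3 * r) ^ d := Nat.pow_le_pow_left (by omega) d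
    exact_mod_cast h1.trans h2
  set B2 := (chemBall_finite ω (r / 2)).toFinset with hB2
  have hmem2 : ∀ x, x ∈ B2 ↔ chemLE ω x (r / 2) := fun x => by
    rw [hB2, Set.Finite.mem_toFinset]; rfl
  have hB2card : c * (r / 3 : ℝ) ^ d ≤ B2.card := by
    rw [hB2, ← Set.ncard_eq_toFinset_card _ (chemBall_finite ω (r / 2))]
    refine le_trans (mul_le_mul_of_nonneg_left (pow_le_pow_left₀ (by positivity) ?_ d) hc.le) hvol
    have h1 : r ≤ 3 * (r / 2) := by omega
    have h2 : (r : ℝ) ≤ 3 * ((r / 2 : ℕ) : ℝ) := by exact_mod_cast h1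
    linarith
  have hr3' : (1 : ℝ) ≤ r / 3 := by
    have : (3 : ℝ) ≤ r := by exact_mod_cast hr3
    linarith
  have hone : 1 < B2.card := by
    have h1 : (2 : ℝ) ≤ B2.card := by
      refine le_trans ?_ hB2card
      have h2 : (r / 3 : ℝ) ≤ (r / 3 : ℝ) ^ d := le_self_pow₀ hr3' (by omega)
      have h3 : 6 ≤ r * c := by rwa [div_le_iff₀ hc] at hrc
      nlinarith
    exact_mod_cast h1
  have hnu : ∀ x ∈ B2, (1 : ℝ) ≤ nu ω x := fun x hx => by
    suffices ∃ z, openAdj ω x z by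
      obtain ⟨z, hz⟩ := this
      exact_mod_cast nu_pos hz
    by_cases hx0 : x = 0
    · obtain ⟨y, hy, hyx⟩ := Finset.exists_mem_ne hone x
      subst hx0
      obtain ⟨z, hz⟩ := (reach.symm (fun a b h => openAdj_comm.1 h)
        (chemLE_iff.1 ((hmem2 y).1 hy))).exists_last hyx
      exact ⟨z, openAdj_comm.1 hz⟩
    · obtain ⟨z, hz⟩ := (chemLE_iff.1 ((hmem2 x).1 hx)).exists_last (Ne.symm hx0)
      exact ⟨z, openAdj_comm.1 hz⟩
  have ha0 : c * (r / 3 : ℝ) ^ d / 4 ≤ ip ω B f f := by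
    have hsub : B2 ⊆ B := fun x hx => (hmem x).2 (chemBall_mono ω (Nat.div_le_self r 2)
      ((hmem2 x).1 hx))
    have h1 : ∑ x ∈ B2, (nu ω x : ℝ) * (f x * f x) ≤ ip ω B f f :=
      Finset.sum_le_sum_of_subset_of_nonneg hsub fun x _ _ => by
        have := hf0 x; positivity
    refine le_trans ?_ h1
    have h2 : ∑ x ∈ B2, (1 / 4 : ℝ) ≤ ∑ x ∈ B2, (nu ω x : ℝ) * (f x * f x) := by
      refine Finset.sum_le_sum fun x hx => ?_
      have h3 : (1 / 2 : ℝ) ≤ f x := by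
        simp only [hf, if_pos (hsub hx)]
        have h4 : 2 * cdist ω x ≤ r := by
          have := cdist_le ((hmem2 x).1 hx)
          omega
        have h5 : 2 * (cdist ω x : ℝ) ≤ r := by exact_mod_cast h4
        have : (cdist ω x : ℝ) / r ≤ 1 / 2 := by
          rw [div_le_iff₀ hrpos]; linarith
        linarith
      have h6 := hnu x hx
      have h7 : (1 / 4 : ℝ) ≤ f x * f x := by nlinarith
      nlinarith
    rw [Finset.sum_const, nsmul_eq_mul] at h2
    linarith
  have ha0pos : 0 < ip ω B f f := lt_of_lt_of_le (by positivity) ha0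
  have hen : ip ω B f f - ip ω B f (killed ω B f) ≤ d * B.card * (1 / r : ℝ) ^ 2 := by
    refine ip_sub_killed_le ω B f (fun x hx y hy hxy => ?_) (fun x hx y hy hxy => ?_)
    · simp only [hf, if_pos hx, if_pos hy]
      have h1 := cdist_le_succ ((hmem x).1 hx) hxy
      have h2 := cdist_le_succ ((hmem y).1 hy) (openAdj_comm.1 hxy)
      have h1' : (cdist ω y : ℝ) ≤ cdist ω x + 1 := by exact_mod_cast h1
      have h2' : (cdist ω x : ℝ) ≤ cdist ω y + 1 := by exact_mod_cast h2
      have h3 : (1 - (cdist ω x : ℝ) / r) - (1 - (cdist ω y : ℝ) / r) =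
        ((cdist ω y : ℝ) - cdist ω x) / r := by ring
      rw [h3, abs_div, abs_of_pos hrpos]
      refine div_le_div_of_nonneg_right ?_ hrpos.le
      rw [abs_le]; constructor <;> linarith
    · have h1 : cdist ω x = r := by
        refine le_antisymm (cdist_le ((hmem x).1 hx)) ?_
        by_contra! h
        refine hy ((hmem y).2 ?_)
        exact chemBall_mono ω (by omega : cdist ω x + 1 ≤ r)
          ((chemLE_cdist ((hmem x).1 hx)).snoc hxy)
      simp only [hf, if_pos hx, h1]
      rw [div_self hrpos.ne', sub_self]
  set θ : ℝ := 1 - K / (r : ℝ) ^ 2 with hθ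
  have hK0 : 0 ≤ K := by positivity
  have hKr : K / (r : ℝ) ^ 2 ≤ 1 / 2 := by
    rw [div_le_iff₀ (by positivity)]; linarith
  have hθ0 : 0 ≤ θ := by linarith
  have hθ1 : θ ≤ 1 := by
    have : 0 ≤ K / (r : ℝ) ^ 2 := by positivity
    linarith
  have h39 : ((3 : ℝ) * r) ^ d = 9 ^ d * (r / 3 : ℝ) ^ d := by
    rw [← mul_pow]; congr 1; ring
  have h1 : θ * ip ω B f f ≤ ip ω B f (killed ω B f) := by
    have h2 : d * B.card * (1 / r : ℝ) ^ 2 ≤ K / (r : ℝ) ^ 2 * (c * (r / 3 : ℝ) ^ d / 4) := by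
      have h3 : K / (r : ℝ) ^ 2 * (c * (r / 3 : ℝ) ^ d / 4) =
        d * (9 ^ d * (r / 3 : ℝ) ^ d) * (1 / r : ℝ) ^ 2 := by
        rw [hK]; field_simp
      rw [h3, ← h39]
      gcongr
    have h4 : K / (r : ℝ) ^ 2 * (c * (r / 3 : ℝ) ^ d / 4) ≤ K / (r : ℝ) ^ 2 * ip ω B f f :=
      mul_le_mul_of_nonneg_left ha0 (by positivity)
    rw [hθ]
    linarith
  set j := Nat.log 2 n + 1 with hj
  have hj1 : n ≤ 2 ^ j := (Nat.lt_pow_succ_log_self (by norm_num) n).le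
  have hj2 : 2 ^ j ≤ 2 * n := by
    rw [hj, pow_succ, mul_comm]
    exact Nat.mul_le_mul_left 2 (Nat.pow_log_le_self 2 (by omega))
  have h2 := ip_iterate_two_pow ω B f ha0pos hθ0 h1 j
  have hit : ∀ k x, (killed ω B)^[k] f x ≤ stay ω B k x := by
    intro k
    induction k with
    | zero => exact hf1
    | succ k ih =>
      intro x
      rw [Function.iterate_succ_apply', stay_succ]
      exact killed_mono ih x
  have h0B : (0 : Zd d) ∈ B := (hmem 0).2 (chemLE_iff.2 (reach_refl _ _))
  obtain ⟨y, hyB, hy⟩ := Finset.exists_max_image B (stay ω B n) ⟨0, h0B⟩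
  refine ⟨y, (hmem y).1 hyB, ?_⟩
  have h3 : ip ω B f ((killed ω B)^[2 ^ j] f) ≤ B.card * (2 * d * stay ω B n y) := by
    rw [← nsmul_eq_mul, ← Finset.sum_const]
    refine Finset.sum_le_sum fun x hx => ?_
    have h4 : (nu ω x : ℝ) ≤ 2 * d := by exact_mod_cast nu_le ω x
    have h5 : (killed ω B)^[2 ^ j] f x ≤ stay ω B n y :=
      (hit _ x).trans ((stay_antitone ω B x hj1).trans (hy x hx))
    have h6 : f x ≤ 1 := by
      have := hf1 x
      rwa [if_pos hx] at this
    have h7 := stay_nonneg ω B n y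
    have h8 : f x * (killed ω B)^[2 ^ j] f x ≤ stay ω B n y := by
      have := mul_le_mul_of_nonneg_left h5 (hf0 x)
      have := mul_le_mul_of_nonneg_right h6 h7
      linarith
    calc (nu ω x : ℝ) * (f x * (killed ω B)^[2 ^ j] f x)
        ≤ nu ω x * stay ω B n y := mul_le_mul_of_nonneg_left h8 (by positivity)
      _ ≤ _ := mul_le_mul_of_nonneg_right h4 h7
  have h4 : θ ^ (2 * n) ≤ θ ^ (2 ^ j) := pow_le_pow_of_le_one hθ0 hθ1 hj2
  have h5 : θ ^ (2 * n) * (c * (r / 3 : ℝ) ^ d / 4) ≤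
      (9 ^ d * (r / 3 : ℝ) ^ d) * (2 * d * stay ω B n y) := by
    calc θ ^ (2 * n) * (c * (r / 3 : ℝ) ^ d / 4) ≤ θ ^ (2 ^ j) * ip ω B f f := by gcongr
      _ ≤ B.card * (2 * d * stay ω B n y) := h2.trans h3
      _ ≤ _ := by
        rw [← h39]
        exact mul_le_mul_of_nonneg_right hBcard
          (mul_nonneg (by positivity) (stay_nonneg ω B n y))
  have hrd : (0 : ℝ) < (r / 3 : ℝ) ^ d := by positivity
  have h6 : θ ^ (2 * n) * (c / 4) ≤ 9 ^ d * (2 * d * stay ω B n y) := by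
    refine le_of_mul_le_mul_right ?_ hrd
    linarith
  rw [mul_div_assoc', div_le_iff₀ (by positivity)]
  linarith

theorem confinement_of_growth {d : ℕ} (hd : 1 ≤ d) {c : ℝ} (hc : 0 < c) :
    ∃ C > (0 : ℝ), ∀ ω : Config d,
      (∃ R : ℕ, ∀ r ≥ R, c * (r : ℝ) ^ d ≤ (chemBall ω r).ncard) →
      ∃ R : ℕ, ∀ r ≥ R, ∀ n ≥ r, Real.exp (-C * ((r : ℝ) + (n : ℝ) / (r : ℝ) ^ 2)) ≤
        PWalk ω n (fun γ => ∀ i, chemLE ω (γ i) r) := by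
  have hd' : (1 : ℝ) ≤ d := by exact_mod_cast hd
  set K : ℝ := 4 * d * 9 ^ d / c with hK
  set κ : ℝ := c / (8 * d * 9 ^ d) with hκ
  have hK0 : 0 < K := by positivity
  have hκ0 : 0 < κ := by positivity
  have hl : 0 ≤ Real.log (2 * d) := Real.log_nonneg (by linarith)
  refine ⟨4 * K + Real.log (2 * d) + |Real.log κ|, by positivity, fun ω ⟨R0, hR0⟩ => ?_⟩
  refine ⟨2 * R0 + 3 + ⌈6 / c⌉₊ + ⌈2 * K⌉₊, fun r hr n hn => ?_⟩
  have h6 : 6 / c ≤ r := (Nat.le_ceil _).trans (by exact_mod_cast (by omega))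
  have h2K : 2 * K ≤ r := (Nat.le_ceil _).trans (by exact_mod_cast (by omega))
  have hr1 : (1 : ℝ) ≤ r := by exact_mod_cast (by omega : 1 ≤ r)
  obtain ⟨y, hy, hstay⟩ := stay_ge_of_growth hd hc (ω := ω) (r := r) (n := n)
    (hR0 _ (by omega)) (by omega) h6 (by nlinarith) (by omega)
  rw [← hK, ← hκ] at hstay
  rw [pWalk_eq_stay]
  have h1 := stay_ge_of_reach hd (n := n) (reach_inside le_rfl (chemLE_iff.1 hy))
  refine le_trans ?_ h1
  have h2 : ((2 * d : ℝ)⁻¹) ^ r = Real.exp (-(r * Real.log (2 * d))) := by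
    rw [Real.exp_neg, Real.exp_nat_mul, Real.exp_log (by positivity), inv_pow]
  have h3 : Real.exp (-(4 * K * (n / (r : ℝ) ^ 2))) ≤ (1 - K / (r : ℝ) ^ 2) ^ (2 * n) := by
    have h4 : K / (r : ℝ) ^ 2 ≤ 1 / 2 := by
      rw [div_le_iff₀ (by positivity)]; nlinarith
    have h5 : Real.exp (-(2 * (K / (r : ℝ) ^ 2))) ≤ 1 - K / (r : ℝ) ^ 2 := by
      have h0 : 0 < K / (r : ℝ) ^ 2 := by positivity
      set x := K / (r : ℝ) ^ 2
      have h6 : 1 + 2 * x ≤ Real.exp (2 * x) := by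
        have := Real.add_one_le_exp (2 * x); linarith
      rw [Real.exp_neg, inv_le_comm₀ (Real.exp_pos _) (by linarith)]
      refine le_trans ?_ h6
      rw [inv_le_iff_one_le_mul₀ (by linarith)]
      nlinarith
    calc Real.exp (-(4 * K * (n / (r : ℝ) ^ 2)))
        = Real.exp (-(2 * (K / (r : ℝ) ^ 2))) ^ (2 * n) := by
          rw [← Real.exp_nat_mul]; congr 1; push_cast; ring
      _ ≤ _ := pow_le_pow_left₀ (Real.exp_pos _).le h5 _
  have h4 : Real.exp (-|Real.log κ|) ≤ κ := by
    calc Real.exp (-|Real.log κ|) ≤ Real.exp (Real.log κ) :=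
          Real.exp_le_exp.2 (neg_abs_le _)
      _ = κ := Real.exp_log hκ0
  calc Real.exp (-(4 * K + Real.log (2 * d) + |Real.log κ|) * ((r : ℝ) + (n : ℝ) / (r : ℝ) ^ 2))
      ≤ Real.exp (-(r * Real.log (2 * d)) + (-(4 * K * (n / (r : ℝ) ^ 2)) + -|Real.log κ|)) := by
        refine Real.exp_le_exp.2 ?_
        have h5 : 0 ≤ (n : ℝ) / (r : ℝ) ^ 2 := by positivity
        have h6 := abs_nonneg (Real.log κ)
        have h7 := mul_nonneg hl h5
        have h8 := mul_nonneg h6 h5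
        have h9 := mul_nonneg h6 (sub_nonneg.2 hr1)
        have h10 : 0 ≤ K * r := by positivity
        nlinarith
    _ = ((2 * d : ℝ)⁻¹) ^ r * (Real.exp (-(4 * K * (n / (r : ℝ) ^ 2))) *
          Real.exp (-|Real.log κ|)) := by
        rw [Real.exp_add, Real.exp_add, h2]
    _ ≤ ((2 * d : ℝ)⁻¹) ^ r * ((1 - K / (r : ℝ) ^ 2) ^ (2 * n) * κ) := by
        gcongr
        exact (Real.exp_pos _).le.trans h3
    _ ≤ _ := by gcongr

/-! ### Products of Bernoulli measures -/

/-- The Bernoulli measure with parameter `q`. -/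
noncomputable def coin (q : unitInterval) : Measure Bool :=
  ENNReal.ofReal q • Measure.dirac true + ENNReal.ofReal (1 - q) • Measure.dirac false

theorem coin_true (q : unitInterval) : coin q {true} = ENNReal.ofReal q := by
  simp [coin]

theorem coin_false (q : unitInterval) : coin q {false} = ENNReal.ofReal (1 - q) := by
  simp [coin]

instance (q : unitInterval) : IsProbabilityMeasure (coin q) := ⟨by
  simp only [coin, Measure.coe_add, Measure.coe_smul, Pi.add_apply, Pi.smul_apply, measure_univ,
    smul_eq_mul, mul_one]
  rw [← ENNReal.ofReal_add q.2.1 (by linarith [q.2.2])]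
  simp⟩

/-- Independent Bernoulli variables with parameters `q i`. -/
noncomputable def bern {ι : Type*} (q : ι → unitInterval) : Measure (ι → Bool) :=
  Measure.infinitePi fun i => coin (q i)

instance {ι : Type*} (q : ι → unitInterval) : IsProbabilityMeasure (bern q) := by
  unfold bern; infer_instance

/-- The event `A` depends only on the coordinates in `S`. -/
def DepOn {ι : Type*} (S : Set ι) (A : Set (ι → Bool)) : Prop :=
  ∀ ω ω' : ι → Bool, (∀ i ∈ S, ω i = ω' i) → ω ∈ A → ω' ∈ A

section DepOn

variable {ι : Type*} {S T : Set ι} {A B : Set (ι → Bool)}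

theorem DepOn.mono (h : DepOn S A) (hST : S ⊆ T) : DepOn T A :=
  fun ω ω' hω => h ω ω' fun i hi => hω i (hST hi)

theorem DepOn.iff (h : DepOn S A) {ω ω' : ι → Bool} (hω : ∀ i ∈ S, ω i = ω' i) :
    ω ∈ A ↔ ω' ∈ A :=
  ⟨h ω ω' hω, h ω' ω fun i hi => (hω i hi).symm⟩

theorem DepOn.compl (h : DepOn S A) : DepOn S Aᶜ := fun ω ω' hω hA hA' =>
  hA (h ω' ω (fun i hi => (hω i hi).symm) hA')

theorem DepOn.inter (hA : DepOn S A) (hB : DepOn S B) : DepOn S (A ∩ B) :=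
  fun ω ω' hω h => ⟨hA ω ω' hω h.1, hB ω ω' hω h.2⟩

theorem DepOn.union (hA : DepOn S A) (hB : DepOn S B) : DepOn S (A ∪ B) :=
  fun ω ω' hω h => h.imp (hA ω ω' hω) (hB ω ω' hω)

theorem DepOn.iInter {κ : Sort*} {A : κ → Set (ι → Bool)} (h : ∀ k, DepOn S (A k)) :
    DepOn S (⋂ k, A k) := fun ω ω' hω hA =>
  Set.mem_iInter.2 fun k => h k ω ω' hω (Set.mem_iInter.1 hA k)

theorem DepOn.measurableSet (h : DepOn S A) (hS : S.Finite) : MeasurableSet A := by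
  have := hS.to_subtype
  have h1 : A = S.domRestrict ⁻¹' (S.domRestrict '' A) := by
    refine (Set.subset_preimage_image _ _).antisymm ?_
    rintro ω ⟨ω', hω', hr⟩
    exact h ω' ω (fun i hi => congrFun hr ⟨i, hi⟩) hω'
  rw [h1]
  exact (measurable_pi_lambda _ fun i => measurable_pi_apply _ : Measurable S.domRestrict)
    (Set.toFinite _).measurableSet

theorem DepOn.measurableSet_iSup (h : DepOn S A) (hA : MeasurableSet A) :
    MeasurableSet[⨆ i ∈ S, MeasurableSpace.comap (fun ω : ι → Bool => ω i) ⊤] A := by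
  classical
  set m : MeasurableSpace (ι → Bool) :=
    ⨆ i ∈ S, MeasurableSpace.comap (fun ω : ι → Bool => ω i) ⊤ with hm
  let φ : (ι → Bool) → (ι → Bool) := fun ω i => if i ∈ S then ω i else false
  have hφ : @Measurable _ _ m MeasurableSpace.pi φ := by
    rw [@measurable_pi_iff]
    intro i
    by_cases hi : i ∈ S
    · simp only [φ, hi, if_true]
      have h1 : MeasurableSpace.comap (fun ω : ι → Bool => ω i) ⊤ ≤ m :=
        le_iSup₂ (f := fun i (_ : i ∈ S) =>
          MeasurableSpace.comap (fun ω : ι → Bool => ω i) ⊤) i hi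
      exact (comap_measurable _).mono h1 le_rfl
    · simp only [φ, hi, if_false]
      exact @measurable_const _ _ _ m _
  have h1 : A = φ ⁻¹' A := by
    ext ω
    exact h.iff fun i hi => by simp [φ, hi]
  rw [h1]
  exact hφ hA

end DepOn

/-- Events depending on disjoint sets of coordinates are independent. -/
theorem bern_inter {ι : Type*} (q : ι → unitInterval) {S T : Set ι} {A B : Set (ι → Bool)}
    (hA : DepOn S A) (hB : DepOn T B) (hST : Disjoint S T) (mA : MeasurableSet A)
    (mB : MeasurableSet B) : (bern q).real (A ∩ B) = (bern q).real A * (bern q).real B := by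
  have h1 : ProbabilityTheory.iIndepFun (fun (i : ι) (ω : ι → Bool) => ω i) (bern q) :=
    ProbabilityTheory.iIndepFun_infinitePi (X := fun _ b => b) fun _ => measurable_id
  have h2 := ProbabilityTheory.indep_iSup_of_disjoint
    (fun i => (measurable_pi_apply i).comap_le) h1 hST
  have h3 := (ProbabilityTheory.Indep_iff _ _ _).1 h2 A B (hA.measurableSet_iSup mA)
    (hB.measurableSet_iSup mB)
  simp only [Measure.real, h3, ENNReal.toReal_mul]

theorem bern_iInter {ι κ : Type*} (q : ι → unitInterval) (s : Finset κ) (S : κ → Set ι)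
    (A : κ → Set (ι → Bool)) (hA : ∀ k, DepOn (S k) (A k))
    (hS : ∀ k ∈ s, ∀ l ∈ s, k ≠ l → Disjoint (S k) (S l)) (mA : ∀ k, MeasurableSet (A k)) :
    (bern q).real (⋂ k ∈ s, A k) = ∏ k ∈ s, (bern q).real (A k) := by
  classical
  induction s using Finset.induction_on with
  | empty => simp
  | insert a s ha ih =>
    rw [Finset.set_biInter_insert, Finset.prod_insert ha, ← ih fun k hk l hl =>
      hS k (Finset.mem_insert_of_mem hk) l (Finset.mem_insert_of_mem hl)]
    refine bern_inter q (T := ⋃ k ∈ s, S k) (hA a) ?_ ?_ (mA a)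
      (Finset.measurableSet_biInter s fun k _ => mA k)
    · refine fun ω ω' hω h => Set.mem_iInter₂.2 fun k hk => ?_
      exact hA k ω ω' (fun i hi => hω i (Set.mem_iUnion₂.2 ⟨k, hk, hi⟩)) (Set.mem_iInter₂.1 h k hk)
    · rw [Set.disjoint_iUnion₂_right]
      intro k hk
      exact hS a (Finset.mem_insert_self _ _) k (Finset.mem_insert_of_mem hk)
        (by rintro rfl; exact ha hk)

theorem bern_coord (ι : Type*) (q : ι → unitInterval) (i : ι) (b : Bool) :
    (bern q).real {ω | ω i = b} = if b then (q i : ℝ) else 1 - q i := by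
  have h1 : bern q {ω | ω i = b} = coin (q i) {b} := by
    have := Measure.infinitePi_map_eval (fun i => coin (q i)) i
    rw [← this, Measure.map_apply (measurable_pi_apply i) (measurableSet_singleton b)]
    rfl
  rw [Measure.real, h1]
  cases b
  · rw [coin_false, ENNReal.toReal_ofReal (by linarith [(q i).2.2])]; simp
  · rw [coin_true, ENNReal.toReal_ofReal (q i).2.1]; simp

theorem bern_cyl {ι : Type*} (q : ι → unitInterval) (s : Finset ι) (f : ι → Bool) :
    (bern q).real {ω | ∀ i ∈ s, ω i = f i} =
      ∏ i ∈ s, if f i then (q i : ℝ) else 1 - q i := by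
  have h := bern_iInter q s (fun i => {i}) (fun i => {ω | ω i = f i})
    (fun i ω ω' h hω => (h i rfl).symm.trans hω)
    (fun k _ l _ hkl => by simpa using hkl)
    (fun i => (measurable_pi_apply i : Measurable fun ω : ι → Bool => ω i)
      (measurableSet_singleton (f i)))
  rw [Finset.prod_congr rfl fun i _ => bern_coord ι q i (f i)] at h
  rw [← h]
  congr 1
  ext ω
  simp

/-- A measure with the cylinder probabilities of a Bernoulli product is that product. -/
theorem eq_bern {ι : Type*} (q : ι → unitInterval) (μ : Measure (ι → Bool))
    [IsProbabilityMeasure μ]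
    (h : ∀ (s : Finset ι) (f : ι → Bool), μ.real {ω | ∀ i ∈ s, ω i = f i} =
      ∏ i ∈ s, if f i then (q i : ℝ) else 1 - q i) : μ = bern q := by
  classical
  refine Measure.eq_infinitePi _ fun s t ht => ?_
  by_cases he : ∃ i ∈ s, t i = ∅
  · obtain ⟨i, hi, hti⟩ := he
    rw [Finset.prod_eq_zero hi (by rw [hti, measure_empty])]
    have : Set.pi (s : Set ι) t = ∅ := by
      rw [Set.pi_eq_empty_iff]
      exact ⟨i, Or.inr ⟨hi, hti⟩⟩
    rw [this, measure_empty]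
  push Not at he
  set s' := s.filter fun i => t i ≠ Set.univ with hs'
  have hex : ∀ i, ∃ b, i ∈ s' → t i = {b} := by
    intro i
    by_cases hi : i ∈ s'
    · obtain ⟨b, hb⟩ := he i (Finset.mem_filter.1 hi).1
      have hu := (Finset.mem_filter.1 hi).2
      refine ⟨b, fun _ => ?_⟩
      ext c
      simp only [Set.mem_singleton_iff]
      refine ⟨fun hc => ?_, fun hc => hc ▸ hb⟩
      by_contra hcb
      refine hu (Set.eq_univ_of_forall fun e => ?_)
      cases e <;> cases b <;> cases c <;> simp_all
    · exact ⟨true, fun h => absurd h hi⟩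
  choose f hf using hex
  have h1 : Set.pi (s : Set ι) t = {ω | ∀ i ∈ s', ω i = f i} := by
    ext ω
    simp only [Set.mem_pi, Finset.mem_coe]
    constructor
    · intro hω i hi
      have := hω i (Finset.mem_filter.1 hi).1
      rwa [hf i hi] at this
    · intro hω i hi
      by_cases hu : t i = Set.univ
      · rw [hu]; trivial
      · have hi' : i ∈ s' := Finset.mem_filter.2 ⟨hi, hu⟩
        rw [hf i hi']; exact hω i hi'
  have h2 : ∏ i ∈ s, coin (q i) (t i) = ∏ i ∈ s', coin (q i) (t i) := by
    rw [hs', Finset.prod_filter]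
    refine Finset.prod_congr rfl fun i _ => ?_
    split_ifs with hu
    · rfl
    · push Not at hu; rw [hu, measure_univ]
  rw [h1, h2, ← ENNReal.ofReal_toReal (measure_ne_top μ _)]
  change ENNReal.ofReal (μ.real _) = _
  rw [h, ENNReal.ofReal_prod_of_nonneg]
  · refine Finset.prod_congr rfl fun i hi => ?_
    rw [hf i hi]
    cases f i
    · rw [coin_false]; simp
    · rw [coin_true]; simp
  · intro i _
    split_ifs
    · exact (q i).2.1
    · linarith [(q i).2.2]

theorem IsBernoulli.eq_bern {d : ℕ} {p : unitInterval} {Q : Measure (Config d)}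
    (h : IsBernoulli p Q) : Q = bern fun _ => p := by
  have := h.1
  refine Perco.eq_bern _ _ fun s f => ?_
  rw [Measure.real, h.2, ENNReal.toReal_prod]
  refine Finset.prod_congr rfl fun i _ => ?_
  split_ifs
  · exact ENNReal.toReal_ofReal p.2.1
  · exact ENNReal.toReal_ofReal (by linarith [p.2.2])

/-- Restriction of a Bernoulli product along an injection. -/
theorem bern_map_comp {ι κ : Type*} (q : ι → unitInterval) {j : κ → ι}
    (hj : Function.Injective j) :
    (bern q).map (fun ω k => ω (j k)) = bern fun k => q (j k) :=
  Measure.map_infinitePi_infinitePi_of_inj hj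

theorem bern_preimage_comp {ι κ : Type*} (q : ι → unitInterval) {j : κ → ι}
    (hj : Function.Injective j) {A : Set (κ → Bool)} (hA : MeasurableSet A) :
    (bern q).real ((fun ω k => ω (j k)) ⁻¹' A) = (bern fun k => q (j k)).real A := by
  rw [← bern_map_comp q hj, measureReal_def, measureReal_def, Measure.map_apply _ hA]
  exact measurable_pi_lambda _ fun k => measurable_pi_apply _

/-- An event which, inside every cylinder event, leaves a proportion of the mass to its
complement, is null. -/
theorem null_of_forall_cylinder {ι : Type*} (μ : Measure (ι → Bool)) [IsProbabilityMeasure μ]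
    {D : Set (ι → Bool)} (hD : MeasurableSet D) {c : ℝ} (hc : 0 < c)
    (h : ∀ (S : Finset ι) (B : Set (ι → Bool)), DepOn (S : Set ι) B →
      c * μ.real (B ∩ D) ≤ μ.real (B \ D)) : μ.real D = 0 := by
  set C : Set (Set (ι → Bool)) := {B | ∃ S : Finset ι, DepOn (S : Set ι) B} with hC
  classical
  have hring : IsSetRing C := by
    refine ⟨⟨∅, fun _ _ _ h => h⟩, ?_, ?_⟩
    · rintro s t ⟨S, hS⟩ ⟨T, hT⟩
      exact ⟨S ∪ T, (hS.mono (by simp)).union (hT.mono (by simp))⟩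
    · rintro s t ⟨S, hS⟩ ⟨T, hT⟩
      exact ⟨S ∪ T, (hS.mono (by simp)).inter (hT.mono (by simp)).compl⟩
  have huniv : (Set.univ : Set (ι → Bool)) ∈ C := ⟨∅, fun _ _ _ _ => trivial⟩
  have hgen : (MeasurableSpace.pi : MeasurableSpace (ι → Bool)) =
      MeasurableSpace.generateFrom C := by
    refine le_antisymm ?_ (MeasurableSpace.generateFrom_le ?_)
    · refine iSup_le fun i => ?_
      rintro _ ⟨t, _, rfl⟩
      refine MeasurableSpace.measurableSet_generateFrom ⟨{i}, fun ω ω' hω h => ?_⟩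
      have := hω i (by simp)
      simpa [← this] using h
    · rintro t ⟨S, hS⟩
      exact hS.measurableSet S.finite_toSet
  by_contra hne
  have hpos : 0 < μ.real D := lt_of_le_of_ne measureReal_nonneg (Ne.symm hne)
  set ε : ℝ := c * μ.real D / (2 * (1 + c)) with hε
  have hεpos : 0 < ε := by positivity
  obtain ⟨B, ⟨S, hS⟩, hB⟩ := exists_measure_symmDiff_lt_of_generateFrom_isSetRing (μ := μ) hring
    ⟨{Set.univ}, Set.countable_singleton _, by simpa using huniv, by simp⟩ hgen hD
    (ENNReal.ofReal_pos.2 hεpos)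
  have hB' : μ.real (symmDiff B D) < ε := by
    rw [measureReal_def]
    exact (ENNReal.lt_ofReal_iff_toReal_lt (measure_ne_top _ _)).1 hB
  have h1 : μ.real (B \ D) ≤ μ.real (symmDiff B D) :=
    measureReal_mono (fun x hx => Or.inl hx)
  have h2 : μ.real D ≤ μ.real (B ∩ D) + μ.real (symmDiff B D) := by
    refine le_trans (measureReal_mono fun x hx => ?_) (measureReal_union_le _ _)
    by_cases hxB : x ∈ B
    · exact Or.inl ⟨hxB, hx⟩
    · exact Or.inr (Or.inr ⟨hx, hxB⟩)
  have h3 := h S B hS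
  have h4 : ε * (2 * (1 + c)) = c * μ.real D := by
    rw [hε]; field_simp
  nlinarith

/-! ### Harris' inequality -/

section Harris

variable {ι : Type*}

open Classical in
/-- Extension by `false` of a configuration on a finite set of coordinates. -/
noncomputable def extend (S : Finset ι) (a : S → Bool) : ι → Bool :=
  fun i => if h : i ∈ S then a ⟨i, h⟩ else false

theorem extend_mono (S : Finset ι) : Monotone (extend S) := by
  intro a b hab i
  unfold extend
  split_ifs with h
  · exact hab ⟨i, h⟩
  · exact le_rfl

open Classical in
theorem bern_real_eq_sum (q : ι → unitInterval) (S : Finset ι) {A : Set (ι → Bool)}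
    (hA : DepOn (S : Set ι) A) :
    (bern q).real A = ∑ a : S → Bool,
      (∏ i ∈ S, if extend S a i then (q i : ℝ) else 1 - q i) *
        (if extend S a ∈ A then 1 else 0) := by
  classical
  have h1 : A = ⋃ a ∈ (Finset.univ : Finset (S → Bool)).filter (fun a => extend S a ∈ A),
      {ω | ∀ i ∈ S, ω i = extend S a i} := by
    ext ω
    simp only [Set.mem_iUnion, Finset.mem_filter, Finset.mem_univ, true_and, exists_prop]
    constructor
    · intro h
      have h2 : ∀ i ∈ S, ω i = extend S (fun i => ω i) i := fun i hi => by simp [extend, hi]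
      exact ⟨fun i => ω i, hA _ _ h2 h, h2⟩
    · rintro ⟨a, ha, h⟩
      exact hA _ _ (fun i hi => (h i hi).symm) ha
  conv_lhs => rw [h1]
  rw [measureReal_biUnion_finset]
  · rw [Finset.sum_filter]
    refine Finset.sum_congr rfl fun a _ => ?_
    rw [bern_cyl]
    split_ifs <;> simp
  · intro a _ b _ hab
    refine Set.disjoint_left.2 fun ω h h' => hab ?_
    funext i
    have := (h i i.2).symm.trans (h' i i.2)
    simpa [extend] using this
  · intro a _
    refine DepOn.measurableSet (S := (S : Set ι)) ?_ S.finite_toSet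
    intro ω ω' h hω i hi
    rw [← h i hi]; exact hω i hi

theorem harris (q : ι → unitInterval) (S : Finset ι) {A B : Set (ι → Bool)}
    (hA : DepOn (S : Set ι) A) (hB : DepOn (S : Set ι) B)
    (iA : ∀ ω ω', ω ≤ ω' → ω ∈ A → ω' ∈ A) (iB : ∀ ω ω', ω ≤ ω' → ω ∈ B → ω' ∈ B) :
    (bern q).real A * (bern q).real B ≤ (bern q).real (A ∩ B) := by
  classical
  rw [bern_real_eq_sum q S hA, bern_real_eq_sum q S hB, bern_real_eq_sum q S (hA.inter hB)]
  set w : (S → Bool) → ℝ := fun a => ∏ i ∈ S, if extend S a i then (q i : ℝ) else 1 - q i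
  have hw : (∑ a, w a) = 1 := by
    have := bern_real_eq_sum q S (A := Set.univ) (fun _ _ _ _ => trivial)
    simpa using this.symm
  have key := fkg (μ := w) (f := fun a => if extend S a ∈ A then 1 else 0)
    (g := fun a => if extend S a ∈ B then 1 else 0) ?_ ?_ ?_ ?_ ?_ ?_
  · rw [hw, one_mul] at key
    refine key.trans (le_of_eq (Finset.sum_congr rfl fun a _ => ?_))
    change w a * _ = w a * _
    simp only [Set.mem_inter_iff]
    by_cases h1 : extend S a ∈ A <;> by_cases h2 : extend S a ∈ B <;> simp [h1, h2]
  · intro a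
    refine Finset.prod_nonneg fun i _ => ?_
    split_ifs
    · exact (q i).2.1
    · linarith [(q i).2.2]
  · intro a; dsimp; split_ifs <;> norm_num
  · intro a; dsimp; split_ifs <;> norm_num
  · intro a b hab
    dsimp
    split_ifs with h1 h2 h2
    · exact le_rfl
    · exact absurd (iA _ _ (extend_mono S hab) h1) h2
    · norm_num
    · exact le_rfl
  · intro a b hab
    dsimp
    split_ifs with h1 h2 h2
    · exact le_rfl
    · exact absurd (iB _ _ (extend_mono S hab) h1) h2
    · norm_num
    · exact le_rfl
  · intro a b
    simp only [w]
    rw [← Finset.prod_mul_distrib, ← Finset.prod_mul_distrib]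
    refine le_of_eq (Finset.prod_congr rfl fun i hi => ?_)
    simp only [extend, hi, dif_pos, Pi.inf_apply, Pi.sup_apply]
    cases a ⟨i, hi⟩ <;> cases b ⟨i, hi⟩ <;> simp [mul_comm]

theorem harris_decreasing (q : ι → unitInterval) (S : Finset ι) {A B : Set (ι → Bool)}
    (hA : DepOn (S : Set ι) A) (hB : DepOn (S : Set ι) B)
    (iA : ∀ ω ω', ω ≤ ω' → ω' ∈ A → ω ∈ A) (iB : ∀ ω ω', ω ≤ ω' → ω' ∈ B → ω ∈ B) :
    (bern q).real A * (bern q).real B ≤ (bern q).real (A ∩ B) := by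
  have mA := hA.measurableSet S.finite_toSet
  have mB := hB.measurableSet S.finite_toSet
  have h := harris q S hA.compl hB.compl (fun ω ω' h h1 h2 => h1 (iA ω ω' h h2))
    (fun ω ω' h h1 h2 => h1 (iB ω ω' h h2))
  rw [← Set.compl_union, probReal_compl_eq_one_sub mA, probReal_compl_eq_one_sub mB,
    probReal_compl_eq_one_sub (mA.union mB)] at h
  have := measureReal_union_add_inter (μ := bern q) (s := A) mB
  nlinarith

theorem harris_prod_le {κ : Type*} (q : ι → unitInterval) (S : Finset ι) (t : Finset κ)
    (A : κ → Set (ι → Bool)) (hA : ∀ k, DepOn (S : Set ι) (A k))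
    (iA : ∀ k ω ω', ω ≤ ω' → ω' ∈ A k → ω ∈ A k) :
    ∏ k ∈ t, (bern q).real (A k) ≤ (bern q).real (⋂ k ∈ t, A k) := by
  classical
  induction t using Finset.induction_on with
  | empty => simp
  | insert a t ha ih =>
    rw [Finset.set_biInter_insert, Finset.prod_insert ha]
    refine (mul_le_mul_of_nonneg_left ih measureReal_nonneg).trans ?_
    refine harris_decreasing q S (hA a) (DepOn.iInter fun k => DepOn.iInter fun _ => hA k)
      (iA a) ?_
    intro ω ω' h h'
    simp only [Set.mem_iInter] at h' ⊢
    exact fun k hk => iA k ω ω' h (h' k hk)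

end Harris

/-! ### Superposition of independent layers -/

/-- The superposition of a base configuration and finitely many layers. -/
def superpose {ι κ : Type*} [Fintype κ] (ω : κ × ι → Bool) : ι → Bool :=
  fun e => decide (∃ k, ω (k, e) = true)

theorem measurable_superpose {ι κ : Type*} [Fintype κ] :
    Measurable (superpose : (κ × ι → Bool) → ι → Bool) := by
  classical
  refine measurable_pi_lambda _ fun e => ?_
  refine measurable_to_bool ?_
  refine DepOn.measurableSet (S := (Finset.univ.image fun k : κ => (k, e) : Set (κ × ι))) ?_
    (Finset.finite_toSet _)
  intro ω ω' h hω
  simp only [superpose, Set.mem_preimage, Set.mem_singleton_iff, decide_eq_true_eq] at hω ⊢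
  obtain ⟨k, hk⟩ := hω
  exact ⟨k, by rw [← h (k, e) (by simp)]; exact hk⟩

theorem bern_map_superpose {ι κ : Type*} [Fintype κ] (q : κ → unitInterval) (p : unitInterval)
    (h : 1 - (p : ℝ) = ∏ k, (1 - (q k : ℝ))) :
    (bern fun i : κ × ι => q i.1).map superpose = bern fun _ : ι => p := by
  classical
  have := Measure.isProbabilityMeasure_map (μ := bern fun i : κ × ι => q i.1)
    (measurable_superpose (ι := ι) (κ := κ)).aemeasurable
  have hblock : ∀ (e : ι) (b : Bool), DepOn (Set.range fun k : κ => (k, e))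
      {ω : κ × ι → Bool | superpose ω e = b} := by
    intro e b ω ω' hω h1
    have : superpose ω e = superpose ω' e := by
      simp only [superpose]
      congr 1
      refine propext (exists_congr fun k => ?_)
      rw [hω (k, e) ⟨k, rfl⟩]
    exact this.symm.trans h1
  have hm : ∀ (e : ι) (b : Bool), MeasurableSet {ω : κ × ι → Bool | superpose ω e = b} :=
    fun e b => (hblock e b).measurableSet (Set.finite_range _)
  have hfalse : ∀ e : ι, (bern fun i : κ × ι => q i.1).real {ω | superpose ω e = false} =
      1 - p := by
    intro e
    have h1 : {ω : κ × ι → Bool | superpose ω e = false} =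
        {ω | ∀ i ∈ Finset.univ.image fun k : κ => (k, e), ω i = false} := by
      ext ω
      simp [superpose]
    rw [h1, bern_cyl _ _ fun _ => false, h, Finset.prod_image]
    · simp
    · intro a _ b _ hab
      exact (Prod.ext_iff.1 hab).1
  refine eq_bern _ _ fun s f => ?_
  have hset : {ω : ι → Bool | ∀ i ∈ s, ω i = f i} = ⋂ i ∈ s, {ω | ω i = f i} := by
    ext ω; simp
  rw [measureReal_def, Measure.map_apply measurable_superpose, ← measureReal_def]
  · have hset2 : superpose ⁻¹' {ω : ι → Bool | ∀ i ∈ s, ω i = f i} =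
        ⋂ i ∈ s, {ω : κ × ι → Bool | superpose ω i = f i} := by
      ext ω; simp
    rw [hset2, bern_iInter _ s (fun e => Set.range fun k : κ => (k, e)) _
      (fun e => hblock e (f e)) _ fun e => hm e (f e)]
    · refine Finset.prod_congr rfl fun e _ => ?_
      cases f e
      · rw [hfalse]; simp
      · have h2 : {ω : κ × ι → Bool | superpose ω e = true} =
            {ω | superpose ω e = false}ᶜ := by
          ext ω; simp
        rw [h2, probReal_compl_eq_one_sub (hm e false), hfalse]
        simp
    · intro e _ e' _ hee
      refine Set.disjoint_left.2 ?_
      rintro _ ⟨k, rfl⟩ ⟨k', hk⟩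
      exact hee (Prod.ext_iff.1 hk).2.symm
  · refine DepOn.measurableSet (S := (s : Set ι)) (fun ω ω' hω h1 i hi => ?_) s.finite_toSet
    rw [← hω i hi]; exact h1 i hi

/-! ### Topology of the orthant -/

/-- Vertices of the orthant `ℕ^d`. -/
abbrev Nd (d : ℕ) := Fin d → ℕ

/-- Nearest-neighbour adjacency in the orthant. -/
def nadj {d : ℕ} (x y : Nd d) : Prop :=
  ∃ i, y = x + Pi.single i 1 ∨ x = y + Pi.single i 1

/-- Two sites of the orthant at `ℓ^∞` distance at most one. -/
def star {d : ℕ} (x y : Nd d) : Prop := ∀ i, x i ≤ y i + 1 ∧ y i ≤ x i + 1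

/-- Restriction of a relation to a set. -/
def onSet {α : Type*} (r : α → α → Prop) (U : Set α) (x y : α) : Prop := r x y ∧ x ∈ U ∧ y ∈ U

theorem nadj.symm {d : ℕ} {x y : Nd d} (h : nadj x y) : nadj y x := by
  obtain ⟨i, h⟩ := h
  exact ⟨i, h.symm⟩

theorem star.symm {d : ℕ} {x y : Nd d} (h : star x y) : star y x := fun i => (h i).symm

theorem star_add {d : ℕ} (x a b : Nd d) (ha : ∀ i, a i ≤ 1) (hb : ∀ i, b i ≤ 1) :
    star (x + a) (x + b) := fun i => by
  have := ha i
  have := hb i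
  simp only [Pi.add_apply]
  omega

theorem nadj.star {d : ℕ} {x y : Nd d} (h : nadj x y) : star x y := by
  intro j
  obtain ⟨i, rfl | rfl⟩ := h <;> by_cases hj : j = i <;> simp [hj] <;> omega

theorem nadj_add {d : ℕ} (x : Nd d) (i : Fin d) : nadj x (x + Pi.single i 1) := ⟨i, Or.inl rfl⟩

/-- A closed one-cochain on the orthant is exact. -/
theorem exists_potential {d : ℕ} {M : Type*} [AddCommGroup M] (c : Fin d → Nd d → M)
    (hc : ∀ x i j, i ≠ j → c i x + c j (x + Pi.single i 1) = c j x + c i (x + Pi.single j 1)) :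
    ∃ φ : Nd d → M, ∀ x i, φ (x + Pi.single i 1) = φ x + c i x := by
  classical
  have key : ∀ n : ℕ, ∃ φ : Nd d → M, ∀ x i, ∑ j, x j < n →
      φ (x + Pi.single i 1) = φ x + c i x := by
    intro n
    induction n with
    | zero => exact ⟨0, fun x i h => absurd h (by omega)⟩
    | succ n ih =>
      obtain ⟨φ, hφ⟩ := ih
      have hsum : ∀ (x : Nd d) i, ∑ j, (x + Pi.single i 1 : Nd d) j = ∑ j, x j + 1 := by
        intro x i
        simp [Finset.sum_add_distrib]
      let ψ : Nd d → M := fun y => if h : ∑ j, y j = n + 1 ∧ ∃ z : Nd d × Fin d,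
        y = z.1 + Pi.single z.2 1 then φ h.2.choose.1 + c h.2.choose.2 h.2.choose.1 else φ y
      refine ⟨ψ, fun x i hx => ?_⟩
      have hψx : ψ x = φ x := dif_neg fun h => by omega
      rw [hψx]
      rcases Nat.lt_succ_iff_lt_or_eq.1 hx with hx | hx
      · rw [← hφ x i hx]
        exact dif_neg fun h => by rw [hsum] at h; omega
      · have h : ∑ j, (x + Pi.single i 1 : Nd d) j = n + 1 ∧ ∃ z : Nd d × Fin d,
          x + Pi.single i 1 = z.1 + Pi.single z.2 1 := ⟨by rw [hsum, hx], (x, i), rfl⟩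
        have hval : ψ (x + Pi.single i 1) = φ h.2.choose.1 + c h.2.choose.2 h.2.choose.1 :=
          dif_pos h
        rw [hval]
        have hz := h.2.choose_spec
        generalize h.2.choose = z at hz
        obtain ⟨z, k⟩ := z
        dsimp only at hz ⊢
        by_cases hik : i = k
        · subst hik
          rw [add_right_cancel hz]
        · have hzi : 1 ≤ z i := by
            have := congrFun hz i
            simp [hik] at this
            omega
          have hy : z = (z - Pi.single i 1) + Pi.single i 1 := by
            funext j
            by_cases hj : j = i
            · subst hj; simp; omega
            · simp [hj]
          set y := z - Pi.single i 1 with hydef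
          have hxy : x = y + Pi.single k 1 := by
            have : x + Pi.single i 1 = (y + Pi.single k 1) + Pi.single i 1 := by
              rw [hz]; nth_rewrite 1 [hy]; abel
            exact add_right_cancel this
          have hlt : ∑ j, y j < n := by
            have := hsum y k
            rw [← hxy, hx] at this
            omega
          rw [hy, hxy, hφ y i hlt, hφ y k hlt, add_assoc, add_assoc, hc y i k hik]
  choose Φ hΦ using key
  have hind : ∀ m x, ∀ n n', ∑ j, x j = m → m < n → m < n' →
      Φ n x - Φ n 0 = Φ n' x - Φ n' 0 := by
    intro m
    induction m with
    | zero =>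
      intro x n n' hx _ _
      have : x = 0 := by
        funext j
        have := (Finset.sum_eq_zero_iff.1 hx) j (Finset.mem_univ j)
        simpa using this
      simp [this]
    | succ m ih =>
      intro x n n' hx hn hn'
      obtain ⟨i, hi⟩ : ∃ i, x i ≠ 0 := by
        by_contra! h
        simp [h] at hx
      have hy : x = (x - Pi.single i 1) + Pi.single i 1 := by
        funext j
        by_cases hj : j = i
        · subst hj; simp; omega
        · simp [hj]
      set y := x - Pi.single i 1
      have hs : ∑ j, y j = m := by
        rw [hy] at hx
        simp [Finset.sum_add_distrib] at hx
        simpa using hx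
      rw [hy, hΦ n y i (by omega), hΦ n' y i (by omega), add_sub_right_comm,
        add_sub_right_comm, ih y n n' hs (by omega) (by omega)]
  refine ⟨fun x => Φ (∑ j, x j + 1) x - Φ (∑ j, x j + 1) 0, fun x i => ?_⟩
  have hs : ∑ j, (x + Pi.single i 1 : Nd d) j = ∑ j, x j + 1 := by
    simp [Finset.sum_add_distrib]
  dsimp only
  rw [hs, ← hind _ x (∑ j, x j + 1 + 1) (∑ j, x j + 1) rfl (by omega) (by omega),
    hΦ (∑ j, x j + 1 + 1) x i (by omega)]
  abel

/-- A path in `P` between two points of the same component of the complement of `S` can be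
rerouted along `P` and the sites neighbouring `S`. -/
theorem reroute {d : ℕ} {S P : Set (Nd d)} {x y : Nd d} (hx : x ∉ S) (hxP : x ∈ P)
    (hW : Relation.ReflTransGen (onSet nadj Sᶜ) x y)
    (hP : Relation.ReflTransGen (onSet nadj P) x y) :
    Relation.ReflTransGen (onSet nadj {w | w ∉ S ∧ (w ∈ P ∨ ∃ s ∈ S, star w s)}) x y := by
  classical
  set U : Set (Nd d) := {w | w ∉ S ∧ (w ∈ P ∨ ∃ s ∈ S, star w s)} with hU
  let W : Set (Nd d) := {w | Relation.ReflTransGen (onSet nadj Sᶜ) x w}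
  let A : Set (Nd d) := {w | Relation.ReflTransGen (onSet nadj U) x w ∧ ∃ s ∈ S, star w s}
  have hxU : x ∈ U := ⟨hx, Or.inl hxP⟩
  have hAS : ∀ w ∈ A, w ∉ S := by
    rintro w ⟨hw, -⟩ hwS
    rcases Relation.ReflTransGen.cases_tail hw with h | ⟨z, _, hz⟩
    · exact hx (h ▸ hwS)
    · exact hz.2.2.1 hwS
  have hstep : ∀ u v : Nd d, u ∈ A → nadj u v → v ∉ S → (∃ s ∈ S, star v s) → v ∈ A := by
    intro u v hu huv hv hs
    refine ⟨hu.1.tail ⟨huv, ⟨hAS u hu, Or.inr hu.2⟩, hv, Or.inr hs⟩, hs⟩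
  let α : Nd d → ZMod 2 := fun w => if w ∈ A then 1 else 0
  let σ : Nd d → ZMod 2 := fun w => if w ∈ S then 1 else 0
  let e : Nd d → Nd d → ZMod 2 := fun u v => α u * σ v + α v * σ u
  have hα0 : ∀ w, w ∉ A → α w = 0 := fun w h => if_neg h
  have hα1 : ∀ w, w ∈ A → α w = 1 := fun w h => if_pos h
  have hσ0 : ∀ w, w ∉ S → σ w = 0 := fun w h => if_neg h
  have hσ1 : ∀ w, w ∈ S → σ w = 1 := fun w h => if_pos h
  have hadd : ∀ a : ZMod 2, a + a = 0 := by decide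
  have he1 : ∀ u v : Nd d, nadj u v → (∃ s ∈ S, star u s) → (∃ s ∈ S, star v s) →
      e u v = α u + α v := by
    intro u v huv hus hvs
    simp only [e]
    by_cases hu : u ∈ A <;> by_cases hv : v ∈ A
    · simp [hα1 _ hu, hα1 _ hv, hσ0 _ (hAS _ hu), hσ0 _ (hAS _ hv), hadd]
    · have : v ∈ S := by
        by_contra h
        exact hv (hstep u v hu huv h hvs)
      simp [hα1 _ hu, hα0 _ hv, hσ1 _ this]
    · have : u ∈ S := by
        by_contra h
        exact hu (hstep v u hv huv.symm h hus)
      simp [hα0 _ hu, hα1 _ hv, hσ1 _ this]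
    · simp [hα0 _ hu, hα0 _ hv]
  have he0 : ∀ u v : Nd d, u ∉ S → v ∉ S → e u v = 0 := by
    intro u v hu hv
    simp [e, hσ0 _ hu, hσ0 _ hv]
  obtain ⟨φ, hφ⟩ := exists_potential (fun i z => e z (z + Pi.single i 1)) (by
    intro z i j hij
    have hcomm : z + Pi.single j 1 + Pi.single i 1 = z + Pi.single i 1 + Pi.single j 1 := by abel
    rw [hcomm]
    have hz0 : z = z + 0 := (add_zero z).symm
    have hij' : z + Pi.single i 1 + Pi.single j 1 = z + (Pi.single i 1 + Pi.single j 1) :=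
      add_assoc _ _ _
    have b0 : ∀ k, (0 : Nd d) k ≤ 1 := fun k => by simp
    have b1 : ∀ l k, (Pi.single l 1 : Nd d) k ≤ 1 := fun l k => by
      rw [Pi.single_apply]; split_ifs <;> omega
    have b2 : ∀ k, (Pi.single i 1 + Pi.single j 1 : Nd d) k ≤ 1 := fun k => by
      rw [Pi.add_apply, Pi.single_apply, Pi.single_apply]
      split_ifs with h1 h2
      · exact absurd (h1.symm.trans h2) hij
      all_goals omega
    by_cases hs : ∃ b : Nd d, (∀ k, b k ≤ 1) ∧ z + b ∈ S
    · obtain ⟨b, hb, hbS⟩ := hs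
      have hn : ∀ a : Nd d, (∀ k, a k ≤ 1) → ∃ s ∈ S, star (z + a) s := fun a ha =>
        ⟨z + b, hbS, star_add z a b ha hb⟩
      have n0 : ∃ s ∈ S, star z s := by have := hn 0 b0; rwa [add_zero] at this
      have ni := hn _ (b1 i)
      have nj := hn _ (b1 j)
      have nij := hn _ b2
      rw [← hij'] at nij
      rw [he1 _ _ (nadj_add _ _) n0 ni, he1 _ _ (nadj_add _ _) ni nij,
        he1 _ _ (nadj_add _ _) n0 nj, ← hcomm, he1 _ _ (nadj_add _ _) nj (by rwa [hcomm])]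
      have := hadd (α (z + Pi.single i 1))
      have := hadd (α (z + Pi.single j 1))
      linear_combination hadd (α (z + Pi.single i 1)) - hadd (α (z + Pi.single j 1))
    · push Not at hs
      have m0 : z ∉ S := by have := hs 0 b0; rwa [add_zero] at this
      have mi := hs _ (b1 i)
      have mj := hs _ (b1 j)
      have mij := hs _ b2
      rw [← hij'] at mij
      rw [he0 _ _ m0 mi, he0 _ _ mi mij, he0 _ _ m0 mj, he0 _ _ mj mij])
  have hgrad : ∀ u v, nadj u v → φ v = φ u + e u v := by
    rintro u v ⟨i, rfl | rfl⟩
    · exact hφ u i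
    · rw [hφ v i]
      simp only [e]
      linear_combination
        -hadd (α v * σ (v + Pi.single i 1) + α (v + Pi.single i 1) * σ v)
  have hWφ : ∀ w ∈ W, φ w = φ x ∧ w ∉ S := by
    intro w hw
    induction hw with
    | refl => exact ⟨rfl, hx⟩
    | tail _ h ih =>
      exact ⟨by rw [hgrad _ _ h.1, he0 _ _ h.2.1 h.2.2, add_zero, ih.1], h.2.2⟩
  have hWstep : ∀ u v, u ∈ W → nadj u v → v ∉ W → v ∈ S := by
    intro u v hu huv hv
    by_contra hvS
    exact hv (Relation.ReflTransGen.tail hu ⟨huv, (hWφ u hu).2, hvS⟩)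
  have hAW : ∀ w, Relation.ReflTransGen (onSet nadj U) x w → w ∈ W := by
    intro w hw
    exact Relation.ReflTransGen.mono (fun a b h => ⟨h.1, h.2.1.1, h.2.2.1⟩) _ _ hw
  have main : ∀ w, Relation.ReflTransGen (onSet nadj P) x w →
      (w ∈ W → Relation.ReflTransGen (onSet nadj U) x w) ∧ (w ∉ W → φ w = φ x + 1) := by
    intro w hw
    induction hw with
    | refl => exact ⟨fun _ => .refl, fun h => absurd (Relation.ReflTransGen.refl) h⟩
    | @tail u v _ huv ih =>
      obtain ⟨hadj, huP, hvP⟩ := huv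
      by_cases hu : u ∈ W <;> by_cases hv : v ∈ W
      · refine ⟨fun _ => (ih.1 hu).tail ⟨hadj, ⟨(hWφ u hu).2, Or.inl huP⟩,
          ⟨(hWφ v hv).2, Or.inl hvP⟩⟩, fun h => absurd hv h⟩
      · refine ⟨fun h => absurd h hv, fun _ => ?_⟩
        have hvS := hWstep u v hu hadj hv
        have huA : u ∈ A := ⟨ih.1 hu, v, hvS, hadj.star⟩
        have hvA : v ∉ A := fun h => hAS v h hvS
        rw [hgrad u v hadj, (hWφ u hu).1]
        simp [e, hα1 _ huA, hσ1 _ hvS, hα0 _ hvA]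
      · refine ⟨fun _ => ?_, fun h => absurd hv h⟩
        have huS := hWstep v u hv hadj.symm hu
        have h1 := hgrad u v hadj
        have huA : u ∉ A := fun h => hAS u h huS
        rw [(hWφ v hv).1, ih.2 hu] at h1
        simp only [e, hα0 _ huA, hσ1 _ huS, zero_mul, zero_add, mul_one] at h1
        by_contra hcon
        have hvA : v ∉ A := fun h => hcon h.1
        rw [hα0 _ hvA, add_zero] at h1
        exact one_ne_zero (left_eq_add.1 h1)
      · refine ⟨fun h => absurd h hv, fun _ => ?_⟩
        have huA : u ∉ A := fun h => hu (hAW u h.1)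
        have hvA : v ∉ A := fun h => hv (hAW v h.1)
        rw [hgrad u v hadj, ih.2 hu]
        simp [e, hα0 _ huA, hα0 _ hvA]
  exact (main y hP).1 hW

/-! ### Chemical distances off a sparse set -/

theorem reach_of_reflTransGen_of_finite {α : Type*} {r : α → α → Prop} {U : Finset α} {x y : α}
    (hx : x ∈ U) (h : Relation.ReflTransGen (onSet r (U : Set α)) x y) :
    reach (onSet r (U : Set α)) U.card x y := by
  classical
  set ρ := onSet r (U : Set α) with hρ
  let B : ℕ → Finset α := fun n => U.filter fun w => reach ρ n x w
  have hB : ∀ n w, reach ρ n x w → w ∈ B n := by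
    intro n w hw
    refine Finset.mem_filter.2 ⟨?_, hw⟩
    rcases Relation.ReflTransGen.cases_tail hw.reflTransGen with h | ⟨z, _, hz⟩
    · exact h ▸ hx
    · exact hz.2.2
  have key : ∀ n, (∀ w, reach ρ (n + 1) x w → reach ρ n x w) ∨ n < (B n).card := by
    intro n
    induction n with
    | zero => exact Or.inr (Finset.card_pos.2 ⟨x, hB 0 x rfl⟩)
    | succ n ih =>
      by_cases hst : ∀ w, reach ρ (n + 1) x w → reach ρ n x w
      · left
        rintro w (hw | ⟨z, hz, hzw⟩)
        · exact hw
        · exact Or.inr ⟨z, hst z hz, hzw⟩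
      · right
        have h1 := ih.resolve_left hst
        push Not at hst
        obtain ⟨w, hw, hw'⟩ := hst
        have h2 : B n ⊂ B (n + 1) := by
          refine Finset.ssubset_iff_subset_ne.2 ⟨fun v hv => ?_, fun h => ?_⟩
          · exact hB _ _ (Or.inl (Finset.mem_filter.1 hv).2)
          · exact hw' (Finset.mem_filter.1 (h ▸ hB _ _ hw)).2
        have := Finset.card_lt_card h2
        omega
  have hst : ∀ w, reach ρ (U.card + 1) x w → reach ρ U.card x w := by
    refine (key U.card).resolve_right fun h => ?_
    have := Finset.card_filter_le U fun w => reach ρ U.card x w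
    simp only [B] at h
    omega
  induction h with
  | refl => exact reach_refl _ _
  | tail _ hr ih => exact hst _ (ih.snoc hr)

/-- Finite `star`-connected sets containing the origin. -/
inductive Animal {d : ℕ} : Finset (Nd d) → Prop
  | base : Animal {0}
  | step {T T' : Finset (Nd d)} {v s : Nd d} : Animal T → v ∈ T → star v s →
      (∀ w, w ∈ T' ↔ w = s ∨ w ∈ T) → Animal T'

theorem Animal.insert {d : ℕ} {T : Finset (Nd d)} {v s : Nd d} [DecidableEq (Nd d)]
    (h : Animal T) (hv : v ∈ T) (hs : star v s) : Animal (insert s T) :=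
  h.step hv hs fun _ => Finset.mem_insert

theorem Animal.zero_mem {d : ℕ} {T : Finset (Nd d)} (h : Animal T) : (0 : Nd d) ∈ T := by
  induction h with
  | base => exact Finset.mem_singleton_self 0
  | step _ _ _ h ih => exact (h _).2 (Or.inr ih)

theorem onSet.mono {α : Type*} {r : α → α → Prop} {U V : Set α} (h : U ⊆ V) {x y : α}
    (hr : onSet r U x y) : onSet r V x y := ⟨hr.1, h hr.2.1, h hr.2.2⟩

theorem reflTransGen_onSet_mono {α : Type*} {r : α → α → Prop} {U V : Set α} (h : U ⊆ V)
    {x y : α} (hr : Relation.ReflTransGen (onSet r U) x y) :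
    Relation.ReflTransGen (onSet r V) x y :=
  Relation.ReflTransGen.mono (fun _ _ h' => h'.mono h) _ _ hr

theorem reflTransGen_onSet_symm {d : ℕ} {U : Set (Nd d)} {x y : Nd d}
    (h : Relation.ReflTransGen (onSet nadj U) x y) :
    Relation.ReflTransGen (onSet nadj U) y x := by
  induction h with
  | refl => exact .refl
  | tail _ h ih => exact .head ⟨h.1.symm, h.2.2, h.2.1⟩ ih

theorem reflTransGen_onSet_mem {α : Type*} {r : α → α → Prop} {U : Set α} {x y : α}
    (hx : x ∈ U) (h : Relation.ReflTransGen (onSet r U) x y) : y ∈ U := by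
  rcases Relation.ReflTransGen.cases_tail h with h | ⟨z, _, hz⟩
  · exact h ▸ hx
  · exact hz.2.2

/-- An animal can be extended by a straight segment. -/
theorem Animal.exists_line {d : ℕ} {T : Finset (Nd d)} (hT : Animal T) (i : Fin d) {v : Nd d}
    (hv : v ∈ T) (R : ℕ) : ∃ T' : Finset (Nd d), T ⊆ T' ∧ Animal T' ∧ T'.card ≤ T.card + R ∧
      ∀ t < R, Relation.ReflTransGen (onSet nadj (T' : Set (Nd d))) v (v + Pi.single i t) := by
  classical
  induction R with
  | zero => exact ⟨T, Finset.Subset.refl _, hT, by omega, fun t ht => absurd ht (by omega)⟩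
  | succ R ih =>
    obtain ⟨T₁, hsub, hA, hc, hl⟩ := ih
    rcases R.eq_zero_or_pos with rfl | hR
    · refine ⟨T₁, hsub, hA, by omega, fun t ht => ?_⟩
      have : t = 0 := by omega
      subst this
      simp only [Pi.single_zero, add_zero]
      exact .refl
    obtain ⟨S, rfl⟩ : ∃ S, R = S + 1 := ⟨R - 1, by omega⟩
    have hmem : v + Pi.single i S ∈ T₁ := reflTransGen_onSet_mem (hsub hv) (hl S (by omega))
    have hadj : nadj (v + Pi.single i S) (v + Pi.single i (S + 1)) :=
      ⟨i, Or.inl (by rw [add_assoc, ← Pi.single_add])⟩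
    have hss : (T₁ : Set (Nd d)) ⊆ (Insert.insert (v + Pi.single i (S + 1)) T₁ : Finset (Nd d)) :=
      Finset.coe_subset.2 (Finset.subset_insert _ _)
    refine ⟨Insert.insert (v + Pi.single i (S + 1)) T₁,
      hsub.trans (Finset.subset_insert _ _), hA.insert hmem hadj.star, ?_, fun t ht => ?_⟩
    · have := Finset.card_insert_le (v + Pi.single i (S + 1)) T₁
      omega
    · rcases Nat.lt_succ_iff_lt_or_eq.1 ht with ht | rfl
      · exact reflTransGen_onSet_mono hss (hl t ht)
      · exact (reflTransGen_onSet_mono hss (hl S (by omega))).tail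
          ⟨hadj, hss hmem, Finset.mem_coe.2 (Finset.mem_insert_self _ _)⟩

/-- An animal can be extended by a path from the origin to any given point. -/
theorem Animal.exists_path {d : ℕ} {T : Finset (Nd d)} (hT : Animal T) (y : Nd d) :
    ∃ T' : Finset (Nd d), T ⊆ T' ∧ Animal T' ∧ T'.card ≤ T.card + ∑ i, y i ∧
      Relation.ReflTransGen (onSet nadj (T' : Set (Nd d))) 0 y := by
  classical
  induction hn : ∑ i, y i generalizing y with
  | zero =>
    have : y = 0 := by
      funext j
      simpa using (Finset.sum_eq_zero_iff.1 hn) j (Finset.mem_univ j)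
    subst this
    exact ⟨T, Finset.Subset.refl _, hT, by omega, .refl⟩
  | succ n ih =>
    obtain ⟨i, hi⟩ : ∃ i, y i ≠ 0 := by
      by_contra! h
      simp [h] at hn
    have hy : y = (y - Pi.single i 1) + Pi.single i 1 := by
      funext j
      by_cases hj : j = i
      · subst hj; simp; omega
      · simp [hj]
    set z := y - Pi.single i 1
    have hs : ∑ j, z j = n := by
      rw [hy] at hn
      simp [Finset.sum_add_distrib] at hn
      simpa using hn
    obtain ⟨T₁, hsub, hA, hc, hl⟩ := ih z hs
    have hmem : z ∈ T₁ := reflTransGen_onSet_mem hA.zero_mem hl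
    have hadj : nadj z y := ⟨i, Or.inl hy⟩
    have hss : (T₁ : Set (Nd d)) ⊆ (Insert.insert y T₁ : Finset (Nd d)) :=
      Finset.coe_subset.2 (Finset.subset_insert _ _)
    refine ⟨Insert.insert y T₁, hsub.trans (Finset.subset_insert _ _), hA.insert hmem hadj.star,
      ?_, (reflTransGen_onSet_mono hss hl).tail
        ⟨hadj, hss hmem, Finset.mem_coe.2 (Finset.mem_insert_self _ _)⟩⟩
    have := Finset.card_insert_le y T₁
    omega

/-- Two points of a hyperplane are joined inside that hyperplane. -/
theorem reflTransGen_hyperplane {d : ℕ} {U : Set (Nd d)} {i : Fin d} {t : ℕ}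
    (hU : ∀ w : Nd d, w i = t → w ∈ U) {x y : Nd d} (hx : x i = t) (hy : y i = t) :
    Relation.ReflTransGen (onSet nadj U) x y := by
  have key : ∀ n, ∀ w : Nd d, w i = t → ∑ j, w j = n →
      Relation.ReflTransGen (onSet nadj U) (Pi.single i t) w := by
    intro n
    induction n with
    | zero =>
      intro w hw hn
      have h0 : w = 0 := by
        funext j
        simpa using (Finset.sum_eq_zero_iff.1 hn) j (Finset.mem_univ j)
      subst h0
      have : t = 0 := hw.symm
      subst this
      rw [Pi.single_zero]
    | succ n ih =>
      intro w hw hn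
      by_cases h : ∃ j, j ≠ i ∧ w j ≠ 0
      · obtain ⟨j, hji, hj⟩ := h
        have hz : w = (w - Pi.single j 1) + Pi.single j 1 := by
          funext l
          by_cases hl : l = j
          · subst hl; simp; omega
          · simp [hl]
        have hzi : (w - Pi.single j 1 : Nd d) i = t := by simp [hji.symm, hw]
        have hs : ∑ l, (w - Pi.single j 1 : Nd d) l = n := by
          rw [hz] at hn
          simp only [Pi.add_apply, Finset.sum_add_distrib, Finset.sum_pi_single',
            Finset.mem_univ, if_true] at hn
          omega
        exact (ih _ hzi hs).tail ⟨⟨j, Or.inl hz⟩, hU _ hzi, hU _ hw⟩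
      · push Not at h
        have : w = Pi.single i t := by
          funext l
          by_cases hl : l = i
          · subst hl; simp [hw]
          · simp [hl, h l hl]
        rw [this]
  exact (reflTransGen_onSet_symm (key _ x hx rfl)).trans (key _ y hy rfl)

/-- The forbidden set `F` is sparse at scale `k`. -/
def Sparse {d : ℕ} (F : Set (Nd d)) (k : ℕ) : Prop :=
  ∀ T : Finset (Nd d), Animal T → T.card ≤ ((d + 3) * 8 + 1) * 2 ^ k →
    ((T : Set (Nd d)) ∩ F).ncard < 2 ^ k

/-- The union of the `star`-components of `F` meeting a small animal is small. -/
theorem Sparse.exists_cover {d k : ℕ} {F : Set (Nd d)} (hF : Sparse F k) {P : Finset (Nd d)}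
    (hP : Animal P) (hc : P.card ≤ (d + 3) * (8 * 2 ^ k)) :
    ∃ S : Finset (Nd d), S.card < 2 ^ k ∧ (∀ w ∈ P, w ∈ F → w ∈ S) ∧
      ∀ s ∈ S, ∀ w ∈ F, star s w → w ∈ S := by
  classical
  let S : Set (Nd d) := {s | ∃ f ∈ P, f ∈ F ∧ Relation.ReflTransGen (onSet star F) f s}
  have hSF : S ⊆ F := by
    rintro s ⟨f, _, hf, h⟩
    exact reflTransGen_onSet_mem hf h
  have hPS : ∀ w ∈ P, w ∈ F → w ∈ S := fun w hw hwF => ⟨w, hw, hwF, .refl⟩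
  have hSS : ∀ s ∈ S, ∀ w ∈ F, star s w → w ∈ S := by
    rintro s ⟨f, hf, hfF, h⟩ w hw hsw
    exact ⟨f, hf, hfF, h.tail ⟨hsw, reflTransGen_onSet_mem hfF h, hw⟩⟩
  have key : ∀ n : ℕ, ∃ T : Finset (Nd d), P ⊆ T ∧ Animal T ∧ T.card ≤ P.card + n ∧
      (S ⊆ (T : Set (Nd d)) ∨ n ≤ ((T : Set (Nd d)) ∩ F).ncard) := by
    intro n
    induction n with
    | zero => exact ⟨P, Finset.Subset.refl _, hP, le_rfl, Or.inr (Nat.zero_le _)⟩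
    | succ n ih =>
      obtain ⟨T, hPT, hT, hTc, h⟩ := ih
      by_cases hS : S ⊆ (T : Set (Nd d))
      · exact ⟨T, hPT, hT, by omega, Or.inl hS⟩
      have hn := h.resolve_left hS
      obtain ⟨s, hsS, hsT⟩ := Set.not_subset.1 hS
      obtain ⟨f, hf, hfF, hfs⟩ := hsS
      obtain ⟨v, w, hv, hw, hvw, hwF⟩ : ∃ v w, v ∈ T ∧ w ∉ T ∧ star v w ∧ w ∈ F := by
        clear hn hTc h
        induction hfs with
        | refl => exact absurd (hPT hf) hsT
        | @tail b c hb hbc ih' =>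
          by_cases hbT : b ∈ T
          · exact ⟨b, c, hbT, hsT, hbc.1, hbc.2.2⟩
          · exact ih' hbT
      refine ⟨Insert.insert w T, hPT.trans (Finset.subset_insert _ _), hT.insert hv hvw, ?_,
        Or.inr ?_⟩
      · have := Finset.card_insert_le w T
        omega
      · have h1 : ((Insert.insert w T : Finset (Nd d)) : Set (Nd d)) ∩ F =
            Insert.insert w ((T : Set (Nd d)) ∩ F) := by
          rw [Finset.coe_insert, Set.insert_inter_of_mem hwF]
        rw [h1, Set.ncard_insert_of_notMem (fun h => hw h.1)
          ((Finset.finite_toSet T).inter_of_left _)]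
        omega
  obtain ⟨T, hPT, hT, hTc, h⟩ := key (2 ^ k)
  have hlt := hF T hT (by linarith)
  have hST := h.resolve_right (by omega)
  have hfin : S.Finite := (Finset.finite_toSet T).subset hST
  refine ⟨hfin.toFinset, ?_, fun w h1 h2 => hfin.mem_toFinset.2 (hPS w h1 h2),
    fun s hs w hw hsw => hfin.mem_toFinset.2 (hSS s (hfin.mem_toFinset.1 hs) w hw hsw)⟩
  rw [← Set.ncard_eq_toFinset_card S hfin]
  exact (Set.ncard_le_ncard (Set.subset_inter hST hSF)
    ((Finset.finite_toSet T).inter_of_left _)).trans_lt hlt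

/-- The number of sites within `star` distance one is at most `3 ^ d`. -/
theorem exists_star_nbrs {d : ℕ} (s : Nd d) :
    ∃ B : Finset (Nd d), B.card ≤ 3 ^ d ∧ ∀ w, star w s → w ∈ B := by
  classical
  refine ⟨Fintype.piFinset fun i => Finset.Icc (s i - 1) (s i + 1), ?_, fun w hw => ?_⟩
  · rw [Fintype.card_piFinset]
    calc ∏ i, (Finset.Icc (s i - 1) (s i + 1)).card ≤ ∏ _i : Fin d, 3 :=
          Finset.prod_le_prod' fun i _ => by rw [Nat.card_Icc]; omega
      _ = 3 ^ d := by simp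
  · rw [Fintype.mem_piFinset]
    intro i
    rw [Finset.mem_Icc]
    have := hw i
    omega

/-- Off a sparse set, most points of a line are joined to most points of the axis. -/
theorem Sparse.line {d k : ℕ} {F : Set (Nd d)} (hF : Sparse F k) {i j : Fin d} (hij : i ≠ j)
    (y : Nd d) (hy : ∀ l, y l < 8 * 2 ^ k) :
    ∃ N : Finset ℕ, N.card < 2 ^ k ∧ ∀ t < 8 * 2 ^ k, ∀ t' < 8 * 2 ^ k, t ∉ N → t' ∉ N →
      reach (onSet nadj Fᶜ) ((d + 3) * (8 * 2 ^ k) + 3 ^ d * 2 ^ k)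
        (Pi.single i t) (Function.update y i t') := by
  classical
  set R := 8 * 2 ^ k with hR
  have hRpos : 0 < R := by positivity
  set y₀ : Nd d := Function.update y i 0 with hy₀
  obtain ⟨P₁, hs₁, hA₁, hc₁, hl₁⟩ := Animal.base.exists_line i (Finset.mem_singleton_self 0) R
  obtain ⟨P₂, hs₂, hA₂, hc₂, hl₂⟩ := hA₁.exists_path y₀
  obtain ⟨P, hs₃, hA, hc₃, hl₃⟩ :=
    hA₂.exists_line i (reflTransGen_onSet_mem hA₂.zero_mem hl₂) R
  have hsum : ∑ l, y₀ l ≤ d * R := by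
    calc ∑ l, y₀ l ≤ ∑ _l : Fin d, R := Finset.sum_le_sum fun l _ => by
          by_cases hl : l = i
          · subst hl; simp [hy₀]
          · simpa [hy₀, hl] using (hy l).le
      _ = d * R := by simp
  have hcP : P.card ≤ (d + 3) * R := by
    rw [Finset.card_singleton] at hc₁
    nlinarith
  have haxis : ∀ t < R, Relation.ReflTransGen (onSet nadj (P : Set (Nd d))) 0 (Pi.single i t) := by
    intro t ht
    have := hl₁ t ht
    rw [zero_add] at this
    exact reflTransGen_onSet_mono (Finset.coe_subset.2 (hs₂.trans hs₃)) this
  have hline : ∀ t < R,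
      Relation.ReflTransGen (onSet nadj (P : Set (Nd d))) 0 (Function.update y i t) := by
    intro t ht
    have h := (reflTransGen_onSet_mono (Finset.coe_subset.2 hs₃) hl₂).trans (hl₃ t ht)
    have : y₀ + Pi.single i t = Function.update y i t := by
      funext l
      by_cases hl : l = i
      · subst hl; simp [hy₀]
      · simp [hy₀, hl]
    rwa [this] at h
  obtain ⟨S, hSc, hPS, hSS⟩ := hF.exists_cover hA (by simpa [hR] using hcP)
  refine ⟨S.image fun s => s i, (Finset.card_image_le).trans_lt hSc, ?_⟩
  intro t ht t' ht' htN htN'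
  obtain ⟨c, hc⟩ := Infinite.exists_notMem_finset (S.image fun s => s j)
  have hyp : ∀ (l : Fin d) (a : ℕ), a ∉ S.image (fun s => s l) → ∀ w : Nd d, w l = a →
      w ∈ ((S : Set (Nd d))ᶜ) := fun l a ha w hw hwS =>
    ha (Finset.mem_image.2 ⟨w, hwS, hw⟩)
  have hW : Relation.ReflTransGen (onSet nadj ((S : Set (Nd d))ᶜ)) (Pi.single i t)
      (Function.update y i t') := by
    refine (reflTransGen_hyperplane (hyp i t htN) (x := Pi.single i t)
      (y := Function.update (Pi.single i t) j c) (by simp) (by simp [hij])).trans ?_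
    refine (reflTransGen_hyperplane (hyp j c hc) (y := Function.update (Function.update y i t') j c)
      (by simp) (by simp)).trans ?_
    exact reflTransGen_hyperplane (hyp i t' htN') (by simp [hij]) (by simp)
  have hre := reroute (hyp i t htN _ (by simp))
    (Finset.mem_coe.2 (reflTransGen_onSet_mem hA.zero_mem (haxis t ht))) hW
    ((reflTransGen_onSet_symm (haxis t ht)).trans (hline t' ht'))
  choose B hBc hB using fun s : Nd d => exists_star_nbrs s
  let U : Finset (Nd d) := (P ∪ S.biUnion B).filter fun w =>
    w ∉ S ∧ (w ∈ P ∨ ∃ s ∈ S, star w s)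
  have hUc : U.card ≤ (d + 3) * R + 3 ^ d * 2 ^ k := by
    refine (Finset.card_filter_le _ _).trans ((Finset.card_union_le _ _).trans ?_)
    refine Nat.add_le_add hcP ?_
    refine (Finset.card_biUnion_le_card_mul _ _ _ fun s _ => hBc s).trans ?_
    rw [mul_comm]
    exact Nat.mul_le_mul_left _ hSc.le
  have hUeq : {w | w ∉ (S : Set (Nd d)) ∧ (w ∈ (P : Set (Nd d)) ∨ ∃ s ∈ (S : Set (Nd d)),
      star w s)} = (U : Set (Nd d)) := by
    ext w
    simp only [U, Set.mem_ofPred_eq, Finset.coe_filter, Finset.mem_coe, Finset.mem_union,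
      Finset.mem_biUnion]
    refine ⟨fun h => ⟨?_, h⟩, fun h => h.2⟩
    rcases h.2 with h | ⟨s, hs, hw⟩
    · exact Or.inl h
    · exact Or.inr ⟨s, hs, hB s w hw⟩
  have hUF : (U : Set (Nd d)) ⊆ Fᶜ := by
    rw [← hUeq]
    rintro w ⟨hwS, hw | ⟨s, hs, hws⟩⟩ hwF
    · exact hwS (hPS w hw hwF)
    · exact hwS (hSS s hs w hwF hws.symm)
  rw [hUeq] at hre
  have hmem : Pi.single i t ∈ U := by
    have : Pi.single i t ∈ {w | w ∉ (S : Set (Nd d)) ∧ (w ∈ (P : Set (Nd d)) ∨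
      ∃ s ∈ (S : Set (Nd d)), star w s)} := ⟨hyp i t htN _ (by simp), Or.inl
        (Finset.mem_coe.2 (reflTransGen_onSet_mem hA.zero_mem (haxis t ht)))⟩
    rw [hUeq] at this
    exact this
  exact ((reach_of_reflTransGen_of_finite hmem hre).mono fun _ _ h => h.mono hUF).mono_len hUc

/-- Off a set sparse at all scales, distances are linear on most of each dyadic box. -/
theorem sparse_growth {d : ℕ} (hd : 2 ≤ d) {F : Set (Nd d)} (hF : ∀ k, Sparse F k) (k : ℕ) :
    (8 * 2 ^ k) ^ d ≤ 2 * {x : Nd d | (∀ i, x i < 8 * 2 ^ k) ∧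
      reach (onSet nadj Fᶜ) (3 * ((d + 3) * 8 + 3 ^ d) * 2 ^ k) 0 x}.ncard := by
  classical
  set M := (d + 3) * 8 + 3 ^ d with hM
  set i : Fin d := ⟨0, by omega⟩
  set j : Fin d := ⟨1, by omega⟩
  have hij : i ≠ j := by simp [i, j]
  have hline : ∀ k (y : Nd d), (∀ l, y l < 8 * 2 ^ k) → ∃ N : Finset ℕ, N.card < 2 ^ k ∧
      ∀ t < 8 * 2 ^ k, ∀ t' < 8 * 2 ^ k, t ∉ N → t' ∉ N →
      reach (onSet nadj Fᶜ) (M * 2 ^ k) (Pi.single i t) (Function.update y i t') := by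
    intro k y hy
    have h := (hF k).line hij y hy
    have e : (d + 3) * (8 * 2 ^ k) + 3 ^ d * 2 ^ k = M * 2 ^ k := by rw [hM]; ring
    rwa [e] at h
  have haxis : ∀ k, ∃ N : Finset ℕ, N.card < 2 ^ k ∧ ∀ t < 8 * 2 ^ k, t ∉ N →
      reach (onSet nadj Fᶜ) (2 * M * 2 ^ k) 0 (Pi.single i t) := by
    intro k
    induction k with
    | zero =>
      obtain ⟨N, hN, h⟩ := hline 0 0 (by simp)
      refine ⟨N, hN, fun t ht htN => ?_⟩
      have hN0 : N = ∅ := by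
        rw [pow_zero] at hN
        exact Finset.card_eq_zero.1 (by omega)
      have := h 0 (by simp) t ht (by simp [hN0]) htN
      rw [Pi.single_zero] at this
      exact this.mono_len (by omega)
    | succ k ih =>
      obtain ⟨N₁, hN₁, h₁⟩ := ih
      obtain ⟨N, hN, h⟩ := hline (k + 1) 0 (by intro l; simp)
      refine ⟨N, hN, fun t' ht' htN' => ?_⟩
      obtain ⟨t, ht, htN⟩ : ∃ t ∈ Finset.range (8 * 2 ^ k), t ∉ N₁ ∪ N := by
        by_contra! hcon
        have h1 := Finset.card_le_card hcon
        have h2 := Finset.card_union_le N₁ N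
        rw [Finset.card_range] at h1
        rw [pow_succ] at hN
        have : 0 < 2 ^ k := by positivity
        omega
      rw [Finset.mem_range] at ht
      rw [Finset.notMem_union] at htN
      have e : 2 * M * 2 ^ (k + 1) = 2 * M * 2 ^ k + M * 2 ^ (k + 1) := by ring
      rw [e]
      exact (h₁ t ht htN.1).trans (h t (by rw [pow_succ]; omega) t' ht' htN.2 htN')
  set R := 8 * 2 ^ k with hR
  let Q : Finset (Nd d) := Fintype.piFinset fun _ => Finset.range R
  have hQ : Q.card = R ^ d := by simp [Q, Fintype.card_piFinset]
  let G := Q.filter fun x => reach (onSet nadj Fᶜ) (3 * M * 2 ^ k) 0 x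
  let B := Q.filter fun x => ¬ reach (onSet nadj Fᶜ) (3 * M * 2 ^ k) 0 x
  have hGB : G.card + B.card = R ^ d := by
    rw [← hQ]
    exact Finset.card_filter_add_card_filter_not _
  have hGn : {x : Nd d | (∀ i, x i < R) ∧ reach (onSet nadj Fᶜ) (3 * M * 2 ^ k) 0 x}.ncard =
      G.card := by
    rw [← Set.ncard_coe_finset]
    congr 1
    ext x
    simp [G, Q, Fintype.mem_piFinset]
  let L : Finset (Nd d) := Fintype.piFinset fun l => if l = i then {0} else Finset.range R
  have hLc : L.card = R ^ (d - 1) := by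
    rw [Fintype.card_piFinset, ← Finset.mul_prod_erase _ _ (Finset.mem_univ i)]
    rw [if_pos rfl, Finset.card_singleton, one_mul]
    rw [Finset.prod_congr rfl fun l hl => by rw [if_neg (Finset.ne_of_mem_erase hl),
      Finset.card_range]]
    simp
  have hBc : B.card ≤ 2 ^ k * L.card := by
    refine Finset.card_le_mul_card_image_of_maps_to (f := fun x => Function.update x i 0)
      (fun x hx => ?_) _ fun y hy => ?_
    · have hx' := Fintype.mem_piFinset.1 (Finset.mem_filter.1 hx).1
      refine Fintype.mem_piFinset.2 fun l => ?_
      by_cases hl : l = i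
      · subst hl; simp
      · simpa [hl] using hx' l
    · have hyR : ∀ l, y l < R := by
        intro l
        have := Fintype.mem_piFinset.1 hy l
        by_cases hl : l = i
        · subst hl
          simp at this
          rw [this]
          positivity
        · simpa [hl] using this
      obtain ⟨N, hN, h⟩ := hline k y hyR
      obtain ⟨N₁, hN₁, h₁⟩ := haxis k
      obtain ⟨t, ht, htN⟩ : ∃ t ∈ Finset.range R, t ∉ N₁ ∪ N := by
        by_contra! hcon
        have h1 := Finset.card_le_card hcon
        have h2 := Finset.card_union_le N₁ N
        rw [Finset.card_range] at h1
        omega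
      rw [Finset.mem_range] at ht
      rw [Finset.notMem_union] at htN
      refine le_trans ?_ hN.le
      refine Finset.card_le_card_of_injOn (fun x => x i) ?_ ?_
      · intro x hx
        obtain ⟨hxB, hxy⟩ := Finset.mem_filter.1 (Finset.mem_coe.1 hx)
        obtain ⟨hxQ, hxr⟩ := Finset.mem_filter.1 hxB
        by_contra hxN
        apply hxr
        have hxi := Finset.mem_range.1 (Fintype.mem_piFinset.1 hxQ i)
        have := (h₁ t ht htN.1).trans (h t ht (x i) hxi htN.2 hxN)
        have e : Function.update y i (x i) = x := by
          rw [← hxy]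
          simp
        rw [e] at this
        exact this.mono_len (by linarith)
      · intro x hx x' hx' hxx
        have h1 := (Finset.mem_filter.1 (Finset.mem_coe.1 hx)).2
        have h2 := (Finset.mem_filter.1 (Finset.mem_coe.1 hx')).2
        funext l
        by_cases hl : l = i
        · subst hl; exact hxx
        · have := congrFun (h1.trans h2.symm) l
          simpa [hl] using this
  rw [hGn]
  have hRd : R ^ d = 8 * (2 ^ k * L.card) := by
    rw [hLc]
    obtain ⟨e, rfl⟩ : ∃ e, d = e + 1 := ⟨d - 1, by omega⟩
    rw [Nat.add_sub_cancel, pow_succ, hR]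
    ring
  omega

/-! ### Random sets with geometric tails are sparse -/

open Classical in
/-- Lists of length at most `n` that continue a `star`-walk from `v`. -/
noncomputable def walks {d : ℕ} : ℕ → Nd d → Finset (List (Nd d))
  | 0, _ => {[]}
  | n + 1, v => {[]} ∪ (exists_star_nbrs v).choose.biUnion fun s => (walks n s).image (s :: ·)

theorem card_walks_le {d : ℕ} (n : ℕ) (v : Nd d) : (walks n v).card ≤ (1 + 3 ^ d) ^ n := by
  classical
  induction n generalizing v with
  | zero => simp [walks]
  | succ n ih =>
    rw [walks]
    refine (Finset.card_union_le _ _).trans ?_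
    have h1 : ((exists_star_nbrs v).choose.biUnion fun s => (walks n s).image (s :: ·)).card ≤
        3 ^ d * (1 + 3 ^ d) ^ n :=
      (Finset.card_biUnion_le_card_mul _ _ _ fun s _ => Finset.card_image_le.trans (ih s)).trans
        (Nat.mul_le_mul_right _ (exists_star_nbrs v).choose_spec.1)
    have h2 : 1 ≤ (1 + 3 ^ d) ^ n := Nat.one_le_pow _ _ (by positivity)
    rw [Finset.card_singleton, pow_succ]
    linarith

theorem mem_walks {d : ℕ} {n : ℕ} {v : Nd d} {l : List (Nd d)} (hl : l.length ≤ n)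
    (hc : List.IsChain star (v :: l)) : l ∈ walks n v := by
  classical
  induction n generalizing v l with
  | zero => simpa [walks] using hl
  | succ n ih =>
    rw [walks, Finset.mem_union, Finset.mem_biUnion]
    rcases l with _ | ⟨s, l⟩
    · simp
    · right
      rw [List.isChain_cons_cons] at hc
      exact ⟨s, (exists_star_nbrs v).choose_spec.2 s hc.1.symm,
        Finset.mem_image_of_mem _ (ih (by simpa using hl) hc.2)⟩

theorem Animal.exists_walk {d : ℕ} {T : Finset (Nd d)} (hT : Animal T) :
    ∃ l : List (Nd d), l.length ≤ 2 * T.card ∧ List.IsChain star (0 :: l) ∧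
      ∀ w, w ∈ T ↔ w ∈ (0 : Nd d) :: l := by
  classical
  induction hT with
  | base => exact ⟨[], by simp, by simp, by simp⟩
  | @step T T' v s hT hv hs hT' ih =>
    obtain ⟨l, hl, hc, hm⟩ := ih
    by_cases hsT : s ∈ T
    · have : T' = T := by
        ext w
        rw [hT']
        exact ⟨fun h => h.elim (fun h => h ▸ hsT) id, Or.inr⟩
      exact this ▸ ⟨l, hl, hc, hm⟩
    · have hcard : T'.card = T.card + 1 := by
        rw [← Finset.card_insert_of_notMem hsT]
        congr 1
        ext w
        rw [hT', Finset.mem_insert]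
      obtain ⟨l₁, l₂, h⟩ := List.append_of_mem ((hm v).1 hv)
      have hc' : List.IsChain star (l₁ ++ v :: s :: v :: l₂) := by
        rw [h, List.isChain_split] at hc
        rw [List.isChain_split]
        exact ⟨hc.1, by simp [List.isChain_cons_cons, hs, hs.symm, hc.2]⟩
      have hlen : (l₁ ++ v :: s :: v :: l₂).length = l.length + 3 := by
        have := congrArg List.length h
        simp at this ⊢
        omega
      have hmem : ∀ w, w ∈ T' ↔ w ∈ l₁ ++ v :: s :: v :: l₂ := by
        intro w
        rw [hT', hm, h]
        simp
        tauto
      obtain ⟨l', hl'⟩ : ∃ l', l₁ ++ v :: s :: v :: l₂ = 0 :: l' := by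
        rcases l₁ with _ | ⟨a, l₁⟩
        · simp only [List.nil_append, List.cons.injEq] at h
          exact ⟨_, by rw [List.nil_append, ← h.1]⟩
        · simp only [List.cons_append, List.cons.injEq] at h
          exact ⟨_, by rw [List.cons_append, ← h.1]⟩
      rw [hl'] at hc' hlen hmem
      refine ⟨l', ?_, hc', hmem⟩
      simp at hlen
      omega

/-- If the probability that `F` contains a given set of `n` sites is at most `ε ^ n` with `ε`
small, then `F` is sparse at all scales with probability at least one half. -/
theorem exists_sparse_threshold (d : ℕ) : ∃ ε₀ : ℝ, 0 < ε₀ ∧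
    ∀ {Ω : Type*} [MeasurableSpace Ω] (μ : Measure Ω) (I : Set Ω) (F : Ω → Set (Nd d)),
      (∀ T : Finset (Nd d), μ (I ∩ {ω | (T : Set (Nd d)) ⊆ F ω}) ≤
        ENNReal.ofReal ε₀ ^ T.card * μ I) →
      μ (I ∩ {ω | ¬ ∀ k, Sparse (F ω) k}) ≤ 2⁻¹ * μ I := by
  classical
  set a := (d + 3) * 8 + 1 with ha
  set B : ℕ := (1 + 3 ^ d) ^ (2 * a) * 2 ^ (2 * a + 1) with hB
  have hB0 : (0 : ℝ) < B := by rw [hB]; positivity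
  refine ⟨1 / (4 * B), by positivity, ?_⟩
  intro Ω _ μ I F h
  set ε := ENNReal.ofReal (1 / (4 * (B : ℝ))) with hε
  have hBε : (B : ℝ≥0∞) * ε = ENNReal.ofReal (1 / 4) := by
    rw [hε, ← ENNReal.ofReal_natCast, ← ENNReal.ofReal_mul hB0.le]
    congr 1
    field_simp
  have hscale : ∀ k, μ (I ∩ {ω | ¬ Sparse (F ω) k}) ≤
      ENNReal.ofReal (1 / 4) * 2⁻¹ ^ k * μ I := by
    intro k
    set n := a * 2 ^ k with hn
    let Wl := walks (2 * n) (0 : Nd d)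
    let Ts : List (Nd d) → Finset (Finset (Nd d)) := fun l =>
      (((0 : Nd d) :: l).toFinset.powersetCard (2 ^ k))
    have hsub : I ∩ {ω | ¬ Sparse (F ω) k} ⊆
        ⋃ l ∈ Wl.filter (fun l => l.length ≤ 2 * n), ⋃ T ∈ Ts l,
          I ∩ {ω | (T : Set (Nd d)) ⊆ F ω} := by
      rintro ω ⟨hI, hω⟩
      simp only [Sparse, Set.mem_ofPred_eq] at hω
      push Not at hω
      obtain ⟨A, hA, hAc, hAF⟩ := hω
      obtain ⟨l, hl, hc, hm⟩ := hA.exists_walk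
      obtain ⟨T, hT, hTc⟩ := Finset.exists_subset_card_eq
        (s := A.filter (· ∈ F ω)) (n := 2 ^ k) (by
          rw [← Set.ncard_coe_finset, Finset.coe_filter]
          exact hAF)
      have hl' : l.length ≤ 2 * n := hl.trans (Nat.mul_le_mul_left _ hAc)
      simp only [Set.mem_iUnion]
      refine ⟨l, Finset.mem_filter.2 ⟨mem_walks hl' hc, hl'⟩, T, ?_, hI, ?_⟩
      · refine Finset.mem_powersetCard.2 ⟨fun w hw => ?_, hTc⟩
        rw [List.mem_toFinset]
        exact (hm w).1 (Finset.mem_filter.1 (hT hw)).1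
      · intro w hw
        exact (Finset.mem_filter.1 (hT hw)).2
    have hTs : ∀ l ∈ Wl.filter (fun l => l.length ≤ 2 * n), (Ts l).card ≤ 2 ^ (2 * n + 1) := by
      intro l hl
      have h1 := List.toFinset_card_le ((0 : Nd d) :: l)
      have h2 := (Finset.mem_filter.1 hl).2
      calc (Ts l).card ≤ (((0 : Nd d) :: l).toFinset.powerset).card :=
            Finset.card_le_card fun T hT =>
              Finset.mem_powerset.2 (Finset.mem_powersetCard.1 hT).1
        _ = 2 ^ ((0 : Nd d) :: l).toFinset.card := Finset.card_powerset _
        _ ≤ 2 ^ (2 * n + 1) := Nat.pow_le_pow_right (by norm_num)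
            (h1.trans (by simpa using h2))
    have hinner : ∀ l ∈ Wl.filter (fun l => l.length ≤ 2 * n),
        μ (⋃ T ∈ Ts l, I ∩ {ω | (T : Set (Nd d)) ⊆ F ω}) ≤
          (2 ^ (2 * n + 1) : ℕ) * (ε ^ (2 ^ k) * μ I) := by
      intro l hl
      refine (measure_biUnion_finset_le _ _).trans ?_
      refine (Finset.sum_le_card_nsmul _ _ (ε ^ (2 ^ k) * μ I) fun T hT => ?_).trans ?_
      · have := h T
        rwa [(Finset.mem_powersetCard.1 hT).2] at this
      · rw [nsmul_eq_mul]
        gcongr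
        exact hTs l hl
    calc μ (I ∩ {ω | ¬ Sparse (F ω) k})
        ≤ ∑ l ∈ Wl.filter (fun l => l.length ≤ 2 * n),
            μ (⋃ T ∈ Ts l, I ∩ {ω | (T : Set (Nd d)) ⊆ F ω}) :=
          (measure_mono hsub).trans (measure_biUnion_finset_le _ _)
      _ ≤ (((1 + 3 ^ d) ^ (2 * n) : ℕ) : ℝ≥0∞) *
            ((2 ^ (2 * n + 1) : ℕ) * (ε ^ (2 ^ k) * μ I)) := by
          refine (Finset.sum_le_card_nsmul _ _ _ hinner).trans ?_
          rw [nsmul_eq_mul]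
          gcongr
          exact (Finset.card_filter_le _ _).trans (card_walks_le _ _)
      _ ≤ ((B ^ 2 ^ k : ℕ) : ℝ≥0∞) * (ε ^ (2 ^ k) * μ I) := by
          rw [← mul_assoc, ← Nat.cast_mul]
          gcongr
          rw [hB, mul_pow, ← pow_mul, ← pow_mul]
          have e1 : 2 * a * 2 ^ k = 2 * n := by rw [hn]; ring
          rw [e1]
          refine Nat.mul_le_mul_left _ (Nat.pow_le_pow_right (by norm_num) ?_)
          rw [add_mul, e1, one_mul]
          have : 1 ≤ 2 ^ k := Nat.one_le_two_pow
          omega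
      _ = ENNReal.ofReal (1 / 4) ^ 2 ^ k * μ I := by
          rw [← mul_assoc, Nat.cast_pow, ← mul_pow, hBε]
      _ ≤ ENNReal.ofReal (1 / 4) * 2⁻¹ ^ k * μ I := by
          gcongr
          have e2 : (2⁻¹ : ℝ≥0∞) = ENNReal.ofReal (1 / 2) := by
            rw [one_div, ENNReal.ofReal_inv_of_pos (by norm_num)]
            norm_num
          rw [e2, ← ENNReal.ofReal_pow (by norm_num), ← ENNReal.ofReal_pow (by norm_num),
            ← ENNReal.ofReal_mul (by norm_num)]
          refine ENNReal.ofReal_le_ofReal ?_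
          calc (1 / 4 : ℝ) ^ 2 ^ k ≤ (1 / 4) ^ (k + 1) :=
                pow_le_pow_of_le_one (by norm_num) (by norm_num) (Nat.lt_two_pow_self)
            _ = 1 / 4 * (1 / 4) ^ k := by ring
            _ ≤ 1 / 4 * (1 / 2) ^ k := by gcongr; norm_num
  have hU : I ∩ {ω | ¬ ∀ k, Sparse (F ω) k} ⊆ ⋃ k, I ∩ {ω | ¬ Sparse (F ω) k} := by
    rintro ω ⟨hI, hω⟩
    obtain ⟨k, hk⟩ := not_forall.1 hω
    exact Set.mem_iUnion.2 ⟨k, hI, hk⟩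
  refine (measure_mono hU).trans ((measure_iUnion_le _).trans
    ((ENNReal.tsum_le_tsum hscale).trans ?_))
  rw [ENNReal.tsum_mul_right, ENNReal.tsum_mul_left, ENNReal.tsum_geometric]
  gcongr
  have e3 : (1 - 2⁻¹ : ℝ≥0∞)⁻¹ = ENNReal.ofReal 2 := by
    rw [ENNReal.one_sub_inv_two, inv_inv]
    norm_num
  rw [e3, ← ENNReal.ofReal_mul (by norm_num)]
  have e2 : (2⁻¹ : ℝ≥0∞) = ENNReal.ofReal (1 / 2) := by
    rw [one_div, ENNReal.ofReal_inv_of_pos (by norm_num)]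
    norm_num
  rw [e2]
  exact ENNReal.ofReal_le_ofReal (by norm_num)

/-! ### Exploration: fresh coordinates after a stopping rule -/

section Restart

variable {ι α : Type*} [Countable α] (q : ι → unitInterval) (X : (ι → Bool) → α)
  {B : Set (ι → Bool)} (S T : α → Set ι) (E : α → Set (ι → Bool))

theorem bern_eq_tsum (mB : ∀ a, MeasurableSet (B ∩ {ω | X ω = a})) :
    bern q B = ∑' a, bern q (B ∩ {ω | X ω = a}) := by
  rw [← measure_iUnion _ mB]
  · congr 1
    ext ω
    simp
  · intro a b hab
    refine Set.disjoint_left.2 fun ω h1 h2 => hab ?_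
    exact h1.2.symm.trans h2.2

theorem bern_eq_tsum_inter (mB : ∀ a, MeasurableSet (B ∩ {ω | X ω = a}))
    (mE : ∀ a, (B ∩ {ω | X ω = a}).Nonempty → MeasurableSet (E a)) :
    bern q (B ∩ {ω | ω ∈ E (X ω)}) = ∑' a, bern q (B ∩ {ω | X ω = a} ∩ E a) := by
  have h : ∀ a, B ∩ {ω | ω ∈ E (X ω)} ∩ {ω | X ω = a} = B ∩ {ω | X ω = a} ∩ E a := by
    intro a
    ext ω
    simp only [Set.mem_inter_iff, Set.mem_ofPred_eq]
    constructor
    · rintro ⟨⟨h1, h2⟩, rfl⟩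
      exact ⟨⟨h1, rfl⟩, h2⟩
    · rintro ⟨⟨h1, rfl⟩, h2⟩
      exact ⟨⟨h1, h2⟩, rfl⟩
  rw [bern_eq_tsum q X]
  · exact tsum_congr fun a => by rw [h]
  · intro a
    rw [h]
    rcases (B ∩ {ω | X ω = a}).eq_empty_or_nonempty with h0 | h0
    · rw [h0, Set.empty_inter]
      exact MeasurableSet.empty
    · exact (mB a).inter (mE a h0)

theorem bern_restart_ge (mB : ∀ a, MeasurableSet (B ∩ {ω | X ω = a}))
    (hB : ∀ a, DepOn (S a) (B ∩ {ω | X ω = a}))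
    (mE : ∀ a, (B ∩ {ω | X ω = a}).Nonempty → MeasurableSet (E a))
    (hE : ∀ a, (B ∩ {ω | X ω = a}).Nonempty → DepOn (T a) (E a))
    (hST : ∀ a, (B ∩ {ω | X ω = a}).Nonempty → Disjoint (S a) (T a)) {c : ℝ} (hc0 : 0 ≤ c)
    (hc : ∀ a, (B ∩ {ω | X ω = a}).Nonempty → c ≤ (bern q).real (E a)) :
    c * (bern q).real B ≤ (bern q).real (B ∩ {ω | ω ∈ E (X ω)}) := by
  have h : ENNReal.ofReal c * bern q B ≤ bern q (B ∩ {ω | ω ∈ E (X ω)}) := by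
    rw [bern_eq_tsum q X mB, bern_eq_tsum_inter q X E mB mE, ← ENNReal.tsum_mul_left]
    refine ENNReal.tsum_le_tsum fun a => ?_
    rcases (B ∩ {ω | X ω = a}).eq_empty_or_nonempty with h0 | h0
    · simp [h0]
    · have h1 := bern_inter q (hB a) (hE a h0) (hST a h0) (mB a) (mE a h0)
      rw [← ofReal_measureReal, ← ofReal_measureReal, h1, ← ENNReal.ofReal_mul hc0, mul_comm]
      exact ENNReal.ofReal_le_ofReal
        (mul_le_mul_of_nonneg_left (hc a h0) measureReal_nonneg)
  have h2 := ENNReal.toReal_mono (measure_ne_top _ _) h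
  rwa [ENNReal.toReal_mul, ENNReal.toReal_ofReal hc0] at h2

theorem bern_restart_le (mB : ∀ a, MeasurableSet (B ∩ {ω | X ω = a}))
    (hB : ∀ a, DepOn (S a) (B ∩ {ω | X ω = a}))
    (mE : ∀ a, (B ∩ {ω | X ω = a}).Nonempty → MeasurableSet (E a))
    (hE : ∀ a, (B ∩ {ω | X ω = a}).Nonempty → DepOn (T a) (E a))
    (hST : ∀ a, (B ∩ {ω | X ω = a}).Nonempty → Disjoint (S a) (T a)) {c : ℝ} (hc0 : 0 ≤ c)
    (hc : ∀ a, (B ∩ {ω | X ω = a}).Nonempty → (bern q).real (E a) ≤ c) :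
    (bern q).real (B ∩ {ω | ω ∈ E (X ω)}) ≤ c * (bern q).real B := by
  have h : bern q (B ∩ {ω | ω ∈ E (X ω)}) ≤ ENNReal.ofReal c * bern q B := by
    rw [bern_eq_tsum q X mB, bern_eq_tsum_inter q X E mB mE, ← ENNReal.tsum_mul_left]
    refine ENNReal.tsum_le_tsum fun a => ?_
    rcases (B ∩ {ω | X ω = a}).eq_empty_or_nonempty with h0 | h0
    · simp [h0]
    · have h1 := bern_inter q (hB a) (hE a h0) (hST a h0) (mB a) (mE a h0)
      rw [← ofReal_measureReal, ← ofReal_measureReal, h1, ← ENNReal.ofReal_mul hc0, mul_comm c]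
      exact ENNReal.ofReal_le_ofReal
        (mul_le_mul_of_nonneg_left (hc a h0) measureReal_nonneg)
  have h2 := ENNReal.toReal_mono
    (ENNReal.mul_ne_top ENNReal.ofReal_ne_top (measure_ne_top _ _)) h
  rwa [ENNReal.toReal_mul, ENNReal.toReal_ofReal hc0] at h2

end Restart

theorem DepOn.preimage {ι κ : Type*} {S : Set κ} {A : Set (κ → Bool)} (h : DepOn S A)
    (j : κ → ι) : DepOn (j '' S) ((fun ω k => ω (j k)) ⁻¹' A) :=
  fun _ _ hω hA => h _ _ (fun k hk => hω _ ⟨k, hk, rfl⟩) hA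

theorem measurable_reindex {ι κ : Type*} (j : κ → ι) :
    Measurable fun (ω : ι → Bool) (k : κ) => ω (j k) :=
  measurable_pi_lambda _ fun _ => measurable_pi_apply _

/-- An event depending on `X`, where `X` is determined by the coordinates in `S`. -/
theorem depOn_of_forall {ι β : Type*} {S : Set ι} {X : (ι → Bool) → β}
    (h : ∀ ω ω', (∀ i ∈ S, ω i = ω' i) → X ω = X ω') (P : β → Prop) :
    DepOn S {ω | P (X ω)} := fun ω ω' hω hP => by
  rw [Set.mem_ofPred_eq] at hP ⊢
  rwa [← h _ _ hω]

/-! ### Edges and connections inside a set -/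

/-- Pairs of vertices of `U`. -/
def edgesIn {d : ℕ} (U : Set (Zd d)) : Set (Sym2 (Zd d)) := {e | ∀ x ∈ e, x ∈ U}

theorem mk_mem_edgesIn {d : ℕ} {U : Set (Zd d)} {x y : Zd d} :
    s(x, y) ∈ edgesIn U ↔ x ∈ U ∧ y ∈ U := by
  simp [edgesIn]

theorem edgesIn_mono {d : ℕ} {U V : Set (Zd d)} (h : U ⊆ V) : edgesIn U ⊆ edgesIn V :=
  fun _ he x hx => h (he x hx)

theorem edgesIn_finite {d : ℕ} {U : Set (Zd d)} (hU : U.Finite) : (edgesIn U).Finite := by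
  refine ((hU.prod hU).image fun z : Zd d × Zd d => s(z.1, z.2)).subset ?_
  intro e he
  induction e with
  | _ x y =>
    have := mk_mem_edgesIn.1 he
    exact ⟨(x, y), this, rfl⟩

theorem onSet_openAdj_congr {d : ℕ} {U : Set (Zd d)} {ω ω' : Config d}
    (h : ∀ e ∈ edgesIn U, ω e = ω' e) : onSet (openAdj ω) U = onSet (openAdj ω') U := by
  funext x y
  refine propext ⟨?_, ?_⟩
  · rintro ⟨⟨h1, h2⟩, hx, hy⟩
    exact ⟨⟨h1, by rw [← h _ (mk_mem_edgesIn.2 ⟨hx, hy⟩)]; exact h2⟩, hx, hy⟩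
  · rintro ⟨⟨h1, h2⟩, hx, hy⟩
    exact ⟨⟨h1, by rw [h _ (mk_mem_edgesIn.2 ⟨hx, hy⟩)]; exact h2⟩, hx, hy⟩

/-- A path leaving `U` has a first exit edge. -/
theorem exists_exit {α : Type*} {r : α → α → Prop} {U : Set α} {x y : α}
    (h : Relation.ReflTransGen r x y) (hx : x ∈ U) (hy : y ∉ U) :
    ∃ v w, Relation.ReflTransGen (onSet r U) x v ∧ r v w ∧ v ∈ U ∧ w ∉ U := by
  have key : (Relation.ReflTransGen (onSet r U) x y) ∨
      ∃ v w, Relation.ReflTransGen (onSet r U) x v ∧ r v w ∧ v ∈ U ∧ w ∉ U := by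
    clear hy
    induction h with
    | refl => exact Or.inl .refl
    | @tail b c _ hbc ih =>
      rcases ih with ih | ih
      · have hb := reflTransGen_onSet_mem hx ih
        by_cases hc : c ∈ U
        · exact Or.inl (ih.tail ⟨hbc, hb, hc⟩)
        · exact Or.inr ⟨b, c, ih, hbc, hb, hc⟩
      · exact Or.inr ih
  exact key.resolve_left fun h => hy (reflTransGen_onSet_mem hx h)

/-- A path entering the complement of `A` has a last exit edge from `A`. -/
theorem exists_last_exit {α : Type*} {r : α → α → Prop} {A : Set α} {x y : α}
    (h : Relation.ReflTransGen r x y) (hx : x ∈ A) (hy : y ∉ A) :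
    ∃ u v, r u v ∧ u ∈ A ∧ v ∉ A ∧ Relation.ReflTransGen (onSet r Aᶜ) v y := by
  induction h with
  | refl => exact absurd hx hy
  | @tail b c _ hbc ih =>
    by_cases hb : b ∈ A
    · exact ⟨b, c, hbc, hb, hy, .refl⟩
    · obtain ⟨u, v, h1, h2, h3, h4⟩ := ih hb
      exact ⟨u, v, h1, h2, h3, h4.tail ⟨hbc, hb, hy⟩⟩

/-! ### Lattice automorphisms -/

/-- The affine map with linear part a signed permutation. -/
def sgm {d : ℕ} (a : Zd d) (π : Equiv.Perm (Fin d)) (ε : Fin d → ℤˣ) (x : Zd d) : Zd d :=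
  fun j => a j + (ε j : ℤ) * x (π j)

theorem abs_units_mul (u : ℤˣ) (x : ℤ) : |(u : ℤ) * x| = |x| := by
  rcases Int.units_eq_one_or u with rfl | rfl <;> simp

theorem latAdj_sgm {d : ℕ} (a : Zd d) (π : Equiv.Perm (Fin d)) (ε : Fin d → ℤˣ) (x y : Zd d) :
    latAdj (sgm a π ε x) (sgm a π ε y) ↔ latAdj x y := by
  unfold latAdj
  have : ∀ j, |sgm a π ε x j - sgm a π ε y j| = |x (π j) - y (π j)| := by
    intro j
    rw [← abs_units_mul (ε j) (x (π j) - y (π j))]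
    congr 1
    simp only [sgm]
    ring
  simp only [this]
  rw [Equiv.sum_comp π fun j => |x j - y j|]

theorem sgm_injective {d : ℕ} (a : Zd d) (π : Equiv.Perm (Fin d)) (ε : Fin d → ℤˣ) :
    Function.Injective (sgm a π ε) := by
  intro x y h
  funext j
  have := congrFun h (π.symm j)
  simp only [sgm, Equiv.apply_symm_apply, add_right_inj] at this
  exact (mul_right_inj' (Units.ne_zero _)).1 this

theorem sym2_map_sgm_injective {d : ℕ} (a : Zd d) (π : Equiv.Perm (Fin d)) (ε : Fin d → ℤˣ) :
    Function.Injective (Sym2.map (sgm a π ε)) := Sym2.map.injective (sgm_injective a π ε)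

theorem map_edgesIn_subset {d : ℕ} {τ : Zd d → Zd d} {U V : Set (Zd d)}
    (h : ∀ x ∈ U, τ x ∈ V) : Sym2.map τ '' edgesIn U ⊆ edgesIn V := by
  rintro _ ⟨e, he, rfl⟩ x hx
  obtain ⟨y, hy, rfl⟩ := Sym2.mem_map.1 hx
  exact h y (he y hy)

/-- The configuration seen through `τ`. -/
def pull {d : ℕ} (τ : Zd d → Zd d) (ω : Config d) : Config d := fun e => ω (Sym2.map τ e)

theorem openAdj_pull {d : ℕ} {a : Zd d} {π : Equiv.Perm (Fin d)} {ε : Fin d → ℤˣ}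
    {ω : Config d} {x y : Zd d} :
    openAdj (pull (sgm a π ε) ω) x y ↔ openAdj ω (sgm a π ε x) (sgm a π ε y) := by
  unfold openAdj pull
  rw [latAdj_sgm, Sym2.map_mk]

/-! ### Connections from an inner box to the boundary of a box -/

theorem box_finite (d n : ℕ) : (box d n).Finite :=
  (fbox d n).finite_toSet.subset fun _ hx => Finset.mem_coe.2 (mem_fbox.2 hx)

theorem zero_mem_box (d n : ℕ) : (0 : Zd d) ∈ box d n := fun i => by simp

theorem box_mono {d m n : ℕ} (h : m ≤ n) : box d m ⊆ box d n := fun x hx i => by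
  have := hx i
  omega

/-- The inner vertex boundary of the box. -/
def shell (d n : ℕ) : Set (Zd d) := {x | x ∈ box d n ∧ ∃ i, |x i| = n}

/-- Points of the boundary of `box d n` connected to `box d m` inside `box d n`. -/
def touch {d : ℕ} (m n : ℕ) (ω : Config d) : Set (Zd d) :=
  {x | x ∈ shell d n ∧ ∃ y ∈ box d m, Relation.ReflTransGen (onSet (openAdj ω) (box d n)) y x}

theorem touch_congr {d m n : ℕ} {ω ω' : Config d}
    (h : ∀ e ∈ edgesIn (box d n), ω e = ω' e) : touch m n ω = touch m n ω' := by
  unfold touch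
  rw [onSet_openAdj_congr h]

theorem touch_finite {d : ℕ} (m n : ℕ) (ω : Config d) : (touch m n ω).Finite :=
  (box_finite d n).subset fun _ hx => hx.1.1

theorem exists_face_of_latAdj {d n : ℕ} {v w : Zd d} (h : latAdj v w) (hv : v ∈ box d n)
    (hw : w ∉ box d n) : v ∈ shell d n := by
  refine ⟨hv, ?_⟩
  by_contra! hc
  refine hw fun i => ?_
  have h1 := hv i
  have h2 := hc i
  have h3 := h.abs_sub_le i
  have h4 := abs_sub_abs_le_abs_sub (w i) (v i)
  rw [abs_sub_comm] at h4
  omega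

theorem touch_nonempty_of_reflTransGen {d m n : ℕ} {ω : Config d} {x y : Zd d} (hmn : m ≤ n)
    (hx : x ∈ box d m) (hy : y ∉ box d n) (h : Relation.ReflTransGen (openAdj ω) x y) :
    (touch m n ω).Nonempty := by
  obtain ⟨v, w, h1, h2, h3, h4⟩ := exists_exit h (box_mono hmn hx) hy
  exact ⟨v, exists_face_of_latAdj h2.1 h3 h4, x, hx, h1⟩

theorem touch_nonempty_of_infinite {d m : ℕ} {ω : Config d} {x : Zd d} (hx : x ∈ box d m)
    (h : {y | Relation.ReflTransGen (openAdj ω) x y}.Infinite) {n : ℕ} (hmn : m ≤ n) :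
    (touch m n ω).Nonempty := by
  obtain ⟨y, hy, hyn⟩ := h.exists_notMem_finite (box_finite d n)
  exact touch_nonempty_of_reflTransGen hmn hx hyn hy

/-! ### Almost sure volume growth from positive probability -/

theorem reach_congr {α : Type*} {r s : α → α → Prop} {n : ℕ} {x y : α} (h : reach r n x y)
    (hrs : ∀ k < n, ∀ u v, reach r k x u → r u v → s u v) : reach s n x y := by
  induction n generalizing y with
  | zero => exact h
  | succ n ih =>
    rcases h with h | ⟨z, h, hz⟩
    · exact Or.inl (ih h fun k hk => hrs k (by omega))
    · exact Or.inr ⟨z, ih h fun k hk => hrs k (by omega), hrs n (by omega) _ _ h hz⟩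

theorem onSet_openAdj_latAdj {d : ℕ} {ω : Config d} {U : Set (Zd d)} (a b : Zd d)
    (h : onSet (openAdj ω) U a b) : latAdj a b := h.1.1

theorem reach_openAdj_finite {d : ℕ} (ω : Config d) (U : Set (Zd d)) (R : ℕ) (v : Zd d) :
    {x | reach (onSet (openAdj ω) U) R v x}.Finite := by
  refine ((box_finite d R).image fun x => v + x).subset fun x hx => ⟨x - v, fun i => ?_, by simp⟩
  have := reach_abs_sub_le onSet_openAdj_latAdj hx i
  rw [abs_sub_comm] at this
  simpa using this

/-- The open cluster of `v` inside `U` grows with full volume. -/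
def Grow {d : ℕ} (c : ℝ) (U : Set (Zd d)) (v : Zd d) : Set (Config d) :=
  {ω | ∃ R₁ : ℕ, ∀ R ≥ R₁, c * (R : ℝ) ^ d ≤ {x | reach (onSet (openAdj ω) U) R v x}.ncard}

theorem depOn_grow {d : ℕ} (c : ℝ) (U : Set (Zd d)) (v : Zd d) :
    DepOn (edgesIn U) (Grow c U v) := by
  intro ω ω' h hω
  unfold Grow at hω ⊢
  rw [Set.mem_ofPred_eq] at hω ⊢
  rwa [← onSet_openAdj_congr h]

theorem measurableSet_grow {d : ℕ} (c : ℝ) (U : Set (Zd d)) (v : Zd d) :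
    MeasurableSet (Grow c U v) := by
  have h1 : Grow c U v = ⋃ R₁ : ℕ, ⋂ R : ℕ, ⋂ _ : R ≥ R₁,
      {ω : Config d | c * (R : ℝ) ^ d ≤ {x | reach (onSet (openAdj ω) U) R v x}.ncard} := by
    ext ω
    simp [Grow]
  rw [h1]
  refine MeasurableSet.iUnion fun R₁ => MeasurableSet.iInter fun R =>
    MeasurableSet.iInter fun _ => ?_
  set V : Set (Zd d) := (fun x => v + x) '' box d R with hV
  have mV : ∀ x : Zd d, (∀ i, |v i - x i| ≤ R) → x ∈ V := fun x hx =>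
    ⟨x - v, fun i => by
      have := hx i
      rw [abs_sub_comm] at this
      simpa using this, by simp⟩
  have key : ∀ ω ω' : Config d, (∀ e ∈ edgesIn V, ω e = ω' e) → ∀ x,
      reach (onSet (openAdj ω) U) R v x → reach (onSet (openAdj ω') U) R v x := by
    intro ω ω' h x hx
    refine reach_congr hx fun k hk u w h1 h2 => ⟨⟨h2.1.1, ?_⟩, h2.2⟩
    rw [← h _ (mk_mem_edgesIn.2 ⟨mV u fun i => ?_, mV w fun i => ?_⟩)]
    · exact h2.1.2
    · have := reach_abs_sub_le onSet_openAdj_latAdj h1 i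
      omega
    · have := reach_abs_sub_le onSet_openAdj_latAdj (h1.snoc h2) i
      omega
  refine DepOn.measurableSet (S := edgesIn V) ?_ (edgesIn_finite ((box_finite d R).image _))
  intro ω ω' h hω
  have : {x | reach (onSet (openAdj ω) U) R v x} = {x | reach (onSet (openAdj ω') U) R v x} :=
    Set.ext fun x => ⟨key ω ω' h x, key ω' ω (fun e he => (h e he).symm) x⟩
  rw [Set.mem_ofPred_eq] at hω ⊢
  rwa [← this]

theorem grow_of_pull {d : ℕ} {c : ℝ} {U V : Set (Zd d)} {v w a : Zd d}
    {π : Equiv.Perm (Fin d)} {ε : Fin d → ℤˣ} {ω : Config d}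
    (hUV : ∀ x ∈ U, sgm a π ε x ∈ V) (hw : sgm a π ε v = w)
    (h : pull (sgm a π ε) ω ∈ Grow c U v) : ω ∈ Grow c V w := by
  obtain ⟨R₁, hR⟩ := h
  refine ⟨R₁, fun R hR₁ => (hR R hR₁).trans ?_⟩
  rw [Nat.cast_le, ← Set.ncard_image_of_injective _ (sgm_injective a π ε)]
  refine Set.ncard_le_ncard ?_ (reach_openAdj_finite ω V R w)
  rintro _ ⟨x, hx, rfl⟩
  have := reach.map (t := onSet (openAdj ω) V) (sgm a π ε)
    (fun x y h => ⟨openAdj_pull.1 h.1, hUV _ h.2.1, hUV _ h.2.2⟩) hx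
  rwa [hw] at this

theorem bern_pull {d : ℕ} (p : unitInterval) (a : Zd d) (π : Equiv.Perm (Fin d))
    (ε : Fin d → ℤˣ) {A : Set (Config d)} (hA : MeasurableSet A) :
    (bern fun _ => p).real (pull (sgm a π ε) ⁻¹' A) = (bern fun _ => p).real A :=
  bern_preimage_comp (fun _ : Sym2 (Zd d) => p) (sym2_map_sgm_injective a π ε) hA

theorem grow_of_reach {d : ℕ} {c : ℝ} (hc : 0 ≤ c) {ω : Config d} {U : Set (Zd d)} {w : Zd d}
    (h : Relation.ReflTransGen (openAdj ω) 0 w) (hw : ω ∈ Grow c U w) :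
    ω ∈ Grow (c / 2 ^ d) Set.univ 0 := by
  obtain ⟨K, hK⟩ := exists_reach_of_reflTransGen h
  obtain ⟨R₁, hR⟩ := hw
  refine ⟨R₁ + 2 * K, fun R hR' => ?_⟩
  have h1 := hR (R - K) (by omega)
  have h2 : {x | reach (onSet (openAdj ω) U) (R - K) w x}.ncard ≤
      {x | reach (onSet (openAdj ω) Set.univ) R 0 x}.ncard := by
    refine Set.ncard_le_ncard (fun x hx => ?_) (reach_openAdj_finite ω _ R 0)
    have h3 := hK.mono (s := onSet (openAdj ω) Set.univ) fun a b h => ⟨h, trivial, trivial⟩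
    have h4 := reach.mono (s := onSet (openAdj ω) Set.univ) hx
      fun a b h => ⟨h.1, trivial, trivial⟩
    exact (h3.trans h4).mono_len (by omega)
  have h3 : (R : ℝ) / 2 ≤ ((R - K : ℕ) : ℝ) := by
    rw [Nat.cast_sub (by omega)]
    have : ((2 * K : ℕ) : ℝ) ≤ R := by exact_mod_cast (by omega : 2 * K ≤ R)
    push_cast at this
    linarith
  calc c / 2 ^ d * (R : ℝ) ^ d = c * ((R : ℝ) / 2) ^ d := by rw [div_pow]; ring
    _ ≤ c * ((R - K : ℕ) : ℝ) ^ d := by gcongr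
    _ ≤ _ := h1
    _ ≤ _ := by exact_mod_cast h2

/-- If, with positive probability, the cluster of `0` in a half-space grows with full volume,
then almost surely the cluster of `0`, when infinite, grows with full volume. -/
theorem ae_grow_of_pos {d : ℕ} {p : unitInterval} (hp : 0 < (p : ℝ)) {c : ℝ} (hc : 0 < c)
    (i₀ : Fin d)
    (h : 0 < (bern fun _ : Sym2 (Zd d) => p).real (Grow c {x | 0 ≤ x i₀} 0)) :
    ∀ᵐ ω ∂(bern fun _ : Sym2 (Zd d) => p), (cluster ω).Infinite →
      ω ∈ Grow (c / 2 ^ d) Set.univ 0 := by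
  classical
  set μ := bern fun _ : Sym2 (Zd d) => p with hμ
  set c₀ := μ.real (Grow c {x : Zd d | 0 ≤ x i₀} 0) with hc₀
  set H : ℕ → Set (Config d) := fun n => {ω | (touch 0 n ω).Nonempty} with hH
  have dH : ∀ n, DepOn (edgesIn (box d n)) (H n) := fun n =>
    depOn_of_forall (fun ω ω' h => touch_congr h) _
  have mH : ∀ n, MeasurableSet (H n) := fun n => (dH n).measurableSet (edgesIn_finite (box_finite d n))
  set D : Set (Config d) := (⋂ n, H n) ∩ (Grow (c / 2 ^ d) Set.univ 0)ᶜ with hD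
  have mD : MeasurableSet D := (MeasurableSet.iInter mH).inter (measurableSet_grow _ _ _).compl
  suffices hnull : μ.real D = 0 by
    have h0 : μ D = 0 := by
      rw [measureReal_def, ENNReal.toReal_eq_zero_iff] at hnull
      exact hnull.resolve_right (measure_ne_top _ _)
    filter_upwards [measure_eq_zero_iff_ae_notMem.1 h0] with ω hω hinf
    by_contra hg
    refine hω ⟨Set.mem_iInter.2 fun n => ?_, hg⟩
    exact touch_nonempty_of_infinite (zero_mem_box d 0) hinf (Nat.zero_le n)
  refine null_of_forall_cylinder μ mD (mul_pos hp h) fun S B hB => ?_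
  obtain ⟨n, hn⟩ : ∃ n, (S : Set (Sym2 (Zd d))) ⊆ edgesIn (box d n) := by
    clear hB
    induction S using Finset.induction_on with
    | empty => exact ⟨0, by simp⟩
    | insert e S _ ih =>
      obtain ⟨n, hn⟩ := ih
      obtain ⟨k, hk⟩ : ∃ k, e ∈ edgesIn (box d k) := by
        induction e with
        | _ x y =>
          refine ⟨∑ i, ((x i).natAbs + (y i).natAbs), mk_mem_edgesIn.2 ?_⟩
          have hs := fun i => Finset.single_le_sum
            (f := fun i => (x i).natAbs + (y i).natAbs) (fun _ _ => Nat.zero_le _)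
            (Finset.mem_univ i)
          constructor <;> intro i <;> have := hs i <;> rw [Int.abs_eq_natAbs] <;> omega
      refine ⟨max n k, ?_⟩
      rw [Finset.coe_insert, Set.insert_subset_iff]
      exact ⟨edgesIn_mono (box_mono (le_max_right _ _)) hk,
        hn.trans (edgesIn_mono (box_mono (le_max_left _ _)))⟩
  have hexit : ∀ v : Zd d, ∃ (i : Fin d) (s : ℤˣ), v ∈ shell d n → v i = (s : ℤ) * n := by
    intro v
    by_cases hv : v ∈ shell d n
    · obtain ⟨i, hi⟩ := hv.2
      rcases abs_choice (v i) with h1 | h1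
      · exact ⟨i, 1, fun _ => by rw [h1] at hi; simpa using hi⟩
      · exact ⟨i, -1, fun _ => by rw [h1] at hi; simp; omega⟩
    · exact ⟨i₀, 1, fun h => absurd h hv⟩
  choose I s hIs using hexit
  let nxt : Zd d → Zd d := fun v => v + Pi.single (I v) (s v : ℤ)
  let half : Zd d → Set (Zd d) := fun v => {x | (n : ℤ) + 1 ≤ (s v : ℤ) * x (I v)}
  let E : Zd d → Set (Config d) := fun v => {ω | ω s(v, nxt v) = true} ∩ Grow c (half v) (nxt v)
  let X : Config d → Zd d := fun ω => if h : (touch 0 n ω).Nonempty then h.some else 0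
  have hss : ∀ v, (s v : ℤ) * (s v : ℤ) = 1 := fun v => by
    rcases Int.units_eq_one_or (s v) with h | h <;> simp [h]
  have hXc : ∀ ω ω' : Config d, (∀ e ∈ edgesIn (box d n), ω e = ω' e) → X ω = X ω' := by
    intro ω ω' h
    simp only [X, touch_congr h]
  have hXmem : ∀ ω ∈ H n, X ω ∈ touch 0 n ω := by
    intro ω hω
    simp only [X, dif_pos (show (touch 0 n ω).Nonempty from hω)]
    exact Set.Nonempty.some_mem _
  have dBX : ∀ v, DepOn (edgesIn (box d n)) (B ∩ H n ∩ {ω | X ω = v}) := fun v =>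
    ((hB.mono hn).inter (dH n)).inter (depOn_of_forall hXc (· = v))
  have hout : ∀ v ∈ shell d n, ∀ x ∈ half v, x ∉ box d n := by
    intro v _ x hx hxb
    have h1 := hxb (I v)
    have h2 : (n : ℤ) + 1 ≤ (s v : ℤ) * x (I v) := hx
    have h3 := le_abs_self ((s v : ℤ) * x (I v))
    rw [abs_units_mul] at h3
    omega
  have hnxt : ∀ v ∈ shell d n, (s v : ℤ) * nxt v (I v) = n + 1 := by
    intro v hv
    simp only [nxt, Pi.add_apply, Pi.single_eq_same, hIs v hv, mul_add, ← mul_assoc, hss, one_mul]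
  have hface : ∀ v, (B ∩ H n ∩ {ω | X ω = v}).Nonempty → v ∈ shell d n := by
    rintro v ⟨ω, ⟨-, hω⟩, rfl⟩
    exact (hXmem ω hω).1
  have mgr : ∀ v, MeasurableSet (Grow c (half v) (nxt v)) := fun v => measurableSet_grow _ _ _
  have mcoord : ∀ e : Sym2 (Zd d), MeasurableSet {ω : Config d | ω e = true} := fun e =>
    (measurable_pi_apply e : Measurable fun ω : Config d => ω e) (measurableSet_singleton true)
  have hprob : ∀ v ∈ shell d n, (p : ℝ) * c₀ ≤ μ.real (E v) := by
    intro v hv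
    have h1 := bern_inter (fun _ : Sym2 (Zd d) => p) (S := {s(v, nxt v)}) (T := edgesIn (half v))
      (A := {ω | ω s(v, nxt v) = true}) (B := Grow c (half v) (nxt v))
      (fun ω ω' h hω => (h _ rfl).symm.trans hω) (depOn_grow _ _ _)
      (by
        rw [Set.disjoint_singleton_left, mk_mem_edgesIn]
        exact fun h => hout v hv v h.1 hv.1)
      (mcoord _) (mgr v)
    rw [bern_coord, if_pos rfl] at h1
    change _ ≤ (bern fun _ => p).real _
    rw [h1]
    refine mul_le_mul_of_nonneg_left ?_ hp.le
    set π := Equiv.swap i₀ (I v)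
    rw [hc₀, hμ, ← bern_pull p (nxt v) π (fun _ => s v) (measurableSet_grow _ _ _)]
    have hhalf : ∀ x ∈ {x : Zd d | 0 ≤ x i₀}, sgm (nxt v) π (fun _ => s v) x ∈ half v := by
      intro x hx
      have hx' : 0 ≤ x i₀ := hx
      change (n : ℤ) + 1 ≤ s v * (nxt v (I v) + s v * x (π (I v)))
      rw [mul_add, hnxt v hv, ← mul_assoc, hss, one_mul, Equiv.swap_apply_right]
      omega
    have hzero : sgm (nxt v) π (fun _ => s v) 0 = nxt v := by
      funext j
      simp [sgm]
    have hincl : pull (sgm (nxt v) π (fun _ => s v)) ⁻¹' Grow c {x : Zd d | 0 ≤ x i₀} 0 ⊆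
        Grow c (half v) (nxt v) := fun ω hω => grow_of_pull hhalf hzero hω
    exact measureReal_mono hincl
  have dE : ∀ v, DepOn ({s(v, nxt v)} ∪ edgesIn (half v)) (E v) := fun v =>
    DepOn.inter (fun ω ω' h (hω : ω _ = true) =>
        (show ω' s(v, nxt v) = true from h _ (Or.inl rfl) ▸ hω))
      ((depOn_grow _ _ _).mono Set.subset_union_right)
  have mE : ∀ v, MeasurableSet (E v) := fun v => (mcoord _).inter (mgr v)
  have hre := bern_restart_ge (fun _ : Sym2 (Zd d) => p) X (B := B ∩ H n)
    (fun _ => edgesIn (box d n)) (fun v => {s(v, nxt v)} ∪ edgesIn (half v)) E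
    (fun v => (dBX v).measurableSet (edgesIn_finite (box_finite d n))) dBX
    (fun v _ => mE v) (fun v _ => dE v)
    (fun v hv => by
      have hv := hface v hv
      refine Set.disjoint_left.2 fun e he he' => ?_
      have key : ∃ x ∈ e, x ∈ half v := by
        rcases he' with rfl | he'
        · refine ⟨nxt v, Sym2.mem_mk_right _ _, ?_⟩
          simp only [half, Set.mem_ofPred_eq, hnxt v hv]
          omega
        · induction e with
          | _ x y => exact ⟨x, Sym2.mem_mk_left _ _, (mk_mem_edgesIn.1 he').1⟩
      obtain ⟨x, hx, hx'⟩ := key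
      exact hout v hv x hx' (he x hx))
    (mul_pos hp h).le (fun v hv => hprob v (hface v hv))
  calc (p : ℝ) * c₀ * μ.real (B ∩ D) ≤ p * c₀ * μ.real (B ∩ H n) := by
        refine mul_le_mul_of_nonneg_left (measureReal_mono ?_) (mul_pos hp h).le
        exact fun ω hω => ⟨hω.1, Set.mem_iInter.1 hω.2.1 n⟩
    _ ≤ _ := hre
    _ ≤ _ := by
        refine measureReal_mono ?_
        rintro ω ⟨⟨hωB, hωH⟩, hωE⟩
        refine ⟨hωB, fun hωD => hωD.2 ?_⟩
        have hX := hXmem ω hωH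
        obtain ⟨y, hy, hyX⟩ := hX.2
        have hy0 : y = 0 := funext fun i => by simpa using hy i
        subst hy0
        refine grow_of_reach hc.le ?_ hωE.2
        refine (Relation.ReflTransGen.mono (fun a b h => h.1) _ _ hyX).tail
          ⟨latAdj_add_single _ _ ?_, hωE.1⟩
        rcases Int.units_eq_one_or (s (X ω)) with h | h <;> simp [h]

/-! ### Supercritical percolation: a large box is connected to infinity -/

theorem exists_isBernoulli_infinite {d : ℕ} {p : unitInterval} (hp : pc d < p) :
    0 < (bern fun _ : Sym2 (Zd d) => p).real {ω | (cluster ω).Infinite} := by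
  have hbdd : BddAbove {p : ℝ | 0 ≤ p ∧ p ≤ 1 ∧
      ∀ Q : Measure (Config d), IsBernoulli p Q → Q {ω | (cluster ω).Infinite} = 0} :=
    ⟨1, fun x hx => hx.2.1⟩
  by_contra hneg
  refine (le_csSup hbdd ⟨p.2.1, p.2.2, fun Q hQ => ?_⟩).not_gt hp
  have := hQ.1
  rw [hQ.eq_bern]
  have h0 := le_antisymm (not_lt.1 hneg) measureReal_nonneg
  rw [measureReal_def, ENNReal.toReal_eq_zero_iff] at h0
  exact h0.resolve_right (measure_ne_top _ _)

theorem measurableSet_reach {d : ℕ} (n : ℕ) (x y : Zd d) :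
    MeasurableSet {ω : Config d | reach (openAdj ω) n x y} := by
  induction n generalizing y with
  | zero => exact MeasurableSet.const _
  | succ n ih =>
    have h1 : {ω : Config d | reach (openAdj ω) (n + 1) x y} =
        {ω | reach (openAdj ω) n x y} ∪
          ⋃ z, ({ω | reach (openAdj ω) n x z} ∩ {ω | openAdj ω z y}) := by
      ext ω
      simp [reach]
    rw [h1]
    refine (ih y).union (MeasurableSet.iUnion fun z => (ih z).inter ?_)
    refine DepOn.measurableSet (S := {s(z, y)}) (fun ω ω' h hω => ⟨hω.1, ?_⟩)
      (Set.finite_singleton _)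
    rw [← h _ rfl]
    exact hω.2

/-- There is an infinite open cluster. -/
def Perc (d : ℕ) : Set (Config d) :=
  {ω | ∃ x, {y | Relation.ReflTransGen (openAdj ω) x y}.Infinite}

theorem measurableSet_perc (d : ℕ) : MeasurableSet (Perc d) := by
  have h1 : Perc d = ⋃ x : Zd d, ⋂ n : ℕ, ⋃ y : Zd d, ⋃ _ : y ∉ box d n, ⋃ k : ℕ,
      {ω | reach (openAdj ω) k x y} := by
    ext ω
    simp only [Perc, Set.mem_iUnion, Set.mem_iInter, Set.mem_ofPred_eq]
    refine exists_congr fun x => ⟨fun h n => ?_, fun h hfin => ?_⟩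
    · obtain ⟨y, hy, hyn⟩ := h.exists_notMem_finite (box_finite d n)
      exact ⟨y, hyn, exists_reach_of_reflTransGen hy⟩
    · obtain ⟨n, hn⟩ : ∃ n, {y | Relation.ReflTransGen (openAdj ω) x y} ⊆ box d n := by
        refine ⟨∑ z ∈ hfin.toFinset, ∑ i, (z i).natAbs, fun y hy i => ?_⟩
        have h1 := Finset.single_le_sum (f := fun z : Zd d => ∑ i, (z i).natAbs)
          (fun _ _ => Nat.zero_le _) (hfin.mem_toFinset.2 hy)
        have h2 := Finset.single_le_sum (f := fun i => (y i).natAbs)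
          (fun _ _ => Nat.zero_le _) (Finset.mem_univ i)
        rw [Int.abs_eq_natAbs]
        exact_mod_cast h2.trans h1
      obtain ⟨y, hy, k, hk⟩ := h n
      exact hy (hn hk.reflTransGen)
  rw [h1]
  exact MeasurableSet.iUnion fun x => MeasurableSet.iInter fun n => MeasurableSet.iUnion fun y =>
    MeasurableSet.iUnion fun _ => MeasurableSet.iUnion fun k => measurableSet_reach k x y

theorem depOn_perc {d : ℕ} (S : Finset (Sym2 (Zd d))) : DepOn (S : Set _)ᶜ (Perc d) := by
  rintro ω ω' h ⟨x, hx⟩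
  set W : Set (Zd d) := {x} ∪ {w | ∃ e ∈ S, w ∈ e} with hW
  have hWfin : W.Finite := by
    refine (Set.finite_singleton x).union ?_
    have : {w : Zd d | ∃ e ∈ S, w ∈ e} = ⋃ e ∈ S, {w | w ∈ e} := by
      ext; simp
    rw [this]
    refine Set.Finite.biUnion S.finite_toSet fun e _ => ?_
    induction e with
    | _ a b =>
      refine (Set.toFinite {a, b}).subset fun w hw => ?_
      simpa using hw
  have key : ∀ y, Relation.ReflTransGen (openAdj ω) x y →
      ∃ w ∈ W, Relation.ReflTransGen (openAdj ω') w y := by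
    intro y hy
    induction hy with
    | refl => exact ⟨x, Or.inl rfl, .refl⟩
    | @tail b c _ hbc ih =>
      by_cases hS : s(b, c) ∈ S
      · exact ⟨c, Or.inr ⟨_, hS, Sym2.mem_mk_right _ _⟩, .refl⟩
      · obtain ⟨w, hw, hwb⟩ := ih
        refine ⟨w, hw, hwb.tail ⟨hbc.1, ?_⟩⟩
        rw [← h _ (by simpa using hS)]
        exact hbc.2
  by_contra hcon
  refine hx ((hWfin.biUnion (t := fun w => {y | Relation.ReflTransGen (openAdj ω') w y})
    fun w _ => ?_).subset fun y hy => ?_)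
  · by_contra h'
    exact hcon ⟨w, h'⟩
  · simpa using key y hy

theorem bern_perc_eq_one {d : ℕ} {p : unitInterval} (hp : pc d < p) :
    (bern fun _ : Sym2 (Zd d) => p).real (Perc d) = 1 := by
  set μ := bern fun _ : Sym2 (Zd d) => p with hμ
  have hpos : 0 < μ.real (Perc d) :=
    (exists_isBernoulli_infinite hp).trans_le (measureReal_mono fun ω hω => ⟨0, hω⟩)
  have h0 := null_of_forall_cylinder μ (measurableSet_perc d).compl hpos fun S B hB => by
    have h1 := bern_inter (fun _ : Sym2 (Zd d) => p) hB (depOn_perc S) disjoint_compl_right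
      (hB.measurableSet S.finite_toSet) (measurableSet_perc d)
    rw [Set.sdiff_compl, hμ, h1, mul_comm]
    exact mul_le_mul_of_nonneg_right (measureReal_mono Set.inter_subset_left) measureReal_nonneg
  rw [probReal_compl_eq_one_sub (measurableSet_perc d)] at h0
  linarith

theorem touch_mono {d m m' n : ℕ} (h : m ≤ m') {ω : Config d} : touch m n ω ⊆ touch m' n ω :=
  fun _ hx => ⟨hx.1, hx.2.imp fun _ hy => ⟨box_mono h hy.1, hy.2⟩⟩

theorem depOn_touch {d m n : ℕ} (P : Set (Zd d) → Prop) :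
    DepOn (edgesIn (box d n)) {ω : Config d | P (touch m n ω)} :=
  depOn_of_forall (fun _ _ h => touch_congr h) P

theorem measurableSet_touch {d m n : ℕ} (P : Set (Zd d) → Prop) :
    MeasurableSet {ω : Config d | P (touch m n ω)} :=
  (depOn_touch P).measurableSet (edgesIn_finite (box_finite d n))

/-- Above the critical point, a large box is connected to far away with high probability. -/
theorem exists_box_touch {d : ℕ} {p : unitInterval} (hp : pc d < p) {η : ℝ} (hη : 0 < η) :
    ∃ m, ∀ n ≥ m, 1 - η ≤ (bern fun _ : Sym2 (Zd d) => p).real {ω | (touch m n ω).Nonempty} := by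
  set μ := bern fun _ : Sym2 (Zd d) => p with hμ
  set G : ℕ → Set (Config d) := fun m => ⋂ n, ⋂ _ : n ≥ m, {ω | (touch m n ω).Nonempty} with hG
  have hmono : Monotone G := by
    intro m m' h ω hω
    simp only [hG, Set.mem_iInter, Set.mem_ofPred_eq] at hω ⊢
    exact fun n hn => (hω n (h.trans hn)).mono (touch_mono h)
  have hsub : Perc d ⊆ ⋃ m, G m := by
    rintro ω ⟨x, hx⟩
    refine Set.mem_iUnion.2 ⟨∑ i, (x i).natAbs, ?_⟩
    simp only [hG, Set.mem_iInter, Set.mem_ofPred_eq]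
    refine fun n hn => touch_nonempty_of_infinite (fun i => ?_) hx hn
    rw [Int.abs_eq_natAbs]
    exact_mod_cast Finset.single_le_sum (f := fun i => (x i).natAbs)
      (fun _ _ => Nat.zero_le _) (Finset.mem_univ i)
  have hone : μ (⋃ m, G m) = 1 := by
    refine le_antisymm prob_le_one ?_
    rw [← ofReal_measureReal]
    have h1 := bern_perc_eq_one hp
    have h2 := measureReal_mono (μ := μ) hsub
    rw [← ENNReal.ofReal_one]
    exact ENNReal.ofReal_le_ofReal (by linarith)
  have ht := tendsto_measure_iUnion_atTop (μ := μ) hmono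
  rw [hone] at ht
  have ht' := (ENNReal.tendsto_toReal ENNReal.one_ne_top).comp ht
  obtain ⟨m, hm⟩ := (ht'.eventually (lt_mem_nhds (a := 1 - η) (by simpa using hη))).exists
  refine ⟨m, fun n hn => hm.le.trans (measureReal_mono (μ := μ) ?_)⟩
  exact Set.iInter₂_subset n hn

/-! ### Many boundary contacts -/

theorem bern_forall_false_ge {ι : Type*} {p : unitInterval} (s : Finset ι) {N : ℕ}
    (hs : s.card ≤ N) :
    (1 - (p : ℝ)) ^ N ≤ (bern fun _ : ι => p).real {ω | ∀ i ∈ s, ω i = false} := by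
  have h1 := bern_cyl (fun _ : ι => p) s fun _ => false
  simp only [Bool.false_eq_true, if_false, Finset.prod_const] at h1
  rw [h1]
  exact pow_le_pow_of_le_one (by linarith [p.2.2]) (by linarith [p.2.1]) hs

/-- The edges from a finite set to the complement of a box. -/
noncomputable def outEdges {d : ℕ} (n : ℕ) (a : Finset (Zd d)) : Finset (Sym2 (Zd d)) :=
  open Classical in a.biUnion fun v => ((nbrs v).filter (· ∉ box d n)).image fun w => s(v, w)

theorem card_outEdges_le {d : ℕ} (n : ℕ) (a : Finset (Zd d)) :
    (outEdges n a).card ≤ a.card * (2 * d) := by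
  classical
  refine Finset.card_biUnion_le_card_mul _ _ _ fun v _ => ?_
  refine Finset.card_image_le.trans ((Finset.card_le_card (Finset.filter_subset _ _)).trans ?_)
  convert card_nbrs_le v

theorem mem_outEdges {d n : ℕ} {a : Finset (Zd d)} {e : Sym2 (Zd d)} :
    e ∈ outEdges n a ↔ ∃ v ∈ a, ∃ w, latAdj v w ∧ w ∉ box d n ∧ s(v, w) = e := by
  classical
  simp only [outEdges, Finset.mem_biUnion, Finset.mem_image, Finset.mem_filter, mem_nbrs, and_assoc]

theorem touch_succ_subset {d m n : ℕ} (hmn : m ≤ n) {ω : Config d}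
    (h : (touch m (n + 1) ω).Nonempty) :
    ∃ v ∈ touch m n ω, ∃ w, latAdj v w ∧ w ∉ box d n ∧ ω s(v, w) = true := by
  obtain ⟨x, ⟨hx, i, hi⟩, y, hy, hyx⟩ := h
  have hxn : x ∉ box d n := fun h => by
    have := h i
    rw [hi] at this
    push_cast at this
    omega
  have h1 := Relation.ReflTransGen.mono (fun a b (h : onSet (openAdj ω) (box d (n + 1)) a b) => h.1)
    _ _ hyx
  obtain ⟨v, w, hv, hvw, hvn, hwn⟩ := exists_exit h1 (box_mono hmn hy) hxn
  exact ⟨v, ⟨exists_face_of_latAdj hvw.1 hvn hwn, y, hy, hv⟩, w, hvw.1, hwn, hvw.2⟩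

/-- A small nonempty set of boundary contacts has a fair chance of being cut off. -/
theorem touch_drop {d m n k : ℕ} (hmn : m ≤ n) (p : unitInterval) :
    (1 - (p : ℝ)) ^ (k * (2 * d)) * (bern fun _ : Sym2 (Zd d) => p).real
      {ω | (touch m n ω).Nonempty ∧ (touch m n ω).ncard < k} ≤
    (bern fun _ : Sym2 (Zd d) => p).real {ω | (touch m n ω).Nonempty} -
      (bern fun _ : Sym2 (Zd d) => p).real {ω | (touch m (n + 1) ω).Nonempty} := by
  classical
  set B : Set (Config d) := {ω | (touch m n ω).Nonempty ∧ (touch m n ω).ncard < k} with hB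
  let X : Config d → Finset (Zd d) := fun ω => (touch_finite m n ω).toFinset
  have hXc : ∀ ω ω' : Config d, (∀ e ∈ edgesIn (box d n), ω e = ω' e) → X ω = X ω' := by
    intro ω ω' h
    simp only [X, touch_congr h]
  have dB : ∀ a, DepOn (edgesIn (box d n)) (B ∩ {ω | X ω = a}) := fun a =>
    (depOn_touch fun t => t.Nonempty ∧ t.ncard < k).inter (depOn_of_forall hXc (· = a))
  have dE : ∀ a : Finset (Zd d), DepOn (outEdges n a : Set (Sym2 (Zd d)))
      {ω : Config d | ∀ e ∈ outEdges n a, ω e = false} :=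
    fun a ω ω' h hω e he => (h e he).symm.trans (hω e he)
  have hre := bern_restart_ge (fun _ : Sym2 (Zd d) => p) X (B := B) (fun _ => edgesIn (box d n))
    (fun a => (outEdges n a : Set _)) (fun a => {ω | ∀ e ∈ outEdges n a, ω e = false})
    (fun a => (dB a).measurableSet (edgesIn_finite (box_finite d n))) dB
    (fun a _ => (dE a).measurableSet (Finset.finite_toSet _)) (fun a _ => dE a)
    (fun a _ => by
      refine Set.disjoint_left.2 fun e he he' => ?_
      obtain ⟨v, hv, w, -, hw, rfl⟩ := mem_outEdges.1 (Finset.mem_coe.1 he')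
      exact hw (mk_mem_edgesIn.1 he).2)
    (c := (1 - (p : ℝ)) ^ (k * (2 * d))) (pow_nonneg (by linarith [p.2.2]) _)
    (fun a ha => by
      obtain ⟨ω, ⟨-, hω⟩, rfl⟩ := ha
      refine bern_forall_false_ge _ ((card_outEdges_le _ _).trans ?_)
      rw [Set.ncard_eq_toFinset_card _ (touch_finite m n ω)] at hω
      exact Nat.mul_le_mul_right _ hω.le)
  refine hre.trans ?_
  rw [← measureReal_sdiff]
  · refine measureReal_mono fun ω hω => ⟨hω.1.1, fun hne => ?_⟩
    obtain ⟨v, hv, w, h1, h2, h3⟩ := touch_succ_subset hmn hne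
    have := hω.2 s(v, w) (mem_outEdges.2 ⟨v, by simpa [X] using hv, w, h1, h2, rfl⟩)
    rw [h3] at this
    exact Bool.noConfusion this
  · intro ω hω
    obtain ⟨v, hv, -⟩ := touch_succ_subset hmn hω
    exact ⟨v, hv⟩
  · exact measurableSet_touch Set.Nonempty

theorem exists_many_touch {d : ℕ} {p : unitInterval} (hp : pc d < p) (hp1 : (p : ℝ) < 1) {η : ℝ}
    (hη : 0 < η) : ∃ m, ∀ k N : ℕ, ∃ n ≥ N, m ≤ n ∧
      (bern fun _ : Sym2 (Zd d) => p).real {ω | (touch m n ω).ncard < k} ≤ η := by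
  obtain ⟨m, hm⟩ := exists_box_touch hp (half_pos hη)
  refine ⟨m, fun k N => ?_⟩
  set μ := bern fun _ : Sym2 (Zd d) => p with hμ
  set θ : ℝ := (1 - (p : ℝ)) ^ (k * (2 * d)) with hθ
  have hθ0 : 0 < θ := pow_pos (by linarith) _
  set z : ℕ → ℝ := fun n => μ.real {ω | (touch m n ω).Nonempty} with hz
  obtain ⟨n, hnN, hn⟩ : ∃ n ≥ max m N, z n - z (n + 1) ≤ θ * (η / 2) := by
    by_contra! hcon
    have key : ∀ t : ℕ, z (max m N + t) ≤ 1 - t * (θ * (η / 2)) := by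
      intro t
      induction t with
      | zero => simpa using measureReal_le_one
      | succ t ih =>
        have := hcon (max m N + t) (by omega)
        rw [← add_assoc]
        push_cast
        linarith
    obtain ⟨t, ht⟩ := exists_nat_gt (1 / (θ * (η / 2)))
    have h1 := key t
    have h2 : 0 ≤ z (max m N + t) := measureReal_nonneg
    rw [div_lt_iff₀ (by positivity)] at ht
    linarith
  refine ⟨n, by omega, by omega, ?_⟩
  have h1 := (touch_drop (k := k) (show m ≤ n by omega) p).trans hn
  have h2 : μ.real {ω | (touch m n ω).Nonempty ∧ (touch m n ω).ncard < k} ≤ η / 2 :=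
    le_of_mul_le_mul_left h1 hθ0
  have h3 : μ.real {ω | (touch m n ω).Nonempty}ᶜ ≤ η / 2 := by
    rw [probReal_compl_eq_one_sub (measurableSet_touch Set.Nonempty)]
    linarith [hm n (by omega)]
  calc μ.real {ω | (touch m n ω).ncard < k} ≤ μ.real
        ({ω | (touch m n ω).Nonempty ∧ (touch m n ω).ncard < k} ∪
          {ω | (touch m n ω).Nonempty}ᶜ) := by
        refine measureReal_mono fun ω hω => ?_
        by_cases h : (touch m n ω).Nonempty
        · exact Or.inl ⟨h, hω⟩
        · exact Or.inr h
    _ ≤ _ := measureReal_union_le _ _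
    _ ≤ η := by linarith

/-! ### Contacts in a quadrant of a face -/

/-- A quadrant of the face of the box in direction `o`. -/
def quad {d : ℕ} (o : Fin d) (n : ℕ) : Set (Zd d) := {y | y o = n ∧ ∀ j, 0 ≤ y j ∧ y j ≤ n}

theorem quad_subset_box {d : ℕ} (o : Fin d) (n : ℕ) : quad o n ⊆ box d n := fun y hy j => by
  have := hy.2 j
  rw [abs_le]
  omega

theorem quad_finite {d : ℕ} (o : Fin d) (n : ℕ) : (quad o n).Finite :=
  (box_finite d n).subset (quad_subset_box o n)

theorem abs_sgm_zero {d : ℕ} (π : Equiv.Perm (Fin d)) (ε : Fin d → ℤˣ) (x : Zd d) (j : Fin d) :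
    |sgm 0 π ε x j| = |x (π j)| := by
  simp only [sgm, Pi.zero_apply, zero_add]
  exact abs_units_mul _ _

theorem sgm_zero_mem_box {d n : ℕ} {π : Equiv.Perm (Fin d)} {ε : Fin d → ℤˣ} {x : Zd d} :
    sgm 0 π ε x ∈ box d n ↔ x ∈ box d n := by
  have h := abs_sgm_zero π ε x
  refine ⟨fun hx j => ?_, fun hx j => by rw [h]; exact hx _⟩
  have := hx (π.symm j)
  rwa [h, Equiv.apply_symm_apply] at this

theorem sgm_surjective {d : ℕ} (a : Zd d) (π : Equiv.Perm (Fin d)) (ε : Fin d → ℤˣ) :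
    Function.Surjective (sgm a π ε) := by
  intro y
  refine ⟨fun j => ε (π.symm j) * (y (π.symm j) - a (π.symm j)), funext fun j => ?_⟩
  simp only [sgm, Equiv.symm_apply_apply, ← mul_assoc]
  rcases Int.units_eq_one_or (ε j) with h | h <;> simp [h]

theorem mem_touch_pull {d m n : ℕ} {π : Equiv.Perm (Fin d)} {ε : Fin d → ℤˣ} {ω : Config d}
    {x : Zd d} : x ∈ touch m n (pull (sgm 0 π ε) ω) ↔ sgm 0 π ε x ∈ touch m n ω := by
  have hshell : x ∈ shell d n ↔ sgm 0 π ε x ∈ shell d n := by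
    have h := abs_sgm_zero π ε x
    unfold shell
    rw [Set.mem_ofPred_eq, Set.mem_ofPred_eq, sgm_zero_mem_box]
    refine and_congr_right fun _ => ⟨fun ⟨i, hi⟩ => ⟨π.symm i, ?_⟩, fun ⟨i, hi⟩ => ⟨π i, ?_⟩⟩
    · rw [h, Equiv.apply_symm_apply, hi]
    · rw [← h, hi]
  have hrel : ∀ a b, onSet (openAdj (pull (sgm 0 π ε) ω)) (box d n) a b ↔
      onSet (openAdj ω) (box d n) (sgm 0 π ε a) (sgm 0 π ε b) := fun a b => by
    unfold onSet
    rw [openAdj_pull, sgm_zero_mem_box, sgm_zero_mem_box]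
  unfold touch
  rw [Set.mem_ofPred_eq, Set.mem_ofPred_eq, hshell]
  refine and_congr_right fun _ => ⟨?_, ?_⟩
  · rintro ⟨y, hy, h⟩
    exact ⟨sgm 0 π ε y, sgm_zero_mem_box.2 hy, h.lift _ fun a b hab => (hrel a b).1 hab⟩
  · rintro ⟨y, hy, h⟩
    obtain ⟨y, rfl⟩ := sgm_surjective 0 π ε y
    refine ⟨y, sgm_zero_mem_box.1 hy, ?_⟩
    set inv := Function.surjInv (sgm_surjective (0 : Zd d) π ε) with hinv
    have hl : ∀ z, sgm 0 π ε (inv z) = z := Function.surjInv_eq _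
    have hr : ∀ z, inv (sgm 0 π ε z) = z := fun z => sgm_injective 0 π ε (hl _)
    have : Relation.ReflTransGen (onSet (openAdj (pull (sgm 0 π ε) ω)) (box d n))
        (inv (sgm 0 π ε y)) (inv (sgm 0 π ε x)) := h.lift inv fun a b hab => by
      change onSet _ _ _ _
      rw [hrel, hl, hl]
      exact hab
    rwa [hr, hr] at this

theorem touch_antitone {d m n : ℕ} {ω ω' : Config d} (h : ω ≤ ω') :
    touch m n ω ⊆ touch m n ω' := fun x hx => ⟨hx.1, hx.2.imp fun y hy => ⟨hy.1,
  Relation.ReflTransGen.mono (fun a b hab => ⟨⟨hab.1.1, by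
    have := h s(a, b)
    rw [hab.1.2] at this
    exact top_le_iff.1 this⟩, hab.2⟩) _ _ hy.2⟩⟩

theorem exists_many_touch_quad {d : ℕ} (o : Fin d) {p : unitInterval} (hp : pc d < p)
    (hp1 : (p : ℝ) < 1) {η : ℝ} (hη : 0 < η) : ∃ m, ∀ k : ℕ, ∃ n > m,
      (bern fun _ : Sym2 (Zd d) => p).real {ω | (touch m n ω ∩ quad o n).ncard < k} ≤ η := by
  classical
  set J : ℕ := (Finset.univ : Finset (Fin d × (Fin d → ℤˣ))).card with hJ
  have hJ0 : J ≠ 0 := by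
    rw [hJ, ← Nat.pos_iff_ne_zero, Finset.card_pos]
    exact ⟨(o, fun _ => 1), Finset.mem_univ _⟩
  obtain ⟨m, hm⟩ := exists_many_touch (d := d) hp hp1 (pow_pos hη J)
  refine ⟨m, fun k => ?_⟩
  obtain ⟨n, hn, hmn, hP⟩ := hm (k * J) (m + 1)
  refine ⟨n, by omega, ?_⟩
  set μ := bern fun _ : Sym2 (Zd d) => p with hμ
  let τ : Fin d × (Fin d → ℤˣ) → Zd d → Zd d := fun κ => sgm 0 (Equiv.swap o κ.1) κ.2
  let A₀ : Set (Config d) := {ω | (touch m n ω ∩ quad o n).ncard < k}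
  let A : Fin d × (Fin d → ℤˣ) → Set (Config d) := fun κ => pull (τ κ) ⁻¹' A₀
  have hA : ∀ κ, A κ = {ω | (touch m n ω ∩ τ κ '' quad o n).ncard < k} := by
    intro κ
    ext ω
    simp only [A, A₀, Set.mem_preimage, Set.mem_ofPred_eq]
    rw [← Set.ncard_image_of_injective _ (sgm_injective 0 (Equiv.swap o κ.1) κ.2)]
    have : sgm 0 (Equiv.swap o κ.1) κ.2 '' (touch m n (pull (τ κ) ω) ∩ quad o n) =
        touch m n ω ∩ τ κ '' quad o n := by
      ext x
      constructor
      · rintro ⟨y, ⟨h1, h2⟩, rfl⟩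
        exact ⟨mem_touch_pull.1 h1, y, h2, rfl⟩
      · rintro ⟨h1, y, h2, rfl⟩
        exact ⟨y, ⟨mem_touch_pull.2 h1, h2⟩, rfl⟩
    rw [this]
  have dA : ∀ κ, DepOn ((edgesIn_finite (box_finite d n)).toFinset : Set (Sym2 (Zd d))) (A κ) := by
    intro κ
    rw [hA, Set.Finite.coe_toFinset]
    exact depOn_touch fun t => (t ∩ τ κ '' quad o n).ncard < k
  have hH := harris_prod_le (fun _ : Sym2 (Zd d) => p) _ Finset.univ A dA fun κ ω ω' h hω => by
    rw [hA] at hω ⊢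
    refine (Set.ncard_le_ncard ?_ ((touch_finite m n ω').subset Set.inter_subset_left)).trans_lt hω
    exact Set.inter_subset_inter_left _ (touch_antitone h)
  have mA₀ : MeasurableSet A₀ := measurableSet_touch fun t => (t ∩ quad o n).ncard < k
  have heq : ∀ κ, μ.real (A κ) = μ.real A₀ := fun κ => bern_pull p _ _ _ mA₀
  rw [Finset.prod_congr rfl fun κ _ => heq κ, Finset.prod_const] at hH
  have hcover : (⋂ κ ∈ (Finset.univ : Finset (Fin d × (Fin d → ℤˣ))), A κ) ⊆
      {ω | (touch m n ω).ncard < k * J} := by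
    intro ω hω
    rw [Set.mem_iInter₂] at hω
    have h1 : touch m n ω ⊆ ⋃ κ ∈ (Finset.univ : Finset (Fin d × (Fin d → ℤˣ))),
        touch m n ω ∩ τ κ '' quad o n := by
      intro x hx
      obtain ⟨i, hi⟩ := hx.1.2
      have hs : ∀ j, ∃ s : ℤˣ, x j = s * |x j| := fun j => by
        rcases abs_choice (x j) with h | h
        · exact ⟨1, by simp [h]⟩
        · exact ⟨-1, by simp [h]⟩
      choose s hs using hs
      refine Set.mem_iUnion₂.2 ⟨(i, s), Finset.mem_univ _, hx,
        fun j => |x (Equiv.swap o i j)|, ⟨?_, fun j => ⟨abs_nonneg _, hx.1.1 _⟩⟩, ?_⟩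
      · simpa using hi
      · funext j
        simp only [τ, sgm, Pi.zero_apply, zero_add, Equiv.swap_apply_self]
        exact (hs j).symm
    have hfin : ∀ κ, (touch m n ω ∩ τ κ '' quad o n).Finite := fun κ =>
      (touch_finite m n ω).subset Set.inter_subset_left
    have h2 : ∀ κ ∈ (Finset.univ : Finset (Fin d × (Fin d → ℤˣ))),
        (touch m n ω ∩ τ κ '' quad o n).ncard < k := fun κ hκ => by
      have := hω κ hκ
      rwa [hA] at this
    have h3 := Set.ncard_le_ncard h1 (Set.Finite.biUnion (Finset.finite_toSet _) fun κ _ => hfin κ)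
    have h4 := Finset.set_ncard_biUnion_le (Finset.univ : Finset (Fin d × (Fin d → ℤˣ)))
      fun κ => touch m n ω ∩ τ κ '' quad o n
    have h5 := Finset.sum_lt_sum_of_nonempty (s := (Finset.univ : Finset (Fin d × (Fin d → ℤˣ))))
      ⟨(o, fun _ => 1), Finset.mem_univ _⟩ h2
    rw [Finset.sum_const, smul_eq_mul, mul_comm] at h5
    exact h3.trans_lt (h4.trans_lt h5)
  have hfinal := (hH.trans (measureReal_mono hcover)).trans hP
  exact (pow_le_pow_iff_left₀ measureReal_nonneg hη.le hJ0).1 hfinal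

/-! ### Seeds -/

theorem bern_forall_not_le {ι κ : Type*} (q : ι → unitInterval) (a : Finset κ) (S : κ → Set ι)
    (hfin : ∀ k, (S k).Finite) (hS : ∀ k ∈ a, ∀ l ∈ a, k ≠ l → Disjoint (S k) (S l))
    {δ : unitInterval} (hq : ∀ k ∈ a, ∀ i ∈ S k, q i = δ) {s : ℕ}
    (hs : ∀ k ∈ a, (S k).ncard ≤ s) :
    (bern q).real {ω | ∀ k ∈ a, ¬ ∀ i ∈ S k, ω i = true} ≤ (1 - (δ : ℝ) ^ s) ^ a.card := by
  have dA : ∀ k, DepOn (S k) {ω : ι → Bool | ∀ i ∈ S k, ω i = true} :=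
    fun k ω ω' h hω i hi => (h i hi).symm.trans (hω i hi)
  have mA := fun k => (dA k).measurableSet (hfin k)
  have h1 := bern_iInter q a S (fun k => {ω : ι → Bool | ∀ i ∈ S k, ω i = true}ᶜ)
    (fun k => (dA k).compl) hS fun k => (mA k).compl
  have h2 : {ω : ι → Bool | ∀ k ∈ a, ¬ ∀ i ∈ S k, ω i = true} =
      ⋂ k ∈ a, {ω : ι → Bool | ∀ i ∈ S k, ω i = true}ᶜ := by
    ext ω
    simp
  rw [h2, h1, ← Finset.prod_const]
  refine Finset.prod_le_prod (fun _ _ => measureReal_nonneg) fun k hk => ?_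
  rw [probReal_compl_eq_one_sub (mA k)]
  have h3 := bern_cyl q (hfin k).toFinset fun _ => true
  simp only [if_true, Set.Finite.mem_toFinset] at h3
  rw [h3, Finset.prod_congr rfl fun i hi => by
    rw [hq k hk i ((hfin k).mem_toFinset.1 hi)], Finset.prod_const,
    ← Set.ncard_eq_toFinset_card _ (hfin k)]
  have := pow_le_pow_of_le_one δ.2.1 δ.2.2 (hs k hk)
  linarith

/-- The box of the seed attached to the boundary point `y` in direction `o`. -/
def seedBox {d : ℕ} (m : ℕ) (o : Fin d) (y : Zd d) : Set (Zd d) :=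
  {x | x - (y + Pi.single o ((m : ℤ) + 1)) ∈ box d m}

/-- The edges of the seed attached to `y`. -/
def seedEdges {d : ℕ} (m : ℕ) (o : Fin d) (y : Zd d) : Set (Sym2 (Zd d)) :=
  edgesIn (seedBox m o y) ∪ {s(y, y + Pi.single o 1)}

/-- The seed at `y` is fully open. -/
def seedOpen {d : ℕ} (m : ℕ) (o : Fin d) (ω : Config d) (y : Zd d) : Prop :=
  ∀ e ∈ seedEdges m o y, ω e = true

theorem seedBox_finite {d : ℕ} (m : ℕ) (o : Fin d) (y : Zd d) : (seedBox m o y).Finite :=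
  ((box_finite d m).image fun x => x + (y + Pi.single o ((m : ℤ) + 1))).subset
    fun x hx => ⟨_, hx, by simp⟩

theorem seedEdges_finite {d : ℕ} (m : ℕ) (o : Fin d) (y : Zd d) : (seedEdges m o y).Finite :=
  (edgesIn_finite (seedBox_finite m o y)).union (Set.finite_singleton _)

theorem ncard_seedEdges_le {d : ℕ} (m : ℕ) (o : Fin d) (y : Zd d) :
    (seedEdges m o y).ncard ≤ (seedEdges m o (0 : Zd d)).ncard := by
  refine (Set.ncard_le_ncard ?_ ((seedEdges_finite m o 0).image (Sym2.map (y + ·)))).trans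
    (Set.ncard_image_le (seedEdges_finite m o 0))
  rintro e (he | rfl)
  · refine ⟨Sym2.map (fun x => x - y) e, Or.inl fun x hx => ?_, ?_⟩
    · obtain ⟨z, hz, rfl⟩ := Sym2.mem_map.1 hx
      have := he z hz
      change z - y - (0 + Pi.single o ((m : ℤ) + 1)) ∈ box d m
      rwa [zero_add, sub_sub]
    · rw [Sym2.map_map]
      have : ((fun x => y + x) ∘ fun x => x - y) = (id : Zd d → Zd d) := by
        funext x
        simp
      rw [this, Sym2.map_id, id]
  · exact ⟨s(0, 0 + Pi.single o 1), Or.inr rfl, by simp [Sym2.map_mk]⟩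

theorem seedBox_apply {d m : ℕ} {o : Fin d} {x y : Zd d} (hx : x ∈ seedBox m o y) :
    y o + 1 ≤ x o ∧ x o ≤ y o + 2 * m + 1 ∧ ∀ j ≠ o, |x j - y j| ≤ m := by
  have ho := hx o
  simp only [Pi.sub_apply, Pi.add_apply, Pi.single_eq_same] at ho
  rw [abs_le] at ho
  refine ⟨by omega, by omega, fun j hj => ?_⟩
  have := hx j
  simpa only [Pi.sub_apply, Pi.add_apply, Pi.single_eq_of_ne hj, add_zero] using this

theorem disjoint_seedEdges {d m n : ℕ} {o : Fin d} {y y' : Zd d} (hy : y o = n) (hy' : y' o = n)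
    (hne : y ≠ y') (hmod : ∀ j, y j % (2 * m + 1) = y' j % (2 * m + 1)) :
    Disjoint (seedEdges m o y) (seedEdges m o y') := by
  obtain ⟨j, hj⟩ : ∃ j, y j ≠ y' j := by
    by_contra! h
    exact hne (funext h)
  have hjo : j ≠ o := by
    rintro rfl
    exact hj (hy.trans hy'.symm)
  have hfar : (2 * m + 1 : ℤ) ≤ |y j - y' j| := by
    obtain ⟨k, hk⟩ := Int.dvd_of_emod_eq_zero (Int.emod_eq_emod_iff_emod_sub_eq_zero.1 (hmod j))
    rw [hk, abs_mul, abs_of_pos (by positivity : (0 : ℤ) < 2 * m + 1)]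
    have hk0 : k ≠ 0 := by
      rintro rfl
      rw [mul_zero] at hk
      exact hj (sub_eq_zero.1 hk)
    have := Int.one_le_abs hk0
    nlinarith
  refine Set.disjoint_left.2 ?_
  rintro e (he | rfl) (he' | he')
  · induction e with
    | _ a b =>
      have h1 := (seedBox_apply (mk_mem_edgesIn.1 he).1).2.2 j hjo
      have h2 := (seedBox_apply (mk_mem_edgesIn.1 he').1).2.2 j hjo
      rw [abs_le] at h1 h2
      rcases le_abs.1 hfar with h | h <;> omega
  · rw [he'] at he
    have := (seedBox_apply (mk_mem_edgesIn.1 he).1).1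
    omega
  · have := (seedBox_apply (mk_mem_edgesIn.1 he').1).1
    omega
  · rw [Set.mem_singleton_iff, Sym2.eq_iff] at he'
    rcases he' with ⟨h, -⟩ | ⟨h, -⟩
    · exact hne h
    · have := congrFun h o
      simp only [Pi.add_apply, Pi.single_eq_same] at this
      omega

theorem exists_seeds {d : ℕ} (m : ℕ) (o : Fin d) {δ : unitInterval} (hδ : 0 < (δ : ℝ)) {η : ℝ}
    (hη : 0 < η) : ∃ k : ℕ, ∀ {ι : Type} (q : ι → unitInterval) (j : Sym2 (Zd d) → ι),
      Function.Injective j → (∀ e, q (j e) = δ) → ∀ (n : ℕ) (a : Finset (Zd d)),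
      (∀ y ∈ a, y o = n) → k ≤ a.card →
      (bern q).real {ω | ∀ y ∈ a, ¬ seedOpen m o (fun e => ω (j e)) y} ≤ η := by
  classical
  set s := (seedEdges m o (0 : Zd d)).ncard with hs
  obtain ⟨k₀, hk₀⟩ := exists_pow_lt_of_lt_one hη (y := 1 - (δ : ℝ) ^ s)
    (by linarith [pow_pos hδ s])
  refine ⟨(2 * m + 1) ^ d * k₀, fun {ι} q j hj hq n a ha hk => ?_⟩
  let f : Zd d → Zd d := fun y i => y i % (2 * m + 1)
  let t : Finset (Zd d) := Fintype.piFinset fun _ => Finset.Ico (0 : ℤ) (2 * m + 1)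
  have ht : t.card = (2 * m + 1) ^ d := by
    have : ((2 : ℤ) * m + 1).toNat = 2 * m + 1 := by omega
    simp [t, this]
  have hf : ∀ y ∈ a, f y ∈ t := fun y _ => by
    simp only [t, Fintype.mem_piFinset, Finset.mem_Ico, f]
    exact fun i => ⟨Int.emod_nonneg _ (by omega), Int.emod_lt_of_pos _ (by omega)⟩
  have htne : t.Nonempty := Finset.card_pos.1 (by rw [ht]; positivity)
  obtain ⟨r, -, hr⟩ := Finset.exists_le_card_fiber_of_mul_le_card_of_maps_to hf htne
    (by rw [ht]; exact hk)
  set b := a.filter fun y => f y = r with hb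
  have h1 := bern_forall_not_le q b (fun y => j '' seedEdges m o y)
    (fun y => (seedEdges_finite m o y).image j)
    (fun y hy y' hy' hne => by
      rw [hb, Finset.mem_filter] at hy hy'
      refine (Set.disjoint_image_iff hj).2 (disjoint_seedEdges (ha y hy.1) (ha y' hy'.1) hne ?_)
      exact fun i => congrFun (hy.2.trans hy'.2.symm) i)
    (δ := δ) (fun y _ i hi => by obtain ⟨e, -, rfl⟩ := hi; exact hq e) (s := s)
    (fun y _ => (Set.ncard_image_le (seedEdges_finite m o y)).trans (ncard_seedEdges_le m o y))
  have h2 : (1 - (δ : ℝ) ^ s) ^ b.card ≤ (1 - (δ : ℝ) ^ s) ^ k₀ :=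
    pow_le_pow_of_le_one (by linarith [pow_le_one₀ δ.2.1 δ.2.2 (n := s)])
      (by linarith [pow_pos hδ s]) hr
  refine ((measureReal_mono fun ω hω y hy hseed => ?_).trans h1).trans (h2.trans hk₀.le)
  refine hω y (Finset.mem_filter.1 hy).1 fun e he => hseed _ ⟨e, he, rfl⟩

/-- Parameters of the two independent layers. -/
def layerProb (ι : Type*) (p δ : unitInterval) : Bool × ι → unitInterval := fun i => cond i.1 p δ

/-- Some contact point in the quadrant carries an open seed. -/
def Good {d : ℕ} (m n : ℕ) (o : Fin d) : Set (Bool × Sym2 (Zd d) → Bool) :=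
  {ω | ∃ y ∈ touch m n (fun e => ω (true, e)) ∩ quad o n, seedOpen m o (fun e => ω (false, e)) y}

theorem exists_good {d : ℕ} (o : Fin d) {p δ : unitInterval} (hp : pc d < p) (hp1 : (p : ℝ) < 1)
    (hδ : 0 < (δ : ℝ)) {η : ℝ} (hη : 0 < η) : ∃ m, ∃ n > m,
      (bern (layerProb (Sym2 (Zd d)) p δ)).real (Good m n o)ᶜ ≤ η := by
  classical
  obtain ⟨m, hm⟩ := exists_many_touch_quad o hp hp1 (half_pos hη)
  obtain ⟨k, hk⟩ := exists_seeds (d := d) m o hδ (half_pos hη)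
  obtain ⟨n, hn, hP⟩ := hm k
  refine ⟨m, n, hn, ?_⟩
  set q := layerProb (Sym2 (Zd d)) p δ with hq
  have hinj : ∀ b : Bool, Function.Injective fun e : Sym2 (Zd d) => (b, e) :=
    fun b _ _ h => (Prod.ext_iff.1 h).2
  have hfin : ∀ ω : Config d, (touch m n ω ∩ quad o n).Finite := fun ω =>
    (touch_finite m n ω).subset Set.inter_subset_left
  let X : (Bool × Sym2 (Zd d) → Bool) → Finset (Zd d) := fun ω =>
    (hfin fun e => ω (true, e)).toFinset
  set S : Set (Bool × Sym2 (Zd d)) := Prod.mk true '' edgesIn (box d n) with hS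
  have hSfin : S.Finite := (edgesIn_finite (box_finite d n)).image _
  have hXc : ∀ ω ω' : Bool × Sym2 (Zd d) → Bool, (∀ i ∈ S, ω i = ω' i) → X ω = X ω' := by
    intro ω ω' h
    have := touch_congr (m := m) (ω := fun e => ω (true, e)) (ω' := fun e => ω' (true, e))
      fun e he => h _ ⟨e, he, rfl⟩
    simp only [X, this]
  set B : Set (Bool × Sym2 (Zd d) → Bool) := {ω | k ≤ (X ω).card} with hB
  have dB : ∀ a, DepOn S (B ∩ {ω | X ω = a}) := fun a =>
    (depOn_of_forall hXc (k ≤ ·.card)).inter (depOn_of_forall hXc (· = a))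
  let T : Finset (Zd d) → Set (Bool × Sym2 (Zd d)) := fun a =>
    Prod.mk false '' ⋃ y ∈ a, seedEdges m o y
  let E : Finset (Zd d) → Set (Bool × Sym2 (Zd d) → Bool) := fun a =>
    {ω | ∀ y ∈ a, ¬ seedOpen m o (fun e => ω (false, e)) y}
  have dE : ∀ a, DepOn (T a) (E a) := by
    intro a ω ω' h hω y hy hseed
    refine hω y hy fun e he => ?_
    change ω (false, e) = true
    rw [h (false, e) ⟨e, Set.mem_iUnion₂.2 ⟨y, hy, he⟩, rfl⟩]
    exact hseed e he
  have hT : ∀ a, (T a).Finite := fun a =>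
    (Set.Finite.biUnion a.finite_toSet fun y _ => seedEdges_finite m o y).image _
  have hre := bern_restart_le q X (fun _ => S) T E (fun a => (dB a).measurableSet hSfin) dB
    (fun a _ => (dE a).measurableSet (hT a)) (fun a _ => dE a)
    (fun a _ => by
      refine Set.disjoint_left.2 ?_
      rintro _ ⟨e, -, rfl⟩ ⟨e', -, h⟩
      exact Bool.noConfusion (Prod.ext_iff.1 h).1)
    (half_pos hη).le
    (fun a ha => by
      obtain ⟨ω, hω, rfl⟩ := ha
      refine hk q (Prod.mk false) (hinj false) (fun e => rfl) n _ (fun y hy => ?_) hω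
      exact ((hfin _).mem_toFinset.1 hy).2.1)
  have h1 : (bern q).real Bᶜ ≤ η / 2 := by
    have h2 := bern_preimage_comp q (hinj true)
      (measurableSet_touch (d := d) (m := m) (n := n) fun t => (t ∩ quad o n).ncard < k)
    have h3 : Bᶜ = (fun ω e => ω (true, e)) ⁻¹'
        {ω : Config d | (touch m n ω ∩ quad o n).ncard < k} := by
      ext ω
      simp only [hB, X, Set.mem_compl_iff, Set.mem_ofPred_eq, not_le, Set.mem_preimage,
        Set.ncard_eq_toFinset_card _ (hfin _)]
    rw [h3, h2]
    exact hP
  have h4 : (Good m n o)ᶜ ⊆ Bᶜ ∪ (B ∩ {ω | ω ∈ E (X ω)}) := by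
    intro ω hω
    by_cases hωB : ω ∈ B
    · exact Or.inr ⟨hωB, fun y hy hseed => hω ⟨y, (hfin _).mem_toFinset.1 hy, hseed⟩⟩
    · exact Or.inl hωB
  have h5 : η / 2 * (bern q).real B ≤ η / 2 :=
    mul_le_of_le_one_right (half_pos hη).le measureReal_le_one
  calc (bern q).real (Good m n o)ᶜ ≤ _ := measureReal_mono h4
    _ ≤ _ := measureReal_union_le _ _
    _ ≤ η := by linarith

/-! ### Sprinkling -/

theorem bern_forall_false {ι : Type*} {q : ι → unitInterval} {s : Finset ι} {r : unitInterval}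
    (hq : ∀ i ∈ s, q i = r) :
    (bern q).real {ω | ∀ i ∈ s, ω i = false} = (1 - (r : ℝ)) ^ s.card := by
  have h1 := bern_cyl q s fun _ => false
  simp only [Bool.false_eq_true, if_false] at h1
  rw [h1, Finset.prod_congr rfl fun i hi => by rw [hq i hi], Finset.prod_const]

/-- The vertices of the box outside `A` reached from `A` by a sprinkled edge followed by a path
of the base layer outside `A`. -/
def growth {d : ℕ} (n : ℕ) (A : Set (Zd d)) (ω : Bool × Sym2 (Zd d) → Bool) : Set (Zd d) :=
  {v | ∃ u v₀, u ∈ A ∧ u ∈ box d n ∧ v₀ ∈ box d n \ A ∧ latAdj u v₀ ∧ ω (false, s(u, v₀)) = true ∧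
    Relation.ReflTransGen (onSet (openAdj fun e => ω (true, e)) (box d n \ A)) v₀ v}

/-- The points of the quadrant, known to be connected to `A`, that carry an open seed. -/
def seedPts {d : ℕ} (m n : ℕ) (o : Fin d) (A : Set (Zd d)) (ω : Bool × Sym2 (Zd d) → Bool) :
    Set (Zd d) :=
  {y | y ∈ quad o n ∧ (y ∈ A ∨ y ∈ growth n A ω) ∧ seedOpen m o (fun e => ω (false, e)) y}

theorem growth_subset {d n : ℕ} {A : Set (Zd d)} {ω : Bool × Sym2 (Zd d) → Bool} :
    growth n A ω ⊆ box d n \ A := by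
  rintro v ⟨u, v₀, -, -, h, -, -, hr⟩
  exact reflTransGen_onSet_mem h hr

theorem not_mem_edgesIn_of_seedEdges {d m n : ℕ} {o : Fin d} {y : Zd d} (hy : y ∈ quad o n)
    {e : Sym2 (Zd d)} (he : e ∈ seedEdges m o y) : e ∉ edgesIn (box d n) := by
  have key : ∃ x ∈ e, (n : ℤ) + 1 ≤ x o := by
    rcases he with he | rfl
    · induction e with
      | _ a b =>
        have := (seedBox_apply (mk_mem_edgesIn.1 he).1).1
        rw [hy.1] at this
        exact ⟨a, Sym2.mem_mk_left _ _, this⟩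
    · refine ⟨_, Sym2.mem_mk_right _ _, ?_⟩
      simp [hy.1]
  obtain ⟨x, hx, hxo⟩ := key
  intro h
  have := h x hx o
  rw [abs_le] at this
  omega

section Sprinkle

variable {d : ℕ} (m n : ℕ) (o : Fin d) (A : Set (Zd d))

/-- Edges leaving `A` whose opening connects `A` to an open seed. -/
def pivots (ω : Bool × Sym2 (Zd d) → Bool) : Set (Sym2 (Zd d)) :=
  {e | ∃ u v₀ y, e = s(u, v₀) ∧ u ∈ A ∧ u ∈ box d n ∧ v₀ ∈ box d n \ A ∧ latAdj u v₀ ∧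
    y ∈ quad o n ∧ seedOpen m o (fun e => ω (false, e)) y ∧
    Relation.ReflTransGen (onSet (openAdj fun e => ω (true, e)) (box d n \ A)) v₀ y}

/-- No point of the quadrant in `A` carries an open seed. -/
def noSeed : Set (Bool × Sym2 (Zd d) → Bool) :=
  {ω | ∀ y ∈ quad o n, y ∈ A → ¬ seedOpen m o (fun e => ω (false, e)) y}

/-- The coordinates determining `pivots` and `noSeed`. -/
def pivotCoord : Set (Bool × Sym2 (Zd d)) :=
  Prod.mk true '' edgesIn (box d n \ A) ∪ Prod.mk false '' ⋃ y ∈ quad o n, seedEdges m o y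

theorem pivotCoord_finite : (pivotCoord m n o A).Finite :=
  ((edgesIn_finite ((box_finite d n).subset Set.sdiff_subset)).image _).union
    (((quad_finite o n).biUnion fun y _ => seedEdges_finite m o y).image _)

variable {m n o A}

theorem seedOpen_congr {ω ω' : Bool × Sym2 (Zd d) → Bool}
    (h : ∀ i ∈ pivotCoord m n o A, ω i = ω' i) {y : Zd d} (hy : y ∈ quad o n) :
    seedOpen m o (fun e => ω (false, e)) y ↔ seedOpen m o (fun e => ω' (false, e)) y := by
  refine forall₂_congr fun e he => ?_
  have : ω (false, e) = ω' (false, e) := h _ (Or.inr ⟨e, Set.mem_iUnion₂.2 ⟨y, hy, he⟩, rfl⟩)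
  simp only [this]

theorem pivots_congr {ω ω' : Bool × Sym2 (Zd d) → Bool}
    (h : ∀ i ∈ pivotCoord m n o A, ω i = ω' i) : pivots m n o A ω = pivots m n o A ω' := by
  have h1 := onSet_openAdj_congr (U := box d n \ A) (ω := fun e => ω (true, e))
    (ω' := fun e => ω' (true, e)) fun e he => h _ (Or.inl ⟨e, he, rfl⟩)
  ext e
  unfold pivots
  simp only [Set.mem_ofPred_eq, h1]
  refine exists_congr fun u => exists_congr fun v₀ => exists_congr fun y => ?_
  constructor
  · rintro ⟨a1, a2, a3, a4, a5, a6, a7, a8⟩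
    exact ⟨a1, a2, a3, a4, a5, a6, (seedOpen_congr h a6).1 a7, a8⟩
  · rintro ⟨a1, a2, a3, a4, a5, a6, a7, a8⟩
    exact ⟨a1, a2, a3, a4, a5, a6, (seedOpen_congr h a6).2 a7, a8⟩

theorem depOn_noSeed : DepOn (pivotCoord m n o A) (noSeed m n o A) :=
  fun _ _ h hω y hy hyA hs => hω y hy hyA ((seedOpen_congr h hy).2 hs)

theorem pivots_subset {ω : Bool × Sym2 (Zd d) → Bool} :
    pivots m n o A ω ⊆ edgesIn (box d n) \ edgesIn (box d n \ A) := by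
  rintro _ ⟨u, v₀, y, rfl, hu, hun, hv, -⟩
  exact ⟨mk_mem_edgesIn.2 ⟨hun, hv.1⟩, fun h => (mk_mem_edgesIn.1 h).1.2 hu⟩

theorem pivots_finite (ω : Bool × Sym2 (Zd d) → Bool) : (pivots m n o A ω).Finite :=
  (edgesIn_finite (box_finite d n)).subset fun _ h => (pivots_subset h).1

theorem noSeed_of_seedPts_eq_empty {ω : Bool × Sym2 (Zd d) → Bool}
    (h : seedPts m n o A ω = ∅) :
    ω ∈ noSeed m n o A ∧ ∀ e ∈ pivots m n o A ω, ω (false, e) = false := by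
  refine ⟨fun y hy hyA hs => (h ▸ (⟨hy, Or.inl hyA, hs⟩ : y ∈ seedPts m n o A ω) : y ∈ (∅ : Set _)),
    ?_⟩
  rintro _ ⟨u, v₀, y, rfl, h1, h2, h3, h4, h5, h6, h7⟩
  by_contra hne
  have hy : y ∈ seedPts m n o A ω :=
    ⟨h5, Or.inr ⟨u, v₀, h1, h2, h3, h4, by simpa using hne, h7⟩, h6⟩
  rw [h] at hy
  exact hy

theorem not_good_of_noSeed (hA : box d m ⊆ A) {ω : Bool × Sym2 (Zd d) → Bool}
    (h : ω ∈ noSeed m n o A) (hcl : ∀ e ∈ pivots m n o A ω, ω (true, e) = false) :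
    ω ∈ (Good m n o)ᶜ := by
  rintro ⟨y, ⟨⟨-, x, hx, hxy⟩, hyq⟩, hs⟩
  by_cases hyA : y ∈ A
  · exact h y hyq hyA hs
  · obtain ⟨u, v, huv, hu, hv, hvy⟩ := exists_last_exit hxy (hA hx) hyA
    have hmem : s(u, v) ∈ pivots m n o A ω := by
      refine ⟨u, v, y, rfl, hu, huv.2.1, ⟨huv.2.2, hv⟩, huv.1.1, hyq, hs, ?_⟩
      refine Relation.ReflTransGen.mono (fun a b hab => ?_) _ _ hvy
      exact ⟨hab.1.1, ⟨hab.1.2.1, hab.2.1⟩, ⟨hab.1.2.2, hab.2.2⟩⟩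
    have h1 := hcl _ hmem
    have h2 : ω (true, s(u, v)) = true := huv.1.2
    rw [h1] at h2
    exact Bool.noConfusion h2

theorem sprinkle (hA : box d m ⊆ A) {p δ : unitInterval} (hp1 : (p : ℝ) < 1) {η : ℝ}
    (hη : (bern (layerProb (Sym2 (Zd d)) p δ)).real (Good m n o)ᶜ ≤ η) (t : ℕ) :
    (bern (layerProb (Sym2 (Zd d)) p δ)).real {ω | seedPts m n o A ω = ∅} ≤
      η / (1 - (p : ℝ)) ^ t + (1 - (δ : ℝ)) ^ t := by
  classical
  set q := layerProb (Sym2 (Zd d)) p δ with hq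
  let X : (Bool × Sym2 (Zd d) → Bool) → Finset (Sym2 (Zd d)) := fun ω =>
    (pivots_finite (m := m) (n := n) (o := o) (A := A) ω).toFinset
  have hX : ∀ ω e, e ∈ X ω ↔ e ∈ pivots m n o A ω := fun ω e => Set.Finite.mem_toFinset _
  have hXc : ∀ ω ω' : Bool × Sym2 (Zd d) → Bool, (∀ i ∈ pivotCoord m n o A, ω i = ω' i) →
      X ω = X ω' := by
    intro ω ω' h
    simp only [X, pivots_congr h]
  have dBX : ∀ (P : Finset (Sym2 (Zd d)) → Prop) a, DepOn (pivotCoord m n o A)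
      (noSeed m n o A ∩ {ω | P (X ω)} ∩ {ω | X ω = a}) := fun P a =>
    (depOn_noSeed.inter (depOn_of_forall hXc P)).inter (depOn_of_forall hXc (· = a))
  have mBX : ∀ (P : Finset (Sym2 (Zd d)) → Prop) a, MeasurableSet
      (noSeed m n o A ∩ {ω | P (X ω)} ∩ {ω | X ω = a}) := fun P a =>
    (dBX P a).measurableSet (pivotCoord_finite m n o A)
  let T : Bool → Finset (Sym2 (Zd d)) → Finset (Bool × Sym2 (Zd d)) := fun b a =>
    a.image (Prod.mk b)
  let E : Bool → Finset (Sym2 (Zd d)) → Set (Bool × Sym2 (Zd d) → Bool) := fun b a =>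
    {ω | ∀ i ∈ T b a, ω i = false}
  have dE : ∀ b a, DepOn (T b a : Set _) (E b a) :=
    fun b a ω ω' h hω i hi => (h i hi).symm.trans (hω i hi)
  have mE : ∀ b a, MeasurableSet (E b a) := fun b a =>
    (dE b a).measurableSet (Finset.finite_toSet _)
  have pE : ∀ b a, (bern q).real (E b a) = (1 - ((cond b p δ : unitInterval) : ℝ)) ^ a.card := by
    intro b a
    rw [← Finset.card_image_of_injective a (fun _ _ h => (Prod.ext_iff.1 h).2 :
      Function.Injective (Prod.mk b : Sym2 (Zd d) → _))]
    refine bern_forall_false fun i hi => ?_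
    obtain ⟨e, -, rfl⟩ := Finset.mem_image.1 hi
    rfl
  have hdisj : ∀ b ω, Disjoint (pivotCoord m n o A) (T b (X ω)) := by
    intro b ω
    refine Set.disjoint_left.2 fun i hi hi' => ?_
    obtain ⟨e, he, rfl⟩ := Finset.mem_image.1 (Finset.mem_coe.1 hi')
    have he' := pivots_subset ((hX ω e).1 he)
    rcases hi with ⟨e', h1, h2⟩ | ⟨e', h1, h2⟩
    · obtain rfl : e' = e := (Prod.ext_iff.1 h2).2
      exact he'.2 h1
    · obtain rfl : e' = e := (Prod.ext_iff.1 h2).2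
      obtain ⟨y, hy, h1⟩ := Set.mem_iUnion₂.1 h1
      exact not_mem_edgesIn_of_seedEdges hy h1 he'.1
  have hE : ∀ b ω, ω ∈ E b (X ω) ↔ ∀ e ∈ pivots m n o A ω, ω (b, e) = false := by
    intro b ω
    simp [E, T, hX]
  have hp0 : (0 : ℝ) ≤ 1 - p := by linarith
  have hδ0 : (0 : ℝ) ≤ 1 - δ := by linarith [δ.2.2]
  have h1 := bern_restart_ge q X (B := noSeed m n o A ∩ {ω | (X ω).card < t})
    (fun _ => pivotCoord m n o A) (fun a => (T true a : Set _)) (E true) (mBX (·.card < t))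
    (dBX (·.card < t)) (fun a _ => mE true a) (fun a _ => dE true a)
    (fun a ha => by obtain ⟨ω, hω, rfl⟩ := ha; exact hdisj true ω)
    (pow_nonneg hp0 t) (fun a ha => by
      obtain ⟨ω, hω, rfl⟩ := ha
      rw [pE]
      exact pow_le_pow_of_le_one hp0 (by change 1 - (p : ℝ) ≤ 1; linarith [p.2.1]) hω.2.le)
  have h2 := bern_restart_le q X (B := noSeed m n o A ∩ {ω | t ≤ (X ω).card})
    (fun _ => pivotCoord m n o A) (fun a => (T false a : Set _)) (E false) (mBX (t ≤ ·.card))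
    (dBX (t ≤ ·.card)) (fun a _ => mE false a) (fun a _ => dE false a)
    (fun a ha => by obtain ⟨ω, hω, rfl⟩ := ha; exact hdisj false ω)
    (pow_nonneg hδ0 t) (fun a ha => by
      obtain ⟨ω, hω, rfl⟩ := ha
      rw [pE]
      exact pow_le_pow_of_le_one hδ0 (by change 1 - (δ : ℝ) ≤ 1; linarith [δ.2.1]) hω.2)
  have h3 : (bern q).real (noSeed m n o A ∩ {ω | (X ω).card < t}) ≤ η / (1 - (p : ℝ)) ^ t := by
    rw [le_div_iff₀ (pow_pos (by linarith) t), mul_comm]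
    refine h1.trans ((measureReal_mono fun ω hω => ?_).trans hη)
    exact not_good_of_noSeed hA hω.1.1 ((hE true ω).1 hω.2)
  have h4 := h2.trans (mul_le_of_le_one_right (pow_nonneg hδ0 t) measureReal_le_one)
  have h5 : {ω | seedPts m n o A ω = ∅} ⊆ (noSeed m n o A ∩ {ω | (X ω).card < t}) ∪
      (noSeed m n o A ∩ {ω | t ≤ (X ω).card} ∩ {ω | ω ∈ E false (X ω)}) := by
    intro ω hω
    obtain ⟨h6, h7⟩ := noSeed_of_seedPts_eq_empty hω
    rcases lt_or_ge (X ω).card t with h | h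
    · exact Or.inl ⟨h6, h⟩
    · exact Or.inr ⟨⟨h6, h⟩, (hE false ω).2 h7⟩
  exact (measureReal_mono h5).trans ((measureReal_union_le _ _).trans (add_le_add h3 h4))

end Sprinkle

/-- With a suitable choice of scales, a trial fails with small probability, whatever has been
explored before. -/
theorem exists_trial {d : ℕ} (o : Fin d) {p δ : unitInterval} (hp : pc d < p)
    (hp1 : (p : ℝ) < 1) (hδ : 0 < (δ : ℝ)) {ε : ℝ} (hε : 0 < ε) : ∃ m, ∃ n > m,
      ∀ A : Set (Zd d), box d m ⊆ A →
        (bern (layerProb (Sym2 (Zd d)) p δ)).real {ω | seedPts m n o A ω = ∅} ≤ ε := by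
  obtain ⟨t, ht⟩ := exists_pow_lt_of_lt_one (half_pos hε) (y := 1 - (δ : ℝ)) (by linarith)
  have hpt : 0 < (1 - (p : ℝ)) ^ t := pow_pos (by linarith) t
  obtain ⟨m, n, hn, h⟩ := exists_good o hp hp1 hδ (mul_pos (half_pos hε) hpt)
  refine ⟨m, n, hn, fun A hA => (sprinkle hA hp1 h t).trans ?_⟩
  rw [mul_div_cancel_right₀ _ hpt.ne']
  linarith

/-! ### Sequential tests -/

section Tests

variable {V : Type*} [DecidableEq V]

/-- Conditional bound, given the sets `F` and `A` of failed and successful sites, for the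
probability that all the sites of `T` eventually fail. -/
noncomputable def failWt (ε : ℝ≥0∞) (T F A : Finset V) : ℝ≥0∞ :=
  if Disjoint T A then ε ^ (T \ F).card else 0

theorem failWt_insert_of_notMem {ε : ℝ≥0∞} {T F A : Finset V} {z : V} (hz : z ∉ T) :
    failWt ε T (insert z F) A = failWt ε T F A ∧ failWt ε T F (insert z A) = failWt ε T F A := by
  simp [failWt, Finset.sdiff_insert_of_notMem hz, Finset.disjoint_insert_right, hz]

theorem failWt_eq_mul {ε : ℝ≥0∞} {T F A : Finset V} {z : V} (hz : z ∈ T) (hF : z ∉ F) :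
    failWt ε T F A = ε * failWt ε T (insert z F) A := by
  unfold failWt
  split_ifs
  · rw [← pow_succ', Finset.sdiff_insert, Finset.card_erase_add_one]
    exact Finset.mem_sdiff.2 ⟨hz, hF⟩
  · simp

theorem failWt_insert_success {ε : ℝ≥0∞} {T F A : Finset V} {z : V} (hz : z ∈ T) :
    failWt ε T F (insert z A) = 0 :=
  if_neg fun h => Finset.disjoint_left.1 h hz (Finset.mem_insert_self z A)

theorem lintegral_failWt_le {Ω α : Type*} [MeasurableSpace Ω] [Countable α] (μ : Measure Ω)
    {I : Set Ω} {S S' : Ω → α} (hS : ∀ a, MeasurableSet (I ∩ {ω | S ω = a}))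
    (fl ac : α → Finset V) (ε : ℝ≥0∞) (z : V)
    (h : ∀ a, (∀ ω, S ω = a → S' ω = a) ∨ z ∉ fl a ∧ ∃ E : Set Ω, MeasurableSet E ∧
      μ (I ∩ {ω | S ω = a} ∩ E) ≤ ε * μ (I ∩ {ω | S ω = a}) ∧
      (∀ ω ∈ E, S ω = a → fl (S' ω) = insert z (fl a) ∧ ac (S' ω) = ac a) ∧
      ∀ ω ∉ E, S ω = a → fl (S' ω) = fl a ∧ ac (S' ω) = insert z (ac a)) (T : Finset V) :
    ∫⁻ ω in I, failWt ε T (fl (S' ω)) (ac (S' ω)) ∂μ ≤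
      ∫⁻ ω in I, failWt ε T (fl (S ω)) (ac (S ω)) ∂μ := by
  have hI : I = ⋃ a, I ∩ {ω | S ω = a} := by
    ext ω
    simp
  have hd : Pairwise (Function.onFun Disjoint fun a => I ∩ {ω | S ω = a}) := by
    intro a b hab
    refine Set.disjoint_left.2 fun ω h1 h2 => hab (h1.2.symm.trans h2.2)
  rw [hI, lintegral_iUnion hS hd, lintegral_iUnion hS hd]
  refine ENNReal.tsum_le_tsum fun a => ?_
  have hR : ∫⁻ ω in I ∩ {ω | S ω = a}, failWt ε T (fl (S ω)) (ac (S ω)) ∂μ =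
      failWt ε T (fl a) (ac a) * μ (I ∩ {ω | S ω = a}) := by
    rw [← setLIntegral_const]
    refine setLIntegral_congr_fun (hS a) fun ω hω => ?_
    have : S ω = a := hω.2
    simp only [this]
  rw [hR]
  rcases h a with h | ⟨hz, E, mE, hE, h1, h2⟩
  · rw [← setLIntegral_const]
    refine setLIntegral_mono' (hS a) fun ω hω => ?_
    rw [h ω hω.2]
  · by_cases hT : z ∈ T
    · rw [failWt_eq_mul hT hz, mul_right_comm, mul_comm]
      calc ∫⁻ ω in I ∩ {ω | S ω = a}, failWt ε T (fl (S' ω)) (ac (S' ω)) ∂μ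
          ≤ ∫⁻ ω in I ∩ {ω | S ω = a},
              E.indicator (fun _ => failWt ε T (insert z (fl a)) (ac a)) ω ∂μ := by
            refine setLIntegral_mono' (hS a) fun ω hω => ?_
            by_cases hωE : ω ∈ E
            · rw [Set.indicator_of_mem hωE, (h1 ω hωE hω.2).1, (h1 ω hωE hω.2).2]
            · rw [Set.indicator_of_notMem hωE, (h2 ω hωE hω.2).2, failWt_insert_success hT]
        _ = failWt ε T (insert z (fl a)) (ac a) * μ (I ∩ {ω | S ω = a} ∩ E) := by
            rw [lintegral_indicator_const mE, Measure.restrict_apply mE, Set.inter_comm E]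
        _ ≤ _ := by gcongr
    · rw [← setLIntegral_const]
      refine setLIntegral_mono' (hS a) fun ω hω => ?_
      by_cases hωE : ω ∈ E
      · rw [(h1 ω hωE hω.2).1, (h1 ω hωE hω.2).2, (failWt_insert_of_notMem hT).1]
      · rw [(h2 ω hωE hω.2).1, (h2 ω hωE hω.2).2, (failWt_insert_of_notMem hT).2]

end Tests

/-! ### One step of the exploration -/

theorem reflTransGen_latAdj_box {d m : ℕ} (c : Zd d) {x : Zd d} (hx : x - c ∈ box d m) :
    Relation.ReflTransGen (onSet latAdj {x | x - c ∈ box d m}) c x := by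
  induction hk : ∑ j, (x j - c j).natAbs using Nat.strong_induction_on generalizing x with
  | _ k ih =>
    by_cases hxc : x = c
    · subst hxc
      exact .refl
    · obtain ⟨j, hj⟩ := Function.ne_iff.1 hxc
      obtain ⟨s, hs, hsj⟩ : ∃ s : ℤ, (s = 1 ∨ s = -1) ∧
          (x j - s - c j).natAbs < (x j - c j).natAbs := by
        rcases lt_or_gt_of_ne hj with h | h
        · exact ⟨-1, Or.inr rfl, by omega⟩
        · exact ⟨1, Or.inl rfl, by omega⟩
      set y : Zd d := x - Pi.single j s with hy
      have hyj : y j = x j - s := by simp [hy]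
      have hyi : ∀ i ≠ j, y i = x i := fun i hi => by simp [hy, Pi.single_eq_of_ne hi]
      have hle : ∀ i, (y i - c i).natAbs ≤ (x i - c i).natAbs := by
        intro i
        by_cases hi : i = j
        · subst hi
          rw [hyj]
          exact hsj.le
        · rw [hyi i hi]
      have hyb : y - c ∈ box d m := by
        intro i
        have h1 := hx i
        have h2 := hle i
        simp only [Pi.sub_apply, Int.abs_eq_natAbs] at h1 ⊢
        omega
      refine (ih _ ?_ hyb rfl).tail ⟨?_, hyb, hx⟩
      · rw [← hk]
        refine Finset.sum_lt_sum (fun i _ => hle i) ⟨j, Finset.mem_univ j, ?_⟩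
        rw [hyj]
        exact hsj
      · have := latAdj_add_single y j hs
        rwa [hy, sub_add_cancel] at this

theorem reflTransGen_of_forall_edgesIn {d m : ℕ} {ω : Config d} {c : Zd d}
    (hω : ∀ e ∈ edgesIn {x | x - c ∈ box d m}, ω e = true) {U : Set (Zd d)}
    (hU : {x | x - c ∈ box d m} ⊆ U) {x : Zd d} (hx : x - c ∈ box d m) :
    Relation.ReflTransGen (onSet (openAdj ω) U) c x :=
  Relation.ReflTransGen.mono (fun _ _ h => ⟨⟨h.1, hω _ (mk_mem_edgesIn.2 h.2)⟩, hU h.2.1, hU h.2.2⟩)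
    _ _ (reflTransGen_latAdj_box c hx)


theorem reflTransGen_openAdj_symm {d : ℕ} {ω : Config d} {U : Set (Zd d)} {x y : Zd d}
    (h : Relation.ReflTransGen (onSet (openAdj ω) U) x y) :
    Relation.ReflTransGen (onSet (openAdj ω) U) y x := by
  induction h with
  | refl => exact .refl
  | tail _ hs ih => exact ih.head ⟨openAdj_comm.1 hs.1, hs.2.2, hs.2.1⟩

/-- What a trial adds to the explored set `A`. -/
def gain {d : ℕ} (m n : ℕ) (o : Fin d) (A : Set (Zd d)) (ω : Bool × Sym2 (Zd d) → Bool) :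
    Set (Zd d) :=
  growth n A ω ∪ ⋃ y ∈ seedPts m n o A ω, seedBox m o y

theorem seedBox_subset_box {d m n : ℕ} {o : Fin d} {y : Zd d} (hy : y ∈ quad o n) :
    seedBox m o y ⊆ box d (2 * (n + m + 1)) := by
  intro x hx j
  have h := hx j
  obtain ⟨hy1, hy2⟩ := hy
  have := hy2 j
  by_cases hj : j = o
  · subst hj
    simp only [Pi.sub_apply, Pi.add_apply, Pi.single_eq_same] at h
    rw [abs_le] at h ⊢
    push_cast
    constructor <;> omega
  · simp only [Pi.sub_apply, Pi.add_apply, Pi.single_eq_of_ne hj] at h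
    rw [abs_le] at h ⊢
    push_cast
    constructor <;> omega

theorem seedEdges_subset_edgesIn {d m n : ℕ} {o : Fin d} {y : Zd d} (hy : y ∈ quad o n) :
    seedEdges m o y ⊆ edgesIn (box d (2 * (n + m + 1))) := by
  rintro e (he | rfl)
  · exact edgesIn_mono (seedBox_subset_box hy) he
  · refine mk_mem_edgesIn.2 ⟨box_mono (by omega) (quad_subset_box o n hy), fun j => ?_⟩
    have h1 := hy.1
    have h2 := hy.2 j
    by_cases hj : j = o
    · subst hj
      simp only [Pi.add_apply, Pi.single_eq_same]
      rw [abs_le]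
      push_cast
      constructor <;> omega
    · simp only [Pi.add_apply, Pi.single_eq_of_ne hj]
      rw [abs_le]
      push_cast
      constructor <;> omega

theorem gain_subset {d m n : ℕ} {o : Fin d} {A : Set (Zd d)} {ω : Bool × Sym2 (Zd d) → Bool} :
    gain m n o A ω ⊆ box d (2 * (n + m + 1)) :=
  Set.union_subset (growth_subset.trans (Set.sdiff_subset.trans (box_mono (by omega))))
    (Set.iUnion₂_subset fun _ hy => seedBox_subset_box hy.1)

/-- The sprinkled coordinates examined by a trial. -/
def trialLayer (d m n : ℕ) : Set (Bool × Sym2 (Zd d)) :=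
  Prod.mk false '' edgesIn (box d (2 * (n + m + 1)))

theorem growth_congr {d m n : ℕ} {A : Set (Zd d)} {ω ω' : Bool × Sym2 (Zd d) → Bool}
    (h₁ : ∀ i ∈ trialLayer d m n, ω i = ω' i)
    (h₂ : ∀ e ∈ edgesIn (box d n \ A), (∃ v ∈ e, v ∈ growth n A ω) → ω (true, e) = ω' (true, e)) :
    growth n A ω = growth n A ω' := by
  have hl : ∀ u ∈ box d n, ∀ v ∈ box d n, ω (false, s(u, v)) = ω' (false, s(u, v)) :=
    fun u hu v hv => h₁ _ ⟨_, mk_mem_edgesIn.2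
      ⟨box_mono (by omega) hu, box_mono (by omega) hv⟩, rfl⟩
  ext v
  constructor
  · rintro ⟨u, v₀, hu, hun, hv₀, huv, ho, hr⟩
    refine ⟨u, v₀, hu, hun, hv₀, huv, (hl u hun v₀ hv₀.1) ▸ ho, ?_⟩
    induction hr with
    | refl => exact .refl
    | tail hr hs ih =>
      refine ih.tail ⟨⟨hs.1.1, ?_⟩, hs.2⟩
      have := h₂ _ (mk_mem_edgesIn.2 hs.2)
        ⟨_, Sym2.mem_mk_left _ _, ⟨u, v₀, hu, hun, hv₀, huv, ho, hr⟩⟩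
      exact this.symm.trans hs.1.2
  · rintro ⟨u, v₀, hu, hun, hv₀, huv, ho, hr⟩
    rw [← hl u hun v₀ hv₀.1] at ho
    refine ⟨u, v₀, hu, hun, hv₀, huv, ho, ?_⟩
    induction hr with
    | refl => exact .refl
    | tail hr hs ih =>
      refine ih.tail ⟨⟨hs.1.1, ?_⟩, hs.2⟩
      have := h₂ _ (mk_mem_edgesIn.2 hs.2)
        ⟨_, Sym2.mem_mk_left _ _, ⟨u, v₀, hu, hun, hv₀, huv, ho, ih⟩⟩
      exact this.trans hs.1.2

theorem seedPts_congr {d m n : ℕ} {o : Fin d} {A : Set (Zd d)}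
    {ω ω' : Bool × Sym2 (Zd d) → Bool}
    (h₁ : ∀ i ∈ trialLayer d m n, ω i = ω' i)
    (h₂ : ∀ e ∈ edgesIn (box d n \ A), (∃ v ∈ e, v ∈ growth n A ω) → ω (true, e) = ω' (true, e)) :
    seedPts m n o A ω = seedPts m n o A ω' := by
  ext y
  unfold seedPts
  rw [Set.mem_ofPred_eq, Set.mem_ofPred_eq, growth_congr h₁ h₂]
  refine and_congr_right fun hy => and_congr_right fun _ => forall₂_congr fun e he => ?_
  have : ω (false, e) = ω' (false, e) := h₁ _ ⟨e, seedEdges_subset_edgesIn hy he, rfl⟩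
  simp only [this]

theorem gain_congr {d m n : ℕ} {o : Fin d} {A : Set (Zd d)} {ω ω' : Bool × Sym2 (Zd d) → Bool}
    (h₁ : ∀ i ∈ trialLayer d m n, ω i = ω' i)
    (h₂ : ∀ e ∈ edgesIn (box d n \ A), (∃ v ∈ e, v ∈ growth n A ω) → ω (true, e) = ω' (true, e)) :
    gain m n o A ω = gain m n o A ω' := by
  rw [gain, gain, growth_congr h₁ h₂, seedPts_congr h₁ h₂]

/-- The coordinates on which the success of a trial depends. -/
def trialCoord {d : ℕ} (m n : ℕ) (A : Set (Zd d)) : Set (Bool × Sym2 (Zd d)) :=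
  Prod.mk true '' edgesIn (box d n \ A) ∪ trialLayer d m n

theorem trialCoord_finite {d m n : ℕ} {A : Set (Zd d)} : (trialCoord m n A).Finite :=
  ((edgesIn_finite ((box_finite d n).subset Set.sdiff_subset)).image _).union
    ((edgesIn_finite (box_finite d _)).image _)

theorem depOn_seedPts_eq_empty {d m n : ℕ} {o : Fin d} {A : Set (Zd d)} :
    DepOn (trialCoord m n A) {ω | seedPts m n o A ω = ∅} :=
  fun _ _ h hω => (seedPts_congr (fun i hi => h i (Or.inr hi))
    fun e he _ => h _ (Or.inl ⟨e, he, rfl⟩)).symm.trans hω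

/-- Everything gained is joined to `A` by a path of open edges. -/
theorem exists_reach_of_mem_gain {d m n : ℕ} {o : Fin d} {A : Set (Zd d)}
    {ω : Bool × Sym2 (Zd d) → Bool} {v : Zd d} (hv : v ∈ gain m n o A ω) :
    ∃ u ∈ A ∩ box d n, Relation.ReflTransGen
      (onSet (openAdj fun e => ω (true, e) || ω (false, e)) (box d (2 * (n + m + 1)))) u v := by
  have hgrow : ∀ v ∈ growth n A ω, ∃ u ∈ A ∩ box d n, Relation.ReflTransGen
      (onSet (openAdj fun e => ω (true, e) || ω (false, e)) (box d (2 * (n + m + 1)))) u v := by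
    rintro v ⟨u, v₀, hu, hun, hv₀, huv, ho, hr⟩
    refine ⟨u, ⟨hu, hun⟩, Relation.ReflTransGen.head
      ⟨⟨huv, by simp [ho]⟩, box_mono (by omega) hun, box_mono (by omega) hv₀.1⟩ ?_⟩
    refine Relation.ReflTransGen.mono (fun a b h => ?_) _ _ hr
    refine ⟨⟨h.1.1, ?_⟩, box_mono (by omega) h.2.1.1, box_mono (by omega) h.2.2.1⟩
    have : ω (true, s(a, b)) = true := h.1.2
    simp [this]
  rcases hv with hv | hv
  · exact hgrow v hv
  · obtain ⟨y, hy, hv⟩ := Set.mem_iUnion₂.1 hv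
    obtain ⟨u, hu, hr⟩ : ∃ u ∈ A ∩ box d n, Relation.ReflTransGen (onSet
        (openAdj fun e => ω (true, e) || ω (false, e)) (box d (2 * (n + m + 1)))) u y := by
      rcases hy.2.1 with h | h
      · exact ⟨y, ⟨h, quad_subset_box o n hy.1⟩, .refl⟩
      · exact hgrow y h
    have hopen : ∀ e ∈ seedEdges m o y, (ω (true, e) || ω (false, e)) = true := by
      intro e he
      have : ω (false, e) = true := hy.2.2 e he
      simp [this]
    have h1 := hopen _ (Or.inr rfl)
    have h2 := mk_mem_edgesIn.1 (seedEdges_subset_edgesIn hy.1 (Or.inr rfl :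
      s(y, y + Pi.single o 1) ∈ seedEdges m o y))
    refine ⟨u, hu, (hr.tail ⟨⟨latAdj_add_single _ _ (Or.inl rfl), h1⟩, h2⟩).trans ?_⟩
    have hmem : y + Pi.single o 1 ∈ seedBox m o y := by
      intro j
      by_cases hj : j = o
      · subst hj
        simp
      · simp [Pi.single_eq_of_ne hj]
    have hbox : ∀ x ∈ seedBox m o y, Relation.ReflTransGen (onSet
        (openAdj fun e => ω (true, e) || ω (false, e)) (box d (2 * (n + m + 1))))
        (y + Pi.single o ((m : ℤ) + 1)) x := fun x hx =>
      reflTransGen_of_forall_edgesIn (fun e he => hopen e (Or.inl he)) (seedBox_subset_box hy.1) hx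
    exact (reflTransGen_openAdj_symm (hbox _ hmem)).trans (hbox _ hv)

/-! ### The exploration process -/

/-- The colour of a coarse site; sites of the same colour are far apart. -/
abbrev Color (d : ℕ) := Fin d → ZMod 10

/-- The colour of the coarse site `z`. -/
def color {d : ℕ} (z : Nd d) : Color d := fun j => (z j : ZMod 10)

/-- Configurations with a base layer and one sprinkled layer for each colour. -/
abbrev Layered (d : ℕ) := Option (Color d) × Sym2 (Zd d) → Bool

/-- A signed coordinate permutation followed by a translation. -/
abbrev Frame (d : ℕ) := Zd d × Equiv.Perm (Fin d) × (Fin d → ℤˣ)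

/-- The map given by a frame. -/
def Frame.map {d : ℕ} (θ : Frame d) : Zd d → Zd d := sgm θ.1 θ.2.1 θ.2.2

/-- The explored vertices, the successful sites, and the failed sites. -/
abbrev Explored (d : ℕ) := Finset (Zd d) × Finset (Nd d) × Finset (Nd d)

/-- The region of space attached to the coarse site `z`. -/
def cell {d : ℕ} (N : ℕ) (z : Nd d) : Set (Zd d) := {x | ∀ j, |x j - N * z j| ≤ 4 * N}

theorem cell_finite {d : ℕ} (N : ℕ) (z : Nd d) : (cell N z).Finite := by
  refine ((box_finite d (4 * N)).image fun x => x + fun j => (N : ℤ) * z j).subset fun x hx => ?_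
  refine ⟨x - fun j => (N : ℤ) * z j, fun j => ?_, sub_add_cancel _ _⟩
  have := hx j
  push_cast
  exact this

theorem disjoint_cell {d N : ℕ} (hN : 0 < N) {z z' : Nd d} (hne : z ≠ z')
    (hc : color z = color z') : Disjoint (cell N z) (cell N z') := by
  refine Set.disjoint_left.2 fun x hx hx' => ?_
  obtain ⟨j, hj⟩ := Function.ne_iff.1 hne
  have h1 : (z j) ≡ (z' j) [MOD 10] := (ZMod.natCast_eq_natCast_iff _ _ _).1 (congrFun hc j)
  have h2 := abs_le.1 (hx j)
  have h3 := abs_le.1 (hx' j)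
  have h4 : (z j : ℤ) + 10 ≤ z' j ∨ (z' j : ℤ) + 10 ≤ z j := by
    unfold Nat.ModEq at h1
    omega
  have hN' : (0 : ℤ) < N := by exact_mod_cast hN
  rcases h4 with h | h <;> nlinarith

/-- The position of the local coordinates of a trial among all coordinates. -/
def place {d : ℕ} (c : Color d) (θ : Frame d) (i : Bool × Sym2 (Zd d)) :
    Option (Color d) × Sym2 (Zd d) :=
  (cond i.1 none (some c), Sym2.map θ.map i.2)

theorem place_injective {d : ℕ} (c : Color d) (θ : Frame d) : Function.Injective (place c θ) := by
  rintro ⟨b, e⟩ ⟨b', e'⟩ h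
  obtain ⟨h1, h2⟩ := Prod.ext_iff.1 h
  have h3 : e = e' := sym2_map_sgm_injective _ _ _ h2
  cases b <;> cases b' <;> simp_all [place]

/-- The configuration seen in a frame, with the layer of colour `c`. -/
def localConf {d : ℕ} (c : Color d) (θ : Frame d) (ω : Layered d) : Bool × Sym2 (Zd d) → Bool :=
  fun i => ω (place c θ i)

section Explore

variable {d : ℕ} (m n : ℕ) (o : Fin d)

/-- A trial in the frame `θ` can be used to test the coarse site `z`. -/
def Fits (R : Finset (Zd d)) (z : Nd d) (θ : Frame d) : Prop :=
  (∀ x ∈ box d m, θ.map x ∈ R) ∧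
  (∀ j, |θ.1 j - (n + m + 1 : ℕ) * z j| ≤ 2 * (n + m + 1 : ℕ)) ∧
  ∀ y ∈ quad o n, ∀ j,
    |θ.map (y + Pi.single o ((m : ℤ) + 1)) j - (n + m + 1 : ℕ) * z j| ≤ (n + m + 1 : ℕ)

/-- The site `z` is ready to be tested. -/
def Ready (z : Nd d) (σ : Explored d) : Prop :=
  z ∉ σ.2.1 ∧ z ∉ σ.2.2 ∧ ∃ θ, Fits m n o σ.1 z θ

open Classical in
/-- The outcome of the test of `z` in the frame `θ`. -/
noncomputable def advance (θ : Frame d) (z : Nd d) (σ : Explored d)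
    (η : Bool × Sym2 (Zd d) → Bool) : Explored d :=
  (σ.1 ∪ ((box_finite d (2 * (n + m + 1))).toFinset.filter
      (· ∈ gain m n o (θ.map ⁻¹' σ.1) η)).image θ.map,
    if seedPts m n o (θ.map ⁻¹' σ.1) η = ∅ then (σ.2.1, insert z σ.2.2)
    else (insert z σ.2.1, σ.2.2))

open Classical in
/-- Test `z` if it is ready. -/
noncomputable def explore (ω : Layered d) (z : Nd d) (σ : Explored d) : Explored d :=
  if h : Ready m n o z σ then
    advance m n o h.2.2.choose z σ (localConf (color z) h.2.2.choose ω)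
  else σ

/-- The exploration along a list of sites, last site first. -/
noncomputable def run (ω : Layered d) : List (Nd d) → Explored d
  | [] => ((box_finite d (4 * (n + m + 1))).toFinset, {0}, ∅)
  | z :: l => explore m n o ω z (run ω l)

variable {m n o}

theorem advance_fst (θ : Frame d) (z : Nd d) (σ : Explored d) (η : Bool × Sym2 (Zd d) → Bool) :
    ((advance m n o θ z σ η).1 : Set (Zd d)) =
      (σ.1 : Set (Zd d)) ∪ θ.map '' gain m n o (θ.map ⁻¹' σ.1) η := by
  ext x
  simp only [advance, Finset.coe_union, Finset.coe_image, Finset.coe_filter,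
    Set.Finite.mem_toFinset, Set.mem_union]
  refine or_congr Iff.rfl ⟨?_, ?_⟩
  · rintro ⟨y, hy, rfl⟩
    exact ⟨y, hy.2, rfl⟩
  · rintro ⟨y, hy, rfl⟩
    exact ⟨y, ⟨gain_subset hy, hy⟩, rfl⟩

theorem advance_snd_of_eq_empty {θ : Frame d} {z : Nd d} {σ : Explored d}
    {η : Bool × Sym2 (Zd d) → Bool} (h : seedPts m n o (θ.map ⁻¹' σ.1) η = ∅) :
    (advance m n o θ z σ η).2 = (σ.2.1, insert z σ.2.2) := by
  simp only [advance, if_pos h]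

theorem advance_snd_of_ne_empty {θ : Frame d} {z : Nd d} {σ : Explored d}
    {η : Bool × Sym2 (Zd d) → Bool} (h : seedPts m n o (θ.map ⁻¹' σ.1) η ≠ ∅) :
    (advance m n o θ z σ η).2 = (insert z σ.2.1, σ.2.2) := by
  simp only [advance, if_neg h]

theorem explore_of_not_ready {z : Nd d} {σ : Explored d} (h : ¬ Ready m n o z σ) (ω : Layered d) :
    explore m n o ω z σ = σ := dif_neg h

theorem exists_explore_eq {z : Nd d} {σ : Explored d} (h : Ready m n o z σ) :
    ∃ θ, Fits m n o σ.1 z θ ∧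
      ∀ ω, explore m n o ω z σ = advance m n o θ z σ (localConf (color z) θ ω) :=
  ⟨h.2.2.choose, h.2.2.choose_spec, fun _ => dif_pos h⟩

theorem Fits.map_mem_cell {R : Finset (Zd d)} {z : Nd d} {θ : Frame d} (h : Fits m n o R z θ)
    {x : Zd d} (hx : x ∈ box d (2 * (n + m + 1))) : θ.map x ∈ cell (n + m + 1) z := by
  intro j
  have h1 := h.2.1 j
  have h2 : |θ.map x j - θ.1 j| ≤ 2 * (n + m + 1 : ℕ) := by
    have := hx (θ.2.1 j)
    rw [← abs_units_mul (θ.2.2 j)] at this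
    simp only [Frame.map, sgm, add_sub_cancel_left]
    exact_mod_cast this
  rw [abs_le] at *
  constructor <;> linarith [h1.1, h1.2, h2.1, h2.2]

theorem subset_explore (ω : Layered d) (z : Nd d) (σ : Explored d) :
    σ.1 ⊆ (explore m n o ω z σ).1 ∧ σ.2.1 ⊆ (explore m n o ω z σ).2.1 ∧
      σ.2.2 ⊆ (explore m n o ω z σ).2.2 := by
  by_cases h : Ready m n o z σ
  · obtain ⟨θ, -, hθ⟩ := exists_explore_eq h
    rw [hθ]
    refine ⟨Finset.coe_subset.1 ?_, ?_⟩
    · rw [advance_fst]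
      exact Set.subset_union_left
    · by_cases he : seedPts m n o (θ.map ⁻¹' σ.1) (localConf (color z) θ ω) = ∅
      · rw [advance_snd_of_eq_empty he]
        exact ⟨subset_rfl, Finset.subset_insert _ _⟩
      · rw [advance_snd_of_ne_empty he]
        exact ⟨Finset.subset_insert _ _, subset_rfl⟩
  · rw [explore_of_not_ready h]
    exact ⟨subset_rfl, subset_rfl, subset_rfl⟩

theorem mem_explore_of_ready {ω : Layered d} {z : Nd d} {σ : Explored d} (h : Ready m n o z σ) :
    z ∈ (explore m n o ω z σ).2.1 ∪ (explore m n o ω z σ).2.2 := by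
  obtain ⟨θ, -, hθ⟩ := exists_explore_eq h
  rw [hθ]
  by_cases he : seedPts m n o (θ.map ⁻¹' σ.1) (localConf (color z) θ ω) = ∅
  · rw [advance_snd_of_eq_empty he]
    simp
  · rw [advance_snd_of_ne_empty he]
    simp

/-! ### Coordinates revealed by the exploration -/

variable (m n) in
/-- The coordinates revealed when the exploration is in the state `σ`. -/
def seen (σ : Explored d) : Set (Option (Color d) × Sym2 (Zd d)) :=
  {i | ∃ z ∈ σ.2.1 ∪ σ.2.2, i.2 ∈ edgesIn (cell (n + m + 1) z) ∧
    (i.1 = some (color z) ∨ i.1 = none ∧ ∃ v ∈ i.2, v ∈ σ.1)}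

theorem seen_finite (σ : Explored d) : (seen m n σ).Finite := by
  refine ((Set.finite_univ (α := Option (Color d))).prod
    ((σ.2.1 ∪ σ.2.2).finite_toSet.biUnion fun z _ =>
      edgesIn_finite (cell_finite (n + m + 1) z))).subset ?_
  rintro ⟨c, e⟩ ⟨z, hz, he, -⟩
  exact ⟨Set.mem_univ _, Set.mem_iUnion₂.2 ⟨z, hz, he⟩⟩

theorem seen_mono {σ τ : Explored d} (h1 : σ.1 ⊆ τ.1) (h2 : σ.2.1 ⊆ τ.2.1) (h3 : σ.2.2 ⊆ τ.2.2) :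
    seen m n σ ⊆ seen m n τ := by
  rintro i ⟨z, hz, he, h⟩
  refine ⟨z, Finset.union_subset_union h2 h3 hz, he, h.imp_right ?_⟩
  rintro ⟨hi, v, hv, hvσ⟩
  exact ⟨hi, v, hv, h1 hvσ⟩

theorem explore_congr {ω ω' : Layered d} {z : Nd d} {σ : Explored d}
    (h : ∀ i ∈ seen m n (explore m n o ω z σ), ω i = ω' i) :
    explore m n o ω' z σ = explore m n o ω z σ := by
  by_cases hr : Ready m n o z σ
  · have hz := mem_explore_of_ready (ω := ω) hr
    obtain ⟨θ, hf, hθ⟩ := exists_explore_eq hr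
    have hfst := advance_fst (m := m) (n := n) (o := o) θ z σ (localConf (color z) θ ω)
    rw [← hθ ω] at hfst
    have h1 : ∀ i ∈ trialLayer d m n, localConf (color z) θ ω i = localConf (color z) θ ω' i := by
      rintro _ ⟨e, he, rfl⟩
      exact h (place (color z) θ (false, e)) ⟨z, hz,
        map_edgesIn_subset (fun x hx => hf.map_mem_cell hx) ⟨e, he, rfl⟩, Or.inl rfl⟩
    have h2 : ∀ e ∈ edgesIn (box d n \ θ.map ⁻¹' σ.1),
        (∃ v ∈ e, v ∈ growth n (θ.map ⁻¹' σ.1) (localConf (color z) θ ω)) →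
        localConf (color z) θ ω (true, e) = localConf (color z) θ ω' (true, e) := by
      rintro e he ⟨v, hve, hv⟩
      refine h (place (color z) θ (true, e)) ⟨z, hz,
        map_edgesIn_subset (fun x hx => hf.map_mem_cell hx)
        ⟨e, edgesIn_mono (Set.sdiff_subset.trans (box_mono (by omega))) he, rfl⟩,
        Or.inr ⟨rfl, θ.map v, Sym2.mem_map.2 ⟨v, hve, rfl⟩, ?_⟩⟩
      rw [← Finset.mem_coe, hfst]
      exact Or.inr ⟨v, Or.inl hv, rfl⟩
    rw [hθ, hθ]
    unfold advance
    rw [gain_congr h1 h2, seedPts_congr h1 h2]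
  · rw [explore_of_not_ready hr, explore_of_not_ready hr]

theorem run_congr {ω ω' : Layered d} {l : List (Nd d)}
    (h : ∀ i ∈ seen m n (run m n o ω l), ω i = ω' i) : run m n o ω' l = run m n o ω l := by
  induction l with
  | nil => rfl
  | cons z l ih =>
    have hs := subset_explore (m := m) (n := n) (o := o) ω z (run m n o ω l)
    have h1 := ih fun i hi => h i (seen_mono hs.1 hs.2.1 hs.2.2 hi)
    change explore m n o ω' z (run m n o ω' l) = explore m n o ω z (run m n o ω l)
    rw [h1]
    exact explore_congr h

end Explore

/-! ### Probability of failure -/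

section Failure

variable {d m n : ℕ} {o : Fin d}

theorem run_start (ω : Layered d) (l : List (Nd d)) :
    box d (4 * (n + m + 1)) ⊆ (run m n o ω l).1 ∧ 0 ∈ (run m n o ω l).2.1 ∧
      Disjoint (run m n o ω l).2.1 (run m n o ω l).2.2 := by
  induction l with
  | nil => simp [run]
  | cons z l ih =>
    have hs := subset_explore (m := m) (n := n) (o := o) ω z (run m n o ω l)
    refine ⟨ih.1.trans (Finset.coe_subset.2 hs.1), hs.2.1 ih.2.1, ?_⟩
    change Disjoint (explore m n o ω z (run m n o ω l)).2.1 (explore m n o ω z (run m n o ω l)).2.2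
    by_cases h : Ready m n o z (run m n o ω l)
    · obtain ⟨θ, -, hθ⟩ := exists_explore_eq h
      rw [hθ]
      by_cases he : seedPts m n o (θ.map ⁻¹' (run m n o ω l).1) (localConf (color z) θ ω) = ∅
      · rw [advance_snd_of_eq_empty he]
        exact Finset.disjoint_insert_right.2 ⟨h.1, ih.2.2⟩
      · rw [advance_snd_of_ne_empty he]
        exact Finset.disjoint_insert_left.2 ⟨h.2.1, ih.2.2⟩
    · rw [explore_of_not_ready h]
      exact ih.2.2

variable (d m n) in
/-- All edges of the base layer are open in the initial box. -/
def startOpen : Set (Layered d) :=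
  {ω | ∀ e ∈ edgesIn (box d (4 * (n + m + 1))), ω (none, e) = true}

theorem cell_zero {N : ℕ} : cell N (0 : Nd d) = box d (4 * N) := by
  ext x
  simp [cell, box]

theorem depOn_startOpen_run (l : List (Nd d)) (σ : Explored d) :
    DepOn (seen m n σ) (startOpen d m n ∩ {ω | run m n o ω l = σ}) := by
  rintro ω ω' h ⟨h1, h2⟩
  obtain rfl : run m n o ω l = σ := h2
  have hs := run_start (m := m) (n := n) (o := o) ω l
  refine ⟨fun e he => ?_, run_congr h⟩
  rw [← h (none, e) ⟨0, Finset.mem_union_left _ hs.2.1, cell_zero ▸ he, Or.inr ⟨rfl, ?_⟩⟩]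
  · exact h1 e he
  · induction e with
    | _ x y => exact ⟨x, Sym2.mem_mk_left _ _, hs.1 (mk_mem_edgesIn.1 he).1⟩

theorem measurableSet_startOpen_run (l : List (Nd d)) (σ : Explored d) :
    MeasurableSet (startOpen d m n ∩ {ω | run m n o ω l = σ}) :=
  (depOn_startOpen_run l σ).measurableSet (seen_finite σ)

theorem disjoint_seen_place {σ : Explored d} {z : Nd d} {θ : Frame d} (h1 : z ∉ σ.2.1)
    (h2 : z ∉ σ.2.2) (hf : Fits m n o σ.1 z θ) :
    Disjoint (seen m n σ) (place (color z) θ '' trialCoord m n (θ.map ⁻¹' σ.1)) := by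
  refine Set.disjoint_left.2 ?_
  rintro _ ⟨z', hz', he', h⟩ ⟨i, hi, rfl⟩
  rcases hi with ⟨e, he, rfl⟩ | ⟨e, he, rfl⟩
  · rcases h with h | ⟨-, v, hv, hvσ⟩
    · exact Option.some_ne_none _ h.symm
    · obtain ⟨x, hx, rfl⟩ := Sym2.mem_map.1 hv
      exact (he x hx).2 hvσ
  · rcases h with h | ⟨h, -⟩
    · have hc : color z = color z' := Option.some_injective _ h
      have hne : z ≠ z' := by
        rintro rfl
        rcases Finset.mem_union.1 hz' with h | h
        · exact h1 h
        · exact h2 h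
      induction e with
      | _ x y =>
        have hx : θ.map x ∈ cell (n + m + 1) z := hf.map_mem_cell (mk_mem_edgesIn.1 he).1
        have hx' : θ.map x ∈ cell (n + m + 1) z' := he' _ (by simp [place])
        exact Set.disjoint_left.1 (disjoint_cell (by omega) hne hc) hx hx'
    · exact Option.some_ne_none _ h

/-- The probabilities of the layers. -/
def layers (d : ℕ) (p δ : unitInterval) (c : Option (Color d)) : unitInterval :=
  c.elim p fun _ => δ

theorem startOpen_run_fail_le {p δ : unitInterval} {ε : ℝ}
    (htrial : ∀ A : Set (Zd d), box d m ⊆ A →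
      (bern (layerProb (Sym2 (Zd d)) p δ)).real {ω | seedPts m n o A ω = ∅} ≤ ε)
    (l : List (Nd d)) {σ : Explored d} {z : Nd d} {θ : Frame d} (h1 : z ∉ σ.2.1)
    (h2 : z ∉ σ.2.2) (hf : Fits m n o σ.1 z θ) :
    (bern fun i : Option (Color d) × Sym2 (Zd d) => layers d p δ i.1).real
      (startOpen d m n ∩ {ω | run m n o ω l = σ} ∩
        {ω | seedPts m n o (θ.map ⁻¹' σ.1) (localConf (color z) θ ω) = ∅}) ≤
    ε * (bern fun i : Option (Color d) × Sym2 (Zd d) => layers d p δ i.1).real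
      (startOpen d m n ∩ {ω | run m n o ω l = σ}) := by
  have hd := depOn_seedPts_eq_empty (m := m) (n := n) (o := o) (A := θ.map ⁻¹' σ.1)
  have hm := hd.measurableSet trialCoord_finite
  have hi := bern_inter (fun i : Option (Color d) × Sym2 (Zd d) => layers d p δ i.1)
    (depOn_startOpen_run (o := o) l σ) (hd.preimage (place (color z) θ))
    (disjoint_seen_place h1 h2 hf) (measurableSet_startOpen_run l σ)
    (measurable_reindex _ hm)
  rw [bern_preimage_comp _ (place_injective _ _) hm] at hi
  refine hi.le.trans ?_
  rw [mul_comm]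
  refine mul_le_mul_of_nonneg_right ?_ measureReal_nonneg
  have : (fun k => layers d p δ (place (color z) θ k).1) = layerProb (Sym2 (Zd d)) p δ := by
    funext k
    obtain ⟨b, e⟩ := k
    cases b <;> rfl
  rw [this]
  exact htrial _ fun x hx => hf.1 x hx

theorem startOpen_subset_fail_le {p δ : unitInterval} {ε : ℝ} (hε : 0 ≤ ε)
    (htrial : ∀ A : Set (Zd d), box d m ⊆ A →
      (bern (layerProb (Sym2 (Zd d)) p δ)).real {ω | seedPts m n o A ω = ∅} ≤ ε)
    (l : List (Nd d)) (T : Finset (Nd d)) :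
    (bern fun i : Option (Color d) × Sym2 (Zd d) => layers d p δ i.1)
      (startOpen d m n ∩ {ω | T ⊆ (run m n o ω l).2.2}) ≤
    ENNReal.ofReal ε ^ T.card *
      (bern fun i : Option (Color d) × Sym2 (Zd d) => layers d p δ i.1) (startOpen d m n) := by
  classical
  set μ := bern fun i : Option (Color d) × Sym2 (Zd d) => layers d p δ i.1 with hμ
  have key : ∀ l : List (Nd d), ∫⁻ ω in startOpen d m n,
      failWt (ENNReal.ofReal ε) T (run m n o ω l).2.2 (run m n o ω l).2.1 ∂μ ≤
      ENNReal.ofReal ε ^ T.card * μ (startOpen d m n) := by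
    intro l
    induction l with
    | nil =>
      rw [← setLIntegral_const]
      refine lintegral_mono fun ω => ?_
      simp only [run, failWt, Finset.sdiff_empty]
      split_ifs
      · exact le_rfl
      · exact zero_le
    | cons z l ih =>
      refine le_trans (lintegral_failWt_le μ (S := fun ω => run m n o ω l)
        (S' := fun ω => run m n o ω (z :: l)) (measurableSet_startOpen_run l)
        (fun σ => σ.2.2) (fun σ => σ.2.1) _ z (fun σ => ?_) T) ih
      by_cases hr : Ready m n o z σ
      · obtain ⟨θ, hf, hθ⟩ := exists_explore_eq hr
        have hd := depOn_seedPts_eq_empty (m := m) (n := n) (o := o) (A := θ.map ⁻¹' σ.1)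
        refine Or.inr ⟨hr.2.1, {ω | seedPts m n o (θ.map ⁻¹' σ.1) (localConf (color z) θ ω) = ∅},
          measurable_reindex _ (hd.measurableSet trialCoord_finite), ?_, ?_, ?_⟩
        · have := startOpen_run_fail_le htrial l hr.1 hr.2.1 hf
          rw [← ENNReal.ofReal_toReal (measure_ne_top μ (_ ∩ _ ∩ _)),
            ← ENNReal.ofReal_toReal (measure_ne_top μ (startOpen d m n ∩ _)),
            ← ENNReal.ofReal_mul hε]
          exact ENNReal.ofReal_le_ofReal this
        · intro ω hω hσ
          have : run m n o ω (z :: l) = advance m n o θ z σ (localConf (color z) θ ω) := by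
            rw [← hθ, ← hσ]
            rfl
          rw [this, advance_snd_of_eq_empty hω]
          exact ⟨rfl, rfl⟩
        · intro ω hω hσ
          have : run m n o ω (z :: l) = advance m n o θ z σ (localConf (color z) θ ω) := by
            rw [← hθ, ← hσ]
            rfl
          rw [this, advance_snd_of_ne_empty hω]
          exact ⟨rfl, rfl⟩
      · refine Or.inl fun ω hω => ?_
        change explore m n o ω z (run m n o ω l) = σ
        rw [hω, explore_of_not_ready hr]
  refine le_trans ?_ (key l)
  have hm : MeasurableSet (startOpen d m n ∩ {ω | T ⊆ (run m n o ω l).2.2}) := by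
    have : startOpen d m n ∩ {ω | T ⊆ (run m n o ω l).2.2} = ⋃ σ ∈ {σ : Explored d | T ⊆ σ.2.2},
        startOpen d m n ∩ {ω | run m n o ω l = σ} := by
      ext ω
      simp
    rw [this]
    exact MeasurableSet.biUnion (Set.to_countable _) fun σ _ => measurableSet_startOpen_run l σ
  calc μ (startOpen d m n ∩ {ω | T ⊆ (run m n o ω l).2.2})
      = ∫⁻ ω in startOpen d m n ∩ {ω | T ⊆ (run m n o ω l).2.2}, 1 ∂μ := by simp
    _ ≤ ∫⁻ ω in startOpen d m n ∩ {ω | T ⊆ (run m n o ω l).2.2},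
          failWt (ENNReal.ofReal ε) T (run m n o ω l).2.2 (run m n o ω l).2.1 ∂μ := by
        refine setLIntegral_mono' hm fun ω hω => ?_
        have h1 : T \ (run m n o ω l).2.2 = ∅ := Finset.sdiff_eq_empty_iff_subset.2 hω.2
        rw [failWt, if_pos ((run_start ω l).2.2.symm.mono_left hω.2), h1]
        simp
    _ ≤ _ := lintegral_mono_set Set.inter_subset_left

end Failure

/-! ### Progress of the exploration -/

section Progress

variable {d m n : ℕ} {o : Fin d}

theorem sgm_sub_apply (a : Zd d) (π : Equiv.Perm (Fin d)) (ε : Fin d → ℤˣ) (x y : Zd d)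
    (j : Fin d) : |sgm a π ε x j - sgm a π ε y j| = |x (π j) - y (π j)| := by
  rw [← abs_units_mul (ε j) (x (π j) - y (π j))]
  simp only [sgm]
  congr 1
  ring

theorem exists_fits {R : Finset (Zd d)} {z z' : Nd d} {a : Zd d}
    (ha : ∀ j, |a j - (n + m + 1 : ℕ) * z j| ≤ (n + m + 1 : ℕ))
    (hR : ∀ x, x - a ∈ box d m → x ∈ R) (hz : nadj z z') : ∃ θ, Fits m n o R z' θ := by
  obtain ⟨i, hi⟩ := hz
  obtain ⟨s, hs⟩ : ∃ s : ℤˣ, ∀ j, (z' j : ℤ) = z j + (Pi.single i (s : ℤ) : Zd d) j := by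
    rcases hi with rfl | rfl
    · refine ⟨1, fun j => ?_⟩
      by_cases hj : j = i
      · subst hj
        simp
      · simp [Pi.single_eq_of_ne hj]
    · refine ⟨-1, fun j => ?_⟩
      by_cases hj : j = i
      · subst hj
        simp
      · simp [Pi.single_eq_of_ne hj]
  let ε : Fin d → ℤˣ := fun j =>
    if j = i then s else if 0 < a j - (n + m + 1 : ℕ) * z j then -1 else 1
  refine ⟨(a, Equiv.swap i o, ε), fun x hx => hR _ fun j => ?_, fun j => ?_, fun y hy j => ?_⟩
  · have := hx (Equiv.swap i o j)
    simp only [Frame.map, sgm, Pi.sub_apply, add_sub_cancel_left, abs_units_mul]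
    exact this
  · have h1 := ha j
    rw [hs j]
    by_cases hj : j = i
    · subst hj
      rw [Pi.single_eq_same]
      rcases Int.units_eq_one_or s with rfl | rfl
      · rw [abs_le] at h1 ⊢
        push_cast at h1 ⊢
        constructor <;> linarith [h1.1, h1.2]
      · rw [abs_le] at h1 ⊢
        push_cast at h1 ⊢
        constructor <;> linarith [h1.1, h1.2]
    · rw [Pi.single_eq_of_ne hj, add_zero]
      linarith [abs_nonneg (a j - (n + m + 1 : ℕ) * (z j : ℤ))]
  · have h1 := ha j
    rw [hs j]
    by_cases hj : j = i
    · subst hj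
      simp only [Frame.map, sgm, ε, Equiv.swap_apply_left, if_true, Pi.add_apply,
        Pi.single_eq_same, hy.1]
      rcases Int.units_eq_one_or s with rfl | rfl
      · rw [abs_le] at h1 ⊢
        push_cast at h1 ⊢
        constructor <;> linarith [h1.1, h1.2]
      · rw [abs_le] at h1 ⊢
        push_cast at h1 ⊢
        constructor <;> linarith [h1.1, h1.2]
    · have hne : Equiv.swap i o j ≠ o := by
        by_cases hjo : j = o
        · subst hjo
          rw [Equiv.swap_apply_right]
          exact fun h => hj h.symm
        · rw [Equiv.swap_apply_of_ne_of_ne hj hjo]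
          exact hjo
      have h2 := hy.2 (Equiv.swap i o j)
      simp only [Frame.map, sgm, ε, if_neg hj, Pi.add_apply, Pi.single_eq_of_ne hne,
        Pi.single_eq_of_ne hj, add_zero]
      rw [abs_le] at h1 ⊢
      split_ifs with h
      · push_cast at h h1 ⊢
        constructor <;> linarith [h1.1, h1.2, h2.1, h2.2]
      · push_cast at h h1 ⊢
        constructor <;> linarith [h1.1, h1.2, h2.1, h2.2]

/-- Every successful site has a fully explored seed. -/
theorem exists_center (ω : Layered d) (l : List (Nd d)) {z : Nd d}
    (hz : z ∈ (run m n o ω l).2.1) :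
    ∃ a : Zd d, (∀ j, |a j - (n + m + 1 : ℕ) * z j| ≤ (n + m + 1 : ℕ)) ∧
      ∀ x, x - a ∈ box d m → x ∈ (run m n o ω l).1 := by
  induction l with
  | nil =>
    have : z = 0 := by simpa [run] using hz
    subst this
    refine ⟨0, fun j => by simp; omega, fun x hx => ?_⟩
    rw [sub_zero] at hx
    exact (Set.Finite.mem_toFinset _).2 (box_mono (by omega) hx)
  | cons w l ih =>
    have hmono := subset_explore (m := m) (n := n) (o := o) ω w (run m n o ω l)
    by_cases hz' : z ∈ (run m n o ω l).2.1
    · obtain ⟨a, h1, h2⟩ := ih hz'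
      exact ⟨a, h1, fun x hx => hmono.1 (h2 x hx)⟩
    change z ∈ (explore m n o ω w (run m n o ω l)).2.1 at hz
    change ∃ a : Zd d, _ ∧ ∀ x, x - a ∈ box d m → x ∈ (explore m n o ω w (run m n o ω l)).1
    by_cases hr : Ready m n o w (run m n o ω l)
    · obtain ⟨θ, hf, hθ⟩ := exists_explore_eq hr
      rw [hθ] at hz ⊢
      by_cases he : seedPts m n o (θ.map ⁻¹' (run m n o ω l).1) (localConf (color w) θ ω) = ∅
      · rw [advance_snd_of_eq_empty he] at hz
        exact absurd hz hz'
      · rw [advance_snd_of_ne_empty he] at hz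
        obtain rfl : z = w := (Finset.mem_insert.1 hz).resolve_right hz'
        obtain ⟨y, hy⟩ := Set.nonempty_iff_ne_empty.2 he
        refine ⟨_, hf.2.2 y hy.1, fun x hx => ?_⟩
        obtain ⟨v, rfl⟩ : ∃ v, θ.map v = x := sgm_surjective _ _ _ x
        rw [← Finset.mem_coe, advance_fst]
        refine Or.inr ⟨v, Or.inr (Set.mem_iUnion₂.2 ⟨y, hy, fun j => ?_⟩), rfl⟩
        have := hx (θ.2.1.symm j)
        rw [Pi.sub_apply, Frame.map, sgm_sub_apply, Equiv.apply_symm_apply] at this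
        exact this
    · rw [explore_of_not_ready hr] at hz
      exact absurd hz hz'

theorem subset_run_append (ω : Layered d) (l' l : List (Nd d)) :
    (run m n o ω l).1 ⊆ (run m n o ω (l' ++ l)).1 ∧
      (run m n o ω l).2.1 ⊆ (run m n o ω (l' ++ l)).2.1 ∧
      (run m n o ω l).2.2 ⊆ (run m n o ω (l' ++ l)).2.2 := by
  induction l' with
  | nil => exact ⟨subset_rfl, subset_rfl, subset_rfl⟩
  | cons z l' ih =>
    have h := subset_explore (m := m) (n := n) (o := o) ω z (run m n o ω (l' ++ l))
    exact ⟨ih.1.trans h.1, ih.2.1.trans h.2.1, ih.2.2.trans h.2.2⟩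

theorem mem_run_append {ω : Layered d} {l' l : List (Nd d)} {z : Nd d} (hz : z ∈ l')
    (hf : ∃ θ, Fits m n o (run m n o ω l).1 z θ) :
    z ∈ (run m n o ω (l' ++ l)).2.1 ∪ (run m n o ω (l' ++ l)).2.2 := by
  induction l' with
  | nil => simp at hz
  | cons w l' ih =>
    have h := subset_explore (m := m) (n := n) (o := o) ω w (run m n o ω (l' ++ l))
    rcases List.mem_cons.1 hz with rfl | hz
    · by_cases hr : Ready m n o z (run m n o ω (l' ++ l))
      · exact mem_explore_of_ready hr
      · obtain ⟨θ, h1, h2⟩ := hf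
        refine Finset.union_subset_union h.2.1 h.2.2 ?_
        by_contra hnot
        rw [Finset.mem_union, not_or] at hnot
        exact hr ⟨hnot.1, hnot.2, θ, fun x hx => (subset_run_append ω l' l).1 (h1 x hx), h2⟩
    · exact Finset.union_subset_union h.2.1 h.2.2 (ih hz)

/-- The sites tested in round `q`: those of a given colour in a box of side `q`. -/
noncomputable def roundSites (d q : ℕ) : Finset (Nd d) :=
  (Fintype.piFinset fun _ => Finset.range (q + 1)).filter fun z =>
    (Fintype.equivFin (Color d) (color z) : ℕ) = q % Fintype.card (Color d)

/-- The sites tested before round `q`, last site first. -/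
noncomputable def sched (d : ℕ) : ℕ → List (Nd d)
  | 0 => []
  | q + 1 => (roundSites d q).toList ++ sched d q

theorem color_eq_of_mem_roundSites {q : ℕ} {z z' : Nd d} (h : z ∈ roundSites d q)
    (h' : z' ∈ roundSites d q) : color z = color z' :=
  (Fintype.equivFin (Color d)).injective (Fin.ext
    ((Finset.mem_filter.1 h).2.trans (Finset.mem_filter.1 h').2.symm))

theorem exists_mem_roundSites (q : ℕ) {z : Nd d} (hz : ∀ j, z j ≤ q) :
    ∃ q' ≥ q, q' < q + Fintype.card (Color d) ∧ z ∈ roundSites d q' := by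
  set J := Fintype.card (Color d)
  have hc : (Fintype.equivFin (Color d) (color z) : ℕ) < J := Fin.is_lt _
  set c := (Fintype.equivFin (Color d) (color z) : ℕ)
  have hq := Nat.div_add_mod q J
  have hq' := Nat.mod_lt q (Nat.zero_lt_of_lt hc)
  have key : ∀ q' ≥ q, q' % J = c → z ∈ roundSites d q' := by
    intro q' hle h
    refine Finset.mem_filter.2 ⟨Fintype.mem_piFinset.2 fun j => ?_, h.symm⟩
    exact Finset.mem_range.2 (by have := hz j; omega)
  have hmod : ∀ k, (J * k + c) % J = c := fun k => by
    rw [Nat.mul_add_mod, Nat.mod_eq_of_lt hc]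
  by_cases h : q % J ≤ c
  · exact ⟨J * (q / J) + c, by omega, by omega, key _ (by omega) (hmod _)⟩
  · refine ⟨J * (q / J + 1) + c, ?_, ?_, key _ ?_ (hmod _)⟩ <;> rw [Nat.mul_add, mul_one] <;> omega

theorem subset_run_sched (ω : Layered d) {q q' : ℕ} (h : q ≤ q') :
    (run m n o ω (sched d q)).1 ⊆ (run m n o ω (sched d q')).1 ∧
      (run m n o ω (sched d q)).2.1 ⊆ (run m n o ω (sched d q')).2.1 ∧
      (run m n o ω (sched d q)).2.2 ⊆ (run m n o ω (sched d q')).2.2 := by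
  induction h with
  | refl => exact ⟨subset_rfl, subset_rfl, subset_rfl⟩
  | @step q' _ ih =>
    have h := subset_run_append (m := m) (n := n) (o := o) ω (roundSites d q').toList (sched d q')
    exact ⟨ih.1.trans h.1, ih.2.1.trans h.2.1, ih.2.2.trans h.2.2⟩

variable (m n o) in
/-- The sites that eventually fail. -/
def failed (ω : Layered d) : Set (Nd d) := {z | ∃ q, z ∈ (run m n o ω (sched d q)).2.2}

theorem mem_success_of_reach {ω : Layered d} {k : ℕ} {x : Nd d}
    (h : reach (onSet nadj (failed m n o ω)ᶜ) k 0 x) :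
    (∀ j, x j ≤ k) ∧
      x ∈ (run m n o ω (sched d ((k + 1) * Fintype.card (Color d)))).2.1 := by
  have hJ : 0 < Fintype.card (Color d) := Fintype.card_pos
  set J := Fintype.card (Color d) with hJd
  induction k generalizing x with
  | zero =>
    cases h
    exact ⟨fun j => le_rfl, (run_start ω _).2.1⟩
  | succ k ih =>
    have hle : (k + 1) * J ≤ (k + 1 + 1) * J := Nat.mul_le_mul_right _ (by omega)
    rcases h with h | ⟨z, h, hzx⟩
    · obtain ⟨h1, h2⟩ := ih h
      exact ⟨fun j => (h1 j).trans (by omega), (subset_run_sched ω hle).2.1 h2⟩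
    · obtain ⟨h1, h2⟩ := ih h
      have hx : ∀ j, x j ≤ k + 1 := by
        intro j
        have := h1 j
        obtain ⟨i, hi⟩ := hzx.1
        by_cases hj : j = i
        · subst hj
          rcases hi with rfl | rfl
          · simpa using this
          · simp at this
            omega
        · rcases hi with rfl | rfl
          · simp [Pi.single_eq_of_ne hj]
            omega
          · simp [Pi.single_eq_of_ne hj] at this
            omega
      refine ⟨hx, ?_⟩
      have hkJ : k + 1 ≤ (k + 1) * J := Nat.le_mul_of_pos_right _ hJ
      obtain ⟨q', hq, hq', hmem⟩ := exists_mem_roundSites ((k + 1) * J)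
        (fun j => (hx j).trans hkJ)
      obtain ⟨a, ha, haR⟩ := exists_center ω _ ((subset_run_sched ω hq).2.1 h2)
      have h3 := mem_run_append (Finset.mem_toList.2 hmem) (exists_fits (o := o) ha haR hzx.1)
      change x ∈ (run m n o ω (sched d (q' + 1))).2.1 ∪ (run m n o ω (sched d (q' + 1))).2.2 at h3
      rcases Finset.mem_union.1 h3 with h3 | h3
      · refine (subset_run_sched ω ?_).2.1 h3
        have : (k + 1 + 1) * J = (k + 1) * J + J := by ring
        omega
      · exact absurd ⟨_, h3⟩ hzx.2.2

end Progress

/-! ### Distances to the explored vertices -/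

section Distance

variable {d m n : ℕ} {o : Fin d}

theorem onSet_openAdj_symm {ω : Config d} {U : Set (Zd d)} (x y : Zd d)
    (h : onSet (openAdj ω) U x y) : onSet (openAdj ω) U y x :=
  ⟨openAdj_comm.1 h.1, h.2.2, h.2.1⟩

theorem openAdj_superpose_map {ω : Layered d} {c : Color d} {θ : Frame d} {x y : Zd d}
    (h : openAdj (fun e => localConf c θ ω (true, e) || localConf c θ ω (false, e)) x y) :
    openAdj (superpose ω) (θ.map x) (θ.map y) := by
  refine ⟨(latAdj_sgm _ _ _ _ _).2 h.1, decide_eq_true ?_⟩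
  rcases Bool.or_eq_true_iff.1 h.2 with h2 | h2
  · exact ⟨none, h2⟩
  · exact ⟨some c, h2⟩

theorem cell_subset (N : ℕ) (o : Fin d) (z : Nd d) :
    cell N z ⊆ {x | -(4 * N : ℤ) ≤ x o} := by
  intro x hx
  have h1 := (abs_le.1 (hx o)).1
  have h2 : (0 : ℤ) ≤ N * z o := by positivity
  change -(4 * N : ℤ) ≤ x o
  linarith

variable (m n) in
/-- A bound for the length of a path inside one cell. -/
noncomputable def cellSize (d : ℕ) : ℕ := (box_finite d (4 * (n + m + 1))).toFinset.card

variable (m n o) in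
/-- Open steps of the superposed configuration in a half-space. -/
def halfStep (ω : Layered d) : Zd d → Zd d → Prop :=
  onSet (openAdj (superpose ω)) {x | -(4 * (n + m + 1 : ℕ) : ℤ) ≤ x o}

theorem exists_reach_of_mem_explore {ω : Layered d} {z : Nd d} {σ : Explored d} {x : Zd d}
    (hx : x ∈ (explore m n o ω z σ).1) (hxσ : x ∉ σ.1) :
    x ∈ cell (n + m + 1) z ∧ ∃ w ∈ σ.1, w ∈ cell (n + m + 1) z ∧
      reach (halfStep m n o ω) (cellSize m n d) w x := by
  by_cases hr : Ready m n o z σ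
  · obtain ⟨θ, hf, hθ⟩ := exists_explore_eq hr
    rw [hθ, ← Finset.mem_coe, advance_fst] at hx
    obtain ⟨v, hv, rfl⟩ := hx.resolve_left hxσ
    obtain ⟨u, hu, huv⟩ := exists_reach_of_mem_gain hv
    have hub : u ∈ box d (2 * (n + m + 1)) := box_mono (by omega) hu.2
    refine ⟨hf.map_mem_cell (gain_subset hv), θ.map u, hu.1, hf.map_mem_cell hub, ?_⟩
    have hbox := (box_finite d (2 * (n + m + 1))).coe_toFinset
    rw [← hbox] at huv
    have hreach := reach_of_reflTransGen_of_finite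
      ((Set.Finite.mem_toFinset _).2 hub) huv
    rw [hbox] at hreach
    refine (hreach.map θ.map fun a b hab => ?_).mono_len (Finset.card_le_card ?_)
    · exact ⟨openAdj_superpose_map hab.1, cell_subset _ o z (hf.map_mem_cell hab.2.1),
        cell_subset _ o z (hf.map_mem_cell hab.2.2)⟩
    · exact Set.Finite.toFinset_subset_toFinset.2 (box_mono (by omega))
  · rw [explore_of_not_ready hr] at hx
    exact absurd hx hxσ

theorem reach_of_mem_run_append {ω : Layered d} {b : Zd d} {t : ℕ} {l L : List (Nd d)}
    (hl : ∀ u ∈ (run m n o ω l).1, reach (halfStep m n o ω) t b u)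
    (hL : L.Nodup) (hc : ∀ z ∈ L, ∀ z' ∈ L, color z = color z') :
    ∀ u ∈ (run m n o ω (L ++ l)).1, reach (halfStep m n o ω) t b u ∨
      (∃ z ∈ L, u ∈ cell (n + m + 1) z) ∧
        reach (halfStep m n o ω) (t + cellSize m n d) b u := by
  induction L with
  | nil => exact fun u hu => Or.inl (hl u hu)
  | cons z L ih =>
    have ih := ih hL.of_cons fun w hw w' hw' =>
      hc w (List.mem_cons_of_mem _ hw) w' (List.mem_cons_of_mem _ hw')
    intro u hu
    by_cases hu' : u ∈ (run m n o ω (L ++ l)).1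
    · exact (ih u hu').imp_right fun ⟨⟨w, hw, huw⟩, h⟩ => ⟨⟨w, List.mem_cons_of_mem _ hw, huw⟩, h⟩
    · obtain ⟨huz, w, hw, hwz, hwu⟩ := exists_reach_of_mem_explore hu hu'
      refine Or.inr ⟨⟨z, List.mem_cons_self, huz⟩, ?_⟩
      rcases ih w hw with h | ⟨⟨z', hz', hwz'⟩, -⟩
      · exact h.trans hwu
      · refine absurd hwz' (Set.disjoint_left.1 (disjoint_cell (Nat.succ_pos _) ?_ ?_) hwz)
        · rintro rfl
          exact (List.nodup_cons.1 hL).1 hz'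
        · exact hc _ List.mem_cons_self _ (List.mem_cons_of_mem _ hz')

theorem reach_of_mem_run_sched {ω : Layered d} (hω : ω ∈ startOpen d m n) {b : Zd d}
    (hb : b ∈ box d (4 * (n + m + 1))) (q : ℕ) :
    ∀ u ∈ (run m n o ω (sched d q)).1,
      reach (halfStep m n o ω) ((q + 2) * cellSize m n d) b u := by
  induction q with
  | zero =>
    intro u hu
    have hu' : u ∈ box d (4 * (n + m + 1)) := (Set.Finite.mem_toFinset _).1 hu
    have hopen : ∀ e ∈ edgesIn {x : Zd d | x - 0 ∈ box d (4 * (n + m + 1))},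
        superpose ω e = true := by
      intro e he
      simp only [sub_zero] at he
      exact decide_eq_true ⟨none, hω e he⟩
    have key : ∀ v ∈ box d (4 * (n + m + 1)), reach (halfStep m n o ω) (cellSize m n d) 0 v := by
      intro v hv
      have hbox := (box_finite d (4 * (n + m + 1))).coe_toFinset
      have h := reflTransGen_of_forall_edgesIn (U := box d (4 * (n + m + 1))) hopen
        (fun x hx => by rwa [Set.mem_ofPred_eq, sub_zero] at hx) (x := v)
        (by rwa [sub_zero])
      rw [← hbox] at h
      have h2 := reach_of_reflTransGen_of_finite
        ((Set.Finite.mem_toFinset _).2 (zero_mem_box d _)) h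
      rw [hbox] at h2
      have hsub : box d (4 * (n + m + 1)) ⊆ {x | -(4 * (n + m + 1 : ℕ) : ℤ) ≤ x o} := by
        rw [← cell_zero]
        exact cell_subset _ o 0
      exact h2.mono fun x y hxy => ⟨hxy.1, hsub hxy.2.1, hsub hxy.2.2⟩
    have h := ((key b hb).symm onSet_openAdj_symm).trans (key u hu')
    exact h.mono_len (by omega)
  | succ q ih =>
    intro u hu
    rcases reach_of_mem_run_append ih (Finset.nodup_toList _) (fun z hz z' hz' =>
      color_eq_of_mem_roundSites (Finset.mem_toList.1 hz) (Finset.mem_toList.1 hz')) u hu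
      with h | ⟨-, h⟩
    · exact h.mono_len (Nat.mul_le_mul_right _ (by omega))
    · exact h.mono_len (by ring_nf; omega)

end Distance

/-! ### Growth from sparsity of the failed sites -/

section Growth

variable {d m n : ℕ} {o : Fin d}

theorem eq_of_center {N : ℕ} (hN : 0 < N) {x y : Nd d} {a : Zd d}
    (hx : ∀ j, |a j - N * x j| ≤ N) (hy : ∀ j, |a j - N * y j| ≤ N)
    (hmod : ∀ j, (x j : ZMod 3) = y j) : x = y := by
  funext j
  have h1 : x j ≡ y j [MOD 3] := (ZMod.natCast_eq_natCast_iff _ _ _).1 (hmod j)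
  have h2 := abs_le.1 (hx j)
  have h3 := abs_le.1 (hy j)
  have hN' : (0 : ℤ) < N := by exact_mod_cast hN
  by_contra hne
  have h4 : (x j : ℤ) + 3 ≤ y j ∨ (y j : ℤ) + 3 ≤ x j := by
    unfold Nat.ModEq at h1
    omega
  rcases h4 with h | h <;> nlinarith

/-- The rate at which chemical distances in the explored region exceed coarse distances. -/
noncomputable def slowness (d m n : ℕ) : ℕ :=
  2 * (3 * ((d + 3) * 8 + 3 ^ d)) * (Fintype.card (Color d) + 1) * cellSize m n d

theorem slowness_pos (d m n : ℕ) : 0 < slowness d m n := by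
  have h : 0 < cellSize m n d :=
    Finset.card_pos.2 ⟨0, (Set.Finite.mem_toFinset _).2 (zero_mem_box d _)⟩
  unfold slowness
  positivity

theorem dyadic_growth (hd : 2 ≤ d) {ω : Layered d} (hω : ω ∈ startOpen d m n)
    (hF : ∀ k, Sparse (failed m n o ω) k) {b : Zd d} (hb : b ∈ box d (4 * (n + m + 1))) (k : ℕ) :
    (8 * 2 ^ k) ^ d ≤
      2 * 3 ^ d * {u | reach (halfStep m n o ω) (slowness d m n * 2 ^ k) b u}.ncard := by
  have hcount := sparse_growth hd hF k
  set A := 3 * ((d + 3) * 8 + 3 ^ d) with hA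
  set S := {x : Nd d | (∀ i, x i < 8 * 2 ^ k) ∧
    reach (onSet nadj (failed m n o ω)ᶜ) (A * 2 ^ k) 0 x} with hS
  set R := {u | reach (halfStep m n o ω) (slowness d m n * 2 ^ k) b u} with hR
  have hRfin : R.Finite := reach_openAdj_finite _ _ _ _
  have hcenter : ∀ x ∈ S, ∃ a ∈ R, ∀ j, |a j - (n + m + 1 : ℕ) * x j| ≤ (n + m + 1 : ℕ) := by
    intro x hx
    obtain ⟨a, ha, haR⟩ := exists_center ω _ (mem_success_of_reach hx.2).2
    refine ⟨a, ?_, ha⟩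
    have h1 := reach_of_mem_run_sched hω hb _ a (haR a (by rw [sub_self]; exact zero_mem_box d m))
    refine h1.mono_len ?_
    have h2 : 1 ≤ A * 2 ^ k := Nat.mul_pos (by positivity) (by positivity)
    calc ((A * 2 ^ k + 1) * Fintype.card (Color d) + 2) * cellSize m n d
        ≤ (2 * (A * 2 ^ k) * (Fintype.card (Color d) + 1)) * cellSize m n d := by
          refine Nat.mul_le_mul_right _ ?_
          nlinarith [Nat.zero_le (Fintype.card (Color d))]
      _ = slowness d m n * 2 ^ k := by rw [slowness, ← hA]; ring
  choose! a haR ha using hcenter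
  have hle : S.ncard ≤ (R ×ˢ (Set.univ : Set (Fin d → ZMod 3))).ncard := by
    refine Set.ncard_le_ncard_of_injOn (fun x => (a x, fun j => (x j : ZMod 3)))
      (fun x hx => ⟨haR x hx, Set.mem_univ _⟩) ?_ (hRfin.prod Set.finite_univ)
    intro x hx y hy hxy
    obtain ⟨h1, h2⟩ := Prod.ext_iff.1 hxy
    have h1 : a x = a y := h1
    refine eq_of_center (Nat.succ_pos _) (ha x hx) ?_ (congrFun h2)
    rw [h1]
    exact ha y hy
  rw [Set.ncard_prod, Set.ncard_univ, Nat.card_eq_fintype_card, Fintype.card_fun, ZMod.card,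
    Fintype.card_fin] at hle
  calc (8 * 2 ^ k) ^ d ≤ 2 * S.ncard := hcount
    _ ≤ 2 * (R.ncard * 3 ^ d) := Nat.mul_le_mul_left _ hle
    _ = 2 * 3 ^ d * R.ncard := by ring

/-- The growth constant obtained from the exploration. -/
noncomputable def growthRate (d m n : ℕ) : ℝ := (4 / slowness d m n) ^ d / (2 * 3 ^ d)

theorem growthRate_pos (d m n : ℕ) : 0 < growthRate d m n := by
  have : (0 : ℝ) < slowness d m n := by exact_mod_cast slowness_pos d m n
  unfold growthRate
  positivity

theorem mem_grow_of_sparse (hd : 2 ≤ d) {ω : Layered d} (hω : ω ∈ startOpen d m n)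
    (hF : ∀ k, Sparse (failed m n o ω) k) {b : Zd d} (hb : b ∈ box d (4 * (n + m + 1))) :
    superpose ω ∈ Grow (growthRate d m n) {x | -(4 * (n + m + 1 : ℕ) : ℤ) ≤ x o} b := by
  set M := slowness d m n with hM
  have hMpos : 0 < M := slowness_pos d m n
  refine ⟨M, fun R hR => ?_⟩
  have hq : R / M ≠ 0 := (Nat.div_pos hR hMpos).ne'
  set k := Nat.log 2 (R / M)
  have hlow : M * 2 ^ k ≤ R :=
    (Nat.mul_le_mul_left M (Nat.pow_log_le_self 2 hq)).trans (Nat.mul_div_le R M)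
  have hupp : R ≤ M * 2 ^ (k + 1) := by
    have h1 : R / M < 2 ^ (k + 1) := Nat.lt_pow_succ_log_self (by norm_num) _
    rw [Nat.div_lt_iff_lt_mul hMpos] at h1
    rw [mul_comm]
    exact h1.le
  have hgrow := dyadic_growth hd hω hF hb k
  have hmono : {u | reach (halfStep m n o ω) (M * 2 ^ k) b u}.ncard ≤
      {u | reach (halfStep m n o ω) R b u}.ncard :=
    Set.ncard_le_ncard (fun u hu => reach.mono_len hu hlow) (reach_openAdj_finite _ _ _ _)
  have hMr : (0 : ℝ) < M := by exact_mod_cast hMpos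
  have h3 : ((8 * 2 ^ k : ℕ) : ℝ) ^ d ≤
      2 * 3 ^ d * {u | reach (halfStep m n o ω) R b u}.ncard := by
    exact_mod_cast hgrow.trans (Nat.mul_le_mul_left _ hmono)
  have h4 : growthRate d m n * (R : ℝ) ^ d ≤ ((8 * 2 ^ k : ℕ) : ℝ) ^ d / (2 * 3 ^ d) := by
    rw [growthRate, ← hM, div_mul_eq_mul_div, ← mul_pow]
    gcongr
    have h5 : (R : ℝ) ≤ M * 2 ^ (k + 1) := by exact_mod_cast hupp
    calc 4 / (M : ℝ) * R ≤ 4 / (M : ℝ) * (M * 2 ^ (k + 1)) := by gcongr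
      _ = ((8 * 2 ^ k : ℕ) : ℝ) := by
        push_cast
        field_simp
        ring
  refine h4.trans ?_
  rw [div_le_iff₀' (by positivity)]
  exact h3

end Growth

/-! ### Supercritical growth -/

section Supercritical

variable {d m n : ℕ} {o : Fin d}

theorem startOpen_failed_le {μ : Measure (Layered d)} {ε : ℝ≥0∞}
    (h : ∀ (l : List (Nd d)) (T : Finset (Nd d)),
      μ (startOpen d m n ∩ {ω | T ⊆ (run m n o ω l).2.2}) ≤ ε ^ T.card * μ (startOpen d m n))
    (T : Finset (Nd d)) :
    μ (startOpen d m n ∩ {ω | (T : Set (Nd d)) ⊆ failed m n o ω}) ≤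
      ε ^ T.card * μ (startOpen d m n) := by
  set A : ℕ → Set (Layered d) :=
    fun q => startOpen d m n ∩ {ω | T ⊆ (run m n o ω (sched d q)).2.2} with hA
  have hmono : Monotone A := fun q q' hq ω hω =>
    ⟨hω.1, Finset.Subset.trans hω.2 (subset_run_sched ω hq).2.2⟩
  have hsub : startOpen d m n ∩ {ω | (T : Set (Nd d)) ⊆ failed m n o ω} ⊆ ⋃ q, A q := by
    rintro ω ⟨h1, h2⟩
    have h2 : ∀ z ∈ T, ∃ q, z ∈ (run m n o ω (sched d q)).2.2 := fun z hz => h2 hz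
    choose! q hq using h2
    refine Set.mem_iUnion.2 ⟨T.sup q, h1, fun z hz => ?_⟩
    exact (subset_run_sched ω (Finset.le_sup hz)).2.2 (hq z hz)
  refine (measure_mono hsub).trans ?_
  rw [hmono.measure_iUnion]
  exact iSup_le fun q => h _ T

theorem startOpen_pos {p δ : unitInterval} (hp : 0 < (p : ℝ)) :
    0 < (bern fun i : Option (Color d) × Sym2 (Zd d) => layers d p δ i.1) (startOpen d m n) := by
  classical
  set s : Finset (Option (Color d) × Sym2 (Zd d)) :=
    (edgesIn_finite (box_finite d (4 * (n + m + 1)))).toFinset.image fun e => (none, e) with hs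
  have h1 : startOpen d m n = {ω : Layered d | ∀ i ∈ s, ω i = (fun _ => true) i} := by
    ext ω
    simp [startOpen, hs]
  rw [pos_iff_ne_zero, Ne, ← measureReal_eq_zero_iff, h1, bern_cyl]
  refine Finset.prod_ne_zero_iff.2 fun i hi => ?_
  obtain ⟨e, -, rfl⟩ := Finset.mem_image.1 hi
  simpa [layers] using hp.ne'

theorem exists_superpose_grow_pos (hd : 2 ≤ d) (o : Fin d) {p δ : unitInterval} (hp : pc d < p)
    (hp0 : 0 < (p : ℝ)) (hp1 : (p : ℝ) < 1) (hδ : 0 < (δ : ℝ)) : ∃ m n,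
    0 < (bern fun i : Option (Color d) × Sym2 (Zd d) => layers d p δ i.1)
      (superpose ⁻¹' Grow (growthRate d m n) {x | -(4 * (n + m + 1 : ℕ) : ℤ) ≤ x o}
        (Pi.single o (-(4 * (n + m + 1 : ℕ) : ℤ)) : Zd d)) := by
  obtain ⟨ε, hε, hsparse⟩ := exists_sparse_threshold d
  obtain ⟨m, n, -, htrial⟩ := exists_trial o hp hp1 hδ hε
  refine ⟨m, n, ?_⟩
  set μ := bern fun i : Option (Color d) × Sym2 (Zd d) => layers d p δ i.1
  have h1 := hsparse μ (startOpen d m n) (failed m n o)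
    (startOpen_failed_le (startOpen_subset_fail_le hε.le htrial))
  have h0 : 0 < μ (startOpen d m n) := startOpen_pos hp0
  have hb : (Pi.single o (-(4 * (n + m + 1 : ℕ) : ℤ)) : Zd d) ∈ box d (4 * (n + m + 1)) := by
    intro j
    by_cases hj : j = o
    · subst hj
      rw [Pi.single_eq_same, abs_neg, abs_of_nonneg (by positivity)]
      push_cast
      exact le_rfl
    · rw [Pi.single_eq_of_ne hj, abs_zero]
      positivity
  have h2 : startOpen d m n ⊆
      (startOpen d m n ∩ {ω | ¬ ∀ k, Sparse (failed m n o ω) k}) ∪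
      superpose ⁻¹' Grow (growthRate d m n) {x | -(4 * (n + m + 1 : ℕ) : ℤ) ≤ x o}
        (Pi.single o (-(4 * (n + m + 1 : ℕ) : ℤ)) : Zd d) := by
    intro ω hω
    by_cases hF : ∀ k, Sparse (failed m n o ω) k
    · exact Or.inr (mem_grow_of_sparse hd hω hF hb)
    · exact Or.inl ⟨hω, hF⟩
  rw [pos_iff_ne_zero]
  intro h3
  have h4 := (measure_mono h2).trans (measure_union_le (μ := μ) _ _)
  rw [h3, add_zero] at h4
  have h5 := h4.trans h1
  rw [mul_comm, ← div_eq_mul_inv] at h5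
  exact absurd h5 (not_le.2 (ENNReal.half_lt_self h0.ne' (measure_ne_top _ _)))

theorem pc_nonneg (d : ℕ) : 0 ≤ pc d := Real.sSup_nonneg fun _ hx => hx.1

theorem exists_layers {p : unitInterval} (hp : pc d < p) : ∃ p' δ : unitInterval,
    pc d < p' ∧ 0 < (p' : ℝ) ∧ (p' : ℝ) < 1 ∧ 0 < (δ : ℝ) ∧
      1 - (p : ℝ) = ∏ c, (1 - (layers d p' δ c : ℝ)) := by
  obtain ⟨q, hq1, hq2⟩ := exists_between hp
  have hp1 := p.2.2
  have hq0 : 0 < q := (pc_nonneg d).trans_lt hq1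
  have hq1' : 0 < 1 - q := by linarith
  set J := Fintype.card (Color d) with hJ
  have hJ0 : J ≠ 0 := Fintype.card_ne_zero
  set x := (1 - (p : ℝ)) / (1 - q) with hx
  have hx0 : 0 ≤ x := div_nonneg (by linarith) hq1'.le
  have hx1 : x < 1 := by
    rw [hx, div_lt_one hq1']
    linarith
  set y := x ^ (J : ℝ)⁻¹ with hy
  have hyJ : y ^ J = x := Real.rpow_inv_natCast_pow hx0 hJ0
  have hy0 : 0 ≤ y := Real.rpow_nonneg hx0 _
  have hy1 : y < 1 := Real.rpow_lt_one hx0 hx1 (by positivity)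
  refine ⟨⟨q, hq0.le, by linarith⟩, ⟨1 - y, by linarith, by linarith⟩, hq1, hq0,
    by linarith, by change 0 < 1 - y; linarith, ?_⟩
  rw [Fintype.prod_option]
  simp only [layers, Option.elim, sub_sub_cancel, Finset.prod_const, Finset.card_univ]
  rw [← hJ, hyJ, hx]
  field_simp

theorem grow_of_pull_translate (c : ℝ) (o : Fin d) (N : ℤ) {ω : Config d}
    (hω : pull (sgm (Pi.single o N : Zd d) 1 1) ω ∈
      Grow c {x | -N ≤ x o} (Pi.single o (-N) : Zd d)) :
    ω ∈ Grow c {x | 0 ≤ x o} 0 := by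
  refine grow_of_pull (fun x hx => ?_) ?_ hω
  · have hx : -N ≤ x o := hx
    change 0 ≤ (Pi.single o N : Zd d) o + _
    simp only [Pi.single_eq_same, Pi.one_apply, Units.val_one, one_mul, Equiv.Perm.one_apply]
    linarith
  · funext j
    by_cases hj : j = o
    · subst hj
      simp [sgm]
    · simp [sgm, Pi.single_eq_of_ne hj]
theorem bern_grow_translate_le (p : unitInterval) (c : ℝ) (o : Fin d) (N : ℤ) :
    (bern fun _ : Sym2 (Zd d) => p).real (Grow c {x | -N ≤ x o} (Pi.single o (-N) : Zd d)) ≤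
      (bern fun _ : Sym2 (Zd d) => p).real (Grow c {x | 0 ≤ x o} 0) := by
  have hmeas := measurableSet_grow c {x : Zd d | -N ≤ x o} (Pi.single o (-N) : Zd d)
  calc _ = _ := (bern_pull p (Pi.single o N : Zd d) 1 1 hmeas).symm
    _ ≤ _ := measureReal_mono fun ω hω => grow_of_pull_translate c o N hω

theorem exists_ae_grow (hd : 2 ≤ d) {p : unitInterval} (hp : pc d < p) : ∃ c > (0 : ℝ),
    ∀ᵐ ω ∂(bern fun _ : Sym2 (Zd d) => p), (cluster ω).Infinite → ω ∈ Grow c Set.univ 0 := by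
  let o : Fin d := ⟨0, by omega⟩
  obtain ⟨p', δ, h1, h2, h3, h4, h5⟩ := exists_layers hp
  obtain ⟨m, n, hpos⟩ := exists_superpose_grow_pos hd o h1 h2 h3 h4
  have hc := growthRate_pos d m n
  refine ⟨growthRate d m n / 2 ^ d, div_pos hc (by positivity),
    ae_grow_of_pos ((pc_nonneg d).trans_lt hp) hc o ?_⟩
  refine lt_of_lt_of_le ?_ (bern_grow_translate_le p _ o (4 * (n + m + 1 : ℕ)))
  rw [← Measure.map_apply measurable_superpose (measurableSet_grow _ _ _),
    bern_map_superpose _ p h5] at hpos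
  exact ENNReal.toReal_pos hpos.ne' (measure_ne_top _ _)

end Supercritical

/-- lower bound for the confinement probability. -/
theorem stmt17 (d : ℕ) (hd : 2 ≤ d) (p : ℝ) (hp : pc d < p) (hp1 : p ≤ 1) :
    ∃ c > (0 : ℝ),
      ∀ Q : Measure (Config d), IsBernoulli p Q →
        ∀ᵐ ω ∂Q, (cluster ω).Infinite →
          ∃ R : ℕ, ∀ r ≥ R, ∀ n ≥ r,
            Real.exp (-c * ((r : ℝ) + (n : ℝ) / (r : ℝ) ^ 2)) ≤
              PWalk ω n (fun γ => ∀ i, chemLE ω (γ i) r) := by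
  obtain ⟨p, rfl⟩ : ∃ q : unitInterval, (q : ℝ) = p :=
    ⟨⟨p, (pc_nonneg d).trans hp.le, hp1⟩, rfl⟩
  obtain ⟨c, hc, hgrow⟩ := exists_ae_grow hd hp
  obtain ⟨C, hC, hconf⟩ := confinement_of_growth (by omega : 1 ≤ d) hc
  refine ⟨C, hC, fun Q hQ => ?_⟩
  rw [hQ.eq_bern]
  filter_upwards [hgrow] with ω hω hinf
  obtain ⟨R, hR⟩ := hω hinf
  refine hconf ω ⟨R, fun r hr => (hR r hr).trans ?_⟩
  rw [Nat.cast_le]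
  exact Set.ncard_le_ncard
    (fun x hx => chemLE_iff.2 (reach.mono hx fun _ _ h => h.1)) (chemBall_finite ω r)

end Perco
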